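/- arXiv:1207.2414 — 4 statements merged into one kernel-verified Lean document; each statement's English description precedes it below -/
import Mathlib

section
/- Let W ∈ C²(ℝ) be such that for some μ ∈ ℝ and some p > 1 the limit lim_{|t|→∞} t^{−1}|t|^{1−p} W'(t + μ) exists and lies in (0, ∞), and such that there exist μ_− < μ_+ with W'(μ_−) = W'(μ_+) = 0, W'(t) < 0 for all t < μ_−, and W'(t) > 0 for all t > μ_+. Then every solution u ∈ C²(ℝⁿ) of Δu = W'(u) on ℝⁿ which is not identically equal to μ_− or to μ_+ satisfies μ_− < u(x) < μ_+ for all x ∈ ℝⁿ. -/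
open Metric Set Filter Pointwise

noncomputable section

/-- The Laplacian of `u : ℝⁿ → ℝ`: the sum of the second partial derivatives. -/
def lap {n : ℕ} (u : EuclideanSpace ℝ (Fin n) → ℝ) (x : EuclideanSpace ℝ (Fin n)) : ℝ :=
  ∑ i : Fin n, fderiv ℝ (fun y => fderiv ℝ u y (EuclideanSpace.single i 1)) x
    (EuclideanSpace.single i 1)

/-- Condition (a'): `W` is `C²`, `μ > 0`, `W μ = 0`, `W > 0` on `[0, μ)`, `W ≥ 0` everywhere,
and either `W(-t) ≥ W(t)` on `[0, μ]` or `W' < 0` on `(-∞, 0)`. -/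
def CondA' (W : ℝ → ℝ) (μ : ℝ) : Prop :=
  ContDiff ℝ 2 W ∧ 0 < μ ∧ W μ = 0 ∧ (∀ t ∈ Set.Ico (0:ℝ) μ, 0 < W t) ∧
    (∀ t : ℝ, 0 ≤ W t) ∧
    ((∀ t ∈ Set.Icc (0:ℝ) μ, W t ≤ W (-t)) ∨ (∀ t < (0:ℝ), deriv W t < 0))

/-- `U` is the heteroclinic profile: `U'' = W'(U)` on `(0, ∞)`, `U 0 = 0`, `U → μ` at `∞`. -/
def IsHetero (W : ℝ → ℝ) (μ : ℝ) (U : ℝ → ℝ) : Prop :=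
  ContDiffOn ℝ 2 U (Set.Ici 0) ∧ U 0 = 0 ∧
    (∀ s > (0:ℝ), deriv (deriv U) s = deriv W (U s)) ∧
    Filter.Tendsto U Filter.atTop (nhds μ)

/-- `Ω` has boundary of class `C²`, via local `C²` defining functions. -/
def HasC2Boundary {n : ℕ} (Ω : Set (EuclideanSpace ℝ (Fin n))) : Prop :=
  ∀ x ∈ frontier Ω, ∃ (V : Set (EuclideanSpace ℝ (Fin n))) (f : EuclideanSpace ℝ (Fin n) → ℝ),
    IsOpen V ∧ x ∈ V ∧ ContDiffOn ℝ 2 f V ∧ (∀ y ∈ V, fderiv ℝ f y ≠ 0) ∧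
    Ω ∩ V = {y ∈ V | f y < 0} ∧ frontier Ω ∩ V = {y ∈ V | f y = 0}

lemma aux_second_deriv (h h' : ℝ → ℝ) (b : ℝ) (h1 : ∀ᶠ s in nhds (0:ℝ), HasDerivAt h (h' s) s)
    (h2 : HasDerivAt h' b 0) (hmin : IsLocalMin h 0) : 0 ≤ b := by
  by_contra hb
  push Not at hb
  have hd : deriv h =ᶠ[nhds 0] h' := h1.mono fun s hs => hs.deriv
  have hdd : deriv (deriv h) 0 = b := by rw [hd.deriv_eq, h2.deriv]
  have hmax : IsLocalMax h 0 :=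
    isLocalMax_of_deriv_deriv_neg (by rw [hdd]; exact hb) hmin.deriv_eq_zero
      h1.self_of_nhds.continuousAt
  have hc : h =ᶠ[nhds 0] fun _ => h 0 := by
    filter_upwards [hmin, hmax] with s hs1 hs2 using le_antisymm hs2 hs1
  have hc2 : deriv h =ᶠ[nhds 0] fun _ => 0 := by
    have := hc.deriv
    simpa using this
  have : deriv (deriv h) 0 = 0 := by rw [hc2.deriv_eq]; simp
  linarith

lemma aux_dist_line {n : ℕ} (y c : EuclideanSpace ℝ (Fin n)) (i : Fin n) (s : ℝ) :
    ‖y + s • EuclideanSpace.single i (1:ℝ) - c‖ ^ 2 = ‖y - c‖ ^ 2 + 2 * (y i - c i) * s + s ^ 2 := by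
  have : y + s • EuclideanSpace.single i (1:ℝ) - c = (y - c) + s • EuclideanSpace.single i (1:ℝ) := by
    abel
  rw [this, norm_add_sq_real, inner_smul_right, EuclideanSpace.inner_single_right, norm_smul]
  simp
  ring

lemma aux_lap_radial {n : ℕ} (u : EuclideanSpace ℝ (Fin n) → ℝ) (hu : ContDiff ℝ 2 u)
    (y c : EuclideanSpace ℝ (Fin n)) (P P' : ℝ → ℝ) (P'' : ℝ)
    (h1 : ∀ᶠ t in nhds (‖y - c‖ ^ 2), HasDerivAt P (P' t) t)
    (h2 : HasDerivAt P' P'' (‖y - c‖ ^ 2))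
    (hmin : IsLocalMin (fun x => P (‖x - c‖ ^ 2) - u x) y) :
    lap u y ≤ 4 * ‖y - c‖ ^ 2 * P'' + 2 * n * P' (‖y - c‖ ^ 2) := by
  have key : ∀ i : Fin n, fderiv ℝ (fun y => fderiv ℝ u y (EuclideanSpace.single i 1)) y
      (EuclideanSpace.single i 1) ≤ P'' * (2 * (y i - c i)) ^ 2 + P' (‖y - c‖ ^ 2) * 2 := by
    intro i
    set e : EuclideanSpace ℝ (Fin n) := EuclideanSpace.single i 1 with he
    have hl : ∀ s : ℝ, HasDerivAt (fun s : ℝ => y + s • e) e s := by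
      intro s
      simpa using ((hasDerivAt_id s).smul_const e).const_add y
    have hl0 : Tendsto (fun s : ℝ => y + s • e) (nhds 0) (nhds y) := by
      have := (hl 0).continuousAt.tendsto
      simpa using this
    let Q : ℝ → ℝ := fun s => ‖y - c‖ ^ 2 + 2 * (y i - c i) * s + s ^ 2
    have hQ : ∀ s, HasDerivAt Q (2 * (y i - c i) + 2 * s) s := by
      intro s
      have := (((hasDerivAt_id s).const_mul (2 * (y i - c i))).const_add (‖y - c‖ ^ 2)).add
        ((hasDerivAt_id s).pow 2)
      refine this.congr_deriv ?_
      simp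
    have hQ0 : Q 0 = ‖y - c‖ ^ 2 := by simp [Q]
    have hQt : Tendsto Q (nhds 0) (nhds (‖y - c‖ ^ 2)) := by
      have := (hQ 0).continuousAt.tendsto
      rwa [hQ0] at this
    have hdu : ∀ s : ℝ, HasDerivAt (fun s : ℝ => u (y + s • e)) (fderiv ℝ u (y + s • e) e) s := by
      intro s
      exact (((hu.differentiable (by norm_num)) (y + s • e)).hasFDerivAt).comp_hasDerivAt s (hl s)
    have hd1 : Differentiable ℝ (fun z => fderiv ℝ u z e) := by
      have : ContDiff ℝ 1 (fderiv ℝ u) := hu.fderiv_right (by norm_num)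
      exact (this.differentiable (by norm_num)).clm_apply (differentiable_const e)
    have hdu2 : HasDerivAt (fun s : ℝ => fderiv ℝ u (y + s • e) e)
        (fderiv ℝ (fun z => fderiv ℝ u z e) y e) 0 := by
      have h := (hd1 (y + (0:ℝ) • e)).hasFDerivAt.comp_hasDerivAt (0:ℝ) (hl 0)
      refine h.congr_deriv ?_
      simp
    have := aux_second_deriv (fun s => P (Q s) - u (y + s • e))
      (fun s => P' (Q s) * (2 * (y i - c i) + 2 * s) - fderiv ℝ u (y + s • e) e)
      (P'' * (2 * (y i - c i)) ^ 2 + P' (‖y - c‖ ^ 2) * 2 -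
        fderiv ℝ (fun z => fderiv ℝ u z e) y e) ?_ ?_ ?_
    · linarith
    · filter_upwards [hQt.eventually h1] with s hs
      exact (hs.comp s (hQ s)).sub (hdu s)
    · refine HasDerivAt.sub ?_ hdu2
      have hA : HasDerivAt (fun s => P' (Q s)) (P'' * (2 * (y i - c i) + 2 * 0)) 0 := by
        rw [← hQ0] at h2
        exact h2.comp (0:ℝ) (hQ 0)
      have hB : HasDerivAt (fun s : ℝ => 2 * (y i - c i) + 2 * s) 2 0 := by
        simpa using ((hasDerivAt_id (0:ℝ)).const_mul 2).const_add (2 * (y i - c i))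
      refine (hA.mul hB).congr_deriv ?_
      rw [hQ0]; ring
    · have := hl0.eventually hmin
      filter_upwards [this] with s hs
      have e1 := aux_dist_line y c i s
      have e0 : y + (0:ℝ) • e = y := by simp
      simp only [hQ0, e0]
      rw [← he] at e1
      rw [e1] at hs
      exact hs
  calc lap u y ≤ ∑ i : Fin n, (P'' * (2 * (y i - c i)) ^ 2 + P' (‖y - c‖ ^ 2) * 2) :=
        Finset.sum_le_sum fun i _ => key i
    _ = _ := by
        rw [Finset.sum_add_distrib, ← Finset.mul_sum, EuclideanSpace.real_norm_sq_eq]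
        simp only [mul_pow, ← Finset.mul_sum]
        simp
        ring

lemma aux_growth (f : ℝ → ℝ) (hf : Continuous f) (μ p ℓ : ℝ) (hp : 1 < p) (hℓ : 0 < ℓ)
    (hs : Tendsto (fun t : ℝ => f (t + μ) / (t * |t| ^ (p - 1))) atTop (nhds ℓ))
    (b : ℝ) (hpos : ∀ t, b < t → 0 < f t) (a : ℝ) (ha : b < a) :
    ∃ c : ℝ, 0 < c ∧ ∀ t, a ≤ t → c * (t - a) ^ p ≤ f t := by
  have hev : ∀ᶠ t in atTop, ℓ / 2 < f (t + μ) / (t * |t| ^ (p - 1)) :=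
    hs.eventually (lt_mem_nhds (by linarith))
  obtain ⟨T0, hT0⟩ := eventually_atTop.1 hev
  set T := max (max (T0 + μ) (μ + 1)) (max (2 * μ - a) a) with hT
  have hT1 : T0 + μ ≤ T := (le_max_left _ _).trans (le_max_left _ _)
  have hT2 : μ + 1 ≤ T := (le_max_right _ _).trans (le_max_left _ _)
  have hT3 : 2 * μ - a ≤ T := (le_max_left _ _).trans (le_max_right _ _)
  have hT4 : a ≤ T := (le_max_right _ _).trans (le_max_right _ _)
  obtain ⟨z, hz, hzmin⟩ := isCompact_Icc.exists_isMinOn (nonempty_Icc.2 hT4) hf.continuousOn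
  have hδ : 0 < f z := hpos z (lt_of_lt_of_le ha hz.1)
  have hp0 : 0 < p := by linarith
  set S := (T - a) ^ p + 1
  have hS : 0 < S := by
    have := Real.rpow_nonneg (sub_nonneg.2 hT4) p
    positivity
  have h2p : (0:ℝ) < 2 ^ p := Real.rpow_pos_of_pos (by norm_num) p
  refine ⟨min (f z / S) (ℓ / 2 / 2 ^ p), lt_min (by positivity) (by positivity), ?_⟩
  intro t ht
  have htp : 0 ≤ (t - a) ^ p := Real.rpow_nonneg (sub_nonneg.2 ht) p
  rcases le_total t T with htT | htT
  · calc _ ≤ f z / S * (t - a) ^ p := by gcongr; exact min_le_left _ _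
      _ ≤ f z / S * S := by
        gcongr
        have : (t - a) ^ p ≤ (T - a) ^ p :=
          Real.rpow_le_rpow (sub_nonneg.2 ht) (by linarith) hp0.le
        linarith
      _ = f z := by field_simp
      _ ≤ f t := hzmin ⟨ht, htT⟩
  · have hτ : 0 < t - μ := by linarith
    have h1 := hT0 (t - μ) (by linarith)
    have hpow : (t - μ) * |t - μ| ^ (p - 1) = (t - μ) ^ p := by
      rw [abs_of_pos hτ, Real.rpow_sub_one hτ.ne']
      field_simp
    rw [hpow, sub_add_cancel, lt_div_iff₀ (Real.rpow_pos_of_pos hτ p)] at h1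
    calc _ ≤ ℓ / 2 / 2 ^ p * (t - a) ^ p := by gcongr; exact min_le_right _ _
      _ ≤ ℓ / 2 / 2 ^ p * (2 * (t - μ)) ^ p := by
        gcongr
        linarith
      _ = ℓ / 2 * (t - μ) ^ p := by
        rw [Real.mul_rpow (by norm_num) hτ.le]; field_simp
      _ ≤ f t := h1.le

lemma aux_keller {n : ℕ} (f : ℝ → ℝ) (p a c : ℝ) (hp : 1 < p) (hc : 0 < c)
    (hg : ∀ t, a ≤ t → c * (t - a) ^ p ≤ f t)
    (u : EuclideanSpace ℝ (Fin n) → ℝ) (hu : ContDiff ℝ 2 u)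
    (heq : ∀ x, lap u x = f (u x)) (x0 : EuclideanSpace ℝ (Fin n)) : u x0 ≤ a := by
  by_contra hlt
  push Not at hlt
  have hp1 : 0 < p - 1 := by linarith
  set α := 2 / (p - 1) with hα
  have hα0 : 0 < α := by positivity
  have hαp : α * p = α + 2 := by rw [hα]; field_simp; ring
  have hαp1 : α * (p - 1) = 2 := by rw [hα]; field_simp
  set C := 4 * α * (α + 1) + 2 * n * α with hC
  have hC0 : 0 < C := by positivity
  set v0 := u x0 - a with hv0
  have hv0p : 0 < v0 := by linarith
  have main : ∀ R : ℝ, 0 < R → c * v0 ^ (p - 1) * R ^ 2 ≤ C := by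
    intro R hR
    let F : EuclideanSpace ℝ (Fin n) → ℝ := fun x => (u x - a) * (R ^ 2 - ‖x - x0‖ ^ 2) ^ α
    have hF : Continuous F := by
      have : Continuous fun x : EuclideanSpace ℝ (Fin n) => (R ^ 2 - ‖x - x0‖ ^ 2) ^ α :=
        (by fun_prop : Continuous fun x : EuclideanSpace ℝ (Fin n) =>
          (R ^ 2 - ‖x - x0‖ ^ 2)).rpow_const fun x => Or.inr hα0.le
      exact (hu.continuous.sub continuous_const).mul this
    obtain ⟨y, hy, hymax⟩ := (isCompact_closedBall x0 R).exists_isMaxOn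
      (nonempty_closedBall.2 hR.le) hF.continuousOn
    have hF0 : F x0 = v0 * (R ^ 2) ^ α := by simp [F, hv0]
    have hM0 : v0 * (R ^ 2) ^ α ≤ F y := by
      rw [← hF0]; exact hymax (mem_closedBall_self hR.le)
    set M := F y with hM
    have hMp : 0 < M := lt_of_lt_of_le (by positivity) hM0
    have hyn : ‖y - x0‖ ≤ R := by simpa [dist_eq_norm] using hy
    have hw0 : 0 ≤ R ^ 2 - ‖y - x0‖ ^ 2 := by
      have := pow_le_pow_left₀ (norm_nonneg _) hyn 2
      linarith
    have hw : 0 < R ^ 2 - ‖y - x0‖ ^ 2 := by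
      refine lt_of_le_of_ne hw0 fun h => ?_
      have : M = 0 := by
        simp only [hM, F]; rw [← h, Real.zero_rpow hα0.ne', mul_zero]
      linarith
    set w := R ^ 2 - ‖y - x0‖ ^ 2 with hwdef
    have huy : u y - a = M * w ^ (-α) := by
      simp only [hM, F]
      rw [← hwdef, mul_assoc, ← Real.rpow_add hw]; simp
    have hlap := aux_lap_radial u hu y x0 (fun t => a + M * (R ^ 2 - t) ^ (-α))
      (fun t => M * (α * (R ^ 2 - t) ^ (-α - 1))) (M * (α * ((α + 1) * w ^ (-α - 2)))) ?_ ?_ ?_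
    · rw [heq] at hlap
      have hlow := hg (u y) (by
        have : 0 < M * w ^ (-α) := by positivity
        linarith)
      rw [huy, Real.mul_rpow hMp.le (by positivity), ← Real.rpow_mul hw.le] at hlow
      have e1 : -α * p = -α - 2 := by linarith
      rw [e1] at hlow
      have e2 : w ^ (-α - 1) = w ^ (-α - 2) * w := by
        rw [← Real.rpow_add_one hw.ne']; congr 1; ring
      simp only [← hwdef, e2] at hlap
      have hwR : w ≤ R ^ 2 := by rw [hwdef]; linarith [sq_nonneg ‖y - x0‖]
      have hqR : ‖y - x0‖ ^ 2 ≤ R ^ 2 := by linarith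
      have hB : 0 < w ^ (-α - 2) := by positivity
      set B := w ^ (-α - 2)
      have h3 : 4 * ‖y - x0‖ ^ 2 * (M * (α * ((α + 1) * B))) + 2 * n * (M * (α * (B * w)))
          ≤ M * B * (C * R ^ 2) := by
        have i1 : 4 * ‖y - x0‖ ^ 2 * (M * (α * ((α + 1) * B))) ≤
          4 * R ^ 2 * (M * (α * ((α + 1) * B))) := by gcongr
        have i2 : 2 * n * (M * (α * (B * w))) ≤ 2 * n * (M * (α * (B * R ^ 2))) := by gcongr
        calc _ ≤ _ := add_le_add i1 i2
          _ = _ := by rw [hC]; ring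
      have h4 : c * (M ^ p * B) ≤ M * B * (C * R ^ 2) := by linarith
      have e3 : M ^ p = M * M ^ (p - 1) := by
        rw [Real.rpow_sub_one hMp.ne']; field_simp
      rw [e3] at h4
      have h5 : c * M ^ (p - 1) ≤ C * R ^ 2 := by
        have : (M * B) * (c * M ^ (p - 1)) ≤ (M * B) * (C * R ^ 2) := by linarith
        exact le_of_mul_le_mul_left this (by positivity)
      have h6 : v0 ^ (p - 1) * (R ^ 2) ^ (2:ℕ) ≤ M ^ (p - 1) := by
        have := Real.rpow_le_rpow (by positivity) hM0 hp1.le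
        rw [Real.mul_rpow hv0p.le (by positivity), ← Real.rpow_mul (by positivity), hαp1] at this
        simpa using this
      have h7 : c * (v0 ^ (p - 1) * (R ^ 2) ^ (2:ℕ)) ≤ C * R ^ 2 :=
        (mul_le_mul_of_nonneg_left h6 hc.le).trans h5
      have hR2 : 0 < R ^ 2 := by positivity
      refine le_of_mul_le_mul_right ?_ hR2
      calc _ = c * (v0 ^ (p - 1) * (R ^ 2) ^ (2:ℕ)) := by ring
        _ ≤ _ := h7
    · have : ∀ᶠ t in nhds (‖y - x0‖ ^ 2), t < R ^ 2 := gt_mem_nhds (by linarith)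
      filter_upwards [this] with t ht
      have hne : R ^ 2 - t ≠ 0 := by linarith
      have h := ((((hasDerivAt_id t).const_sub (R ^ 2)).rpow_const (p := -α)
        (Or.inl hne)).const_mul M).const_add a
      refine h.congr_deriv ?_
      simp
    · have hne : R ^ 2 - ‖y - x0‖ ^ 2 ≠ 0 := hw.ne'
      have h := ((((hasDerivAt_id (‖y - x0‖ ^ 2)).const_sub (R ^ 2)).rpow_const (p := -α - 1)
        (Or.inl hne)).const_mul α).const_mul M
      refine h.congr_deriv ?_
      simp only [id, ← hwdef]
      rw [show -α - 1 - 1 = -α - 2 by ring]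
      ring
    · have hopen : ∀ᶠ x in nhds y, 0 < R ^ 2 - ‖x - x0‖ ^ 2 := by
        have : Continuous fun x : EuclideanSpace ℝ (Fin n) => (R ^ 2 - ‖x - x0‖ ^ 2) := by fun_prop
        exact this.continuousAt.eventually (lt_mem_nhds hw)
      filter_upwards [hopen] with x hx
      have hxb : x ∈ closedBall x0 R := by
        rw [mem_closedBall, dist_eq_norm]
        exact le_of_sq_le_sq (by linarith) hR.le
      have h := hymax hxb
      have h' : (u x - a) * (R ^ 2 - ‖x - x0‖ ^ 2) ^ α ≤ M := h
      have hux : u x - a ≤ M * (R ^ 2 - ‖x - x0‖ ^ 2) ^ (-α) := by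
        rw [Real.rpow_neg hx.le, ← div_eq_mul_inv, le_div_iff₀ (Real.rpow_pos_of_pos hx α)]
        exact h'
      simp only [← hwdef]
      linarith
  have hD : 0 < c * v0 ^ (p - 1) := by positivity
  set D := c * v0 ^ (p - 1)
  have h := main (C / D + 1) (by positivity)
  have hq : 0 < C / D := by positivity
  have : D * (C / D) = C := by field_simp
  nlinarith [mul_pos hD hq, mul_pos hD (mul_pos hq hq)]

lemma aux_strong {n : ℕ} (f : ℝ → ℝ) (b K : ℝ) (hK : 0 ≤ K)
    (u : EuclideanSpace ℝ (Fin n) → ℝ) (hu : ContDiff ℝ 2 u)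
    (hle : ∀ x, u x ≤ b) (heq : ∀ x, lap u x = f (u x))
    (hf : ∀ x, -(K * (b - u x)) ≤ f (u x))
    (hnot : ¬ ∀ x, u x = b) : ∀ x, u x < b := by
  intro x2
  refine lt_of_le_of_ne (hle x2) fun hx2 => ?_
  push Not at hnot
  obtain ⟨x1, hx1⟩ := hnot
  have hcl : IsClosed {x | u x = b} := isClosed_eq hu.continuous continuous_const
  obtain ⟨z, hz, hzd⟩ := hcl.exists_infDist_eq_dist ⟨x2, hx2⟩ x1
  have hz : u z = b := hz
  have hnear : ∀ x, dist x1 x < dist x1 z → u x < b := by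
    intro x hx
    refine lt_of_le_of_ne (hle x) fun h => ?_
    have := infDist_le_dist_of_mem (x := x1) (show x ∈ {x | u x = b} from h)
    linarith
  have hd : 0 < dist x1 z := dist_pos.2 fun h => hx1 (h ▸ hz)
  set c : EuclideanSpace ℝ (Fin n) := (1/2 : ℝ) • (x1 + z) with hcdef
  set ρ := dist x1 z / 2 with hρ
  have hρ0 : 0 < ρ := by positivity
  have hzc : ‖z - c‖ = ρ := by
    have : z - c = (1/2 : ℝ) • (z - x1) := by rw [hcdef]; module
    rw [this, norm_smul, hρ, dist_eq_norm, norm_sub_rev x1 z]; norm_num; ring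
  have hpar : ∀ x, ‖x - x1‖ ^ 2 + ‖x - z‖ ^ 2 = 2 * ‖x - c‖ ^ 2 + 2 * ρ ^ 2 := by
    intro x
    have := parallelogram_law_with_norm ℝ (x - c) (z - c)
    have e1 : x - c + (z - c) = x - x1 := by rw [hcdef]; module
    have e2 : x - c - (z - c) = x - z := by abel
    rw [e1, e2, hzc] at this
    nlinarith
  set r := ρ / 2 with hr
  have hr0 : 0 < r := by positivity
  obtain ⟨α, hα0, hα⟩ : ∃ α : ℝ, 0 < α ∧ 2 * n * α + K < α ^ 2 * ρ ^ 2 := by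
    refine ⟨(2 * n + K) / ρ ^ 2 + 1 / ρ ^ 2 + 1, by positivity, ?_⟩
    set α := (2 * n + K) / ρ ^ 2 + 1 / ρ ^ 2 + 1 with hα
    have h1 : α * ρ ^ 2 = 2 * n + K + 1 + ρ ^ 2 := by rw [hα]; field_simp
    have hα1 : 1 ≤ α := by
      have : 0 ≤ (2 * n + K) / ρ ^ 2 + 1 / ρ ^ 2 := by positivity
      linarith
    have : α ^ 2 * ρ ^ 2 = α * (2 * n + K + 1 + ρ ^ 2) := by rw [← h1]; ring
    rw [this]
    nlinarith [sq_nonneg ρ, mul_nonneg hK (sub_nonneg.2 hα1), mul_pos (lt_of_lt_of_le one_pos hα1) (pow_pos hρ0 2)]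
  let E : EuclideanSpace ℝ (Fin n) → ℝ := fun x => Real.exp (-α * ‖x - c‖ ^ 2) - Real.exp (-α * ρ ^ 2)
  have hE : Continuous E := by fun_prop
  have hE1 : ∀ x, E x ≤ 1 := by
    intro x
    have h1 : Real.exp (-α * ‖x - c‖ ^ 2) ≤ 1 := by
      rw [Real.exp_le_one_iff]; nlinarith [sq_nonneg ‖x - c‖]
    have h2 := Real.exp_pos (-α * ρ ^ 2)
    simp only [E]; linarith
  -- boundary set
  obtain ⟨ε, hε, hεb⟩ : ∃ ε : ℝ, 0 < ε ∧ ∀ x ∈ sphere z r, 0 < b - u x - ε * E x := by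
    have hS : IsCompact (sphere z r ∩ {x | 0 ≤ E x}) :=
      (isCompact_sphere z r).inter_right (isClosed_le continuous_const hE)
    have hSpos : ∀ x ∈ sphere z r ∩ {x | 0 ≤ E x}, u x < b := by
      rintro x ⟨hx, hxE⟩
      apply hnear
      have hxE : 0 ≤ E x := hxE
      simp only [E, sub_nonneg, Real.exp_le_exp] at hxE
      have h1 : ‖x - c‖ ^ 2 ≤ ρ ^ 2 := by nlinarith
      have h2 := hpar x
      rw [mem_sphere, dist_eq_norm] at hx
      rw [hx] at h2
      have h3 : ‖x - x1‖ ^ 2 < (dist x1 z) ^ 2 := by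
        have : dist x1 z = 2 * ρ := by rw [hρ]; ring
        rw [this]; nlinarith [pow_pos hr0 2]
      rw [dist_comm x1 x, dist_eq_norm]
      exact lt_of_pow_lt_pow_left₀ 2 hd.le h3
    have hcase : ∀ ε : ℝ, 0 < ε → (∀ x ∈ sphere z r ∩ {x | 0 ≤ E x}, 0 < b - u x - ε * E x) →
        ∀ x ∈ sphere z r, 0 < b - u x - ε * E x := by
      intro ε hε h x hx
      by_cases hxE : 0 ≤ E x
      · exact h x ⟨hx, hxE⟩
      · push Not at hxE
        nlinarith [hle x, mul_pos hε (neg_pos.2 hxE)]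
    rcases (sphere z r ∩ {x | 0 ≤ E x}).eq_empty_or_nonempty with hem | hne
    · exact ⟨1, one_pos, hcase 1 one_pos (by rw [hem]; simp)⟩
    · obtain ⟨y, hy, hymax⟩ := hS.exists_isMaxOn hne hu.continuous.continuousOn
      have hyb := hSpos y hy
      refine ⟨(b - u y) / 2, by linarith, hcase _ (by linarith) fun x hx => ?_⟩
      have h1 : u x ≤ u y := hymax hx
      have h2 := hE1 x
      nlinarith
  let G : EuclideanSpace ℝ (Fin n) → ℝ := fun x => b - ε * E x - u x
  have hG : Continuous G := by
    have := hu.continuous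
    fun_prop
  obtain ⟨y, hy, hymin⟩ := (isCompact_closedBall z r).exists_isMinOn
    (nonempty_closedBall.2 hr0.le) hG.continuousOn
  have hGz : G z = 0 := by simp [G, E, hzc, hz]
  have hGy : G y ≤ 0 := by rw [← hGz]; exact hymin (mem_closedBall_self hr0.le)
  have hyball : y ∈ ball z r := by
    rw [mem_closedBall] at hy
    rw [mem_ball]
    refine lt_of_le_of_ne hy fun h => ?_
    have := hεb y h
    simp only [G] at hGy
    linarith
  have hloc : IsLocalMin G y := by
    filter_upwards [isOpen_ball.mem_nhds hyball] with x hx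
    exact hymin (ball_subset_closedBall hx)
  have hlap := aux_lap_radial u hu y c
    (fun t => b - ε * (Real.exp (-α * t) - Real.exp (-α * ρ ^ 2)))
    (fun t => ε * α * Real.exp (-α * t)) (-(ε * α ^ 2 * Real.exp (-α * ‖y - c‖ ^ 2))) ?_ ?_ hloc
  · rw [heq] at hlap
    have h1 := hf y
    have hyc : ρ / 2 ≤ ‖y - c‖ := by
      have h := norm_sub_norm_le (z - c) (z - y)
      rw [mem_ball, dist_eq_norm, norm_sub_rev] at hyball
      have e : z - c - (z - y) = y - c := by abel
      rw [e, hzc] at h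
      linarith
    have hyc2 : ρ ^ 2 ≤ 4 * ‖y - c‖ ^ 2 := by nlinarith
    simp only [G, E] at hGy
    have hX : 0 < Real.exp (-α * ‖y - c‖ ^ 2) := Real.exp_pos _
    have hY : 0 < Real.exp (-α * ρ ^ 2) := Real.exp_pos _
    set X := Real.exp (-α * ‖y - c‖ ^ 2)
    set Y := Real.exp (-α * ρ ^ 2)
    have h2 : K * (b - u y) ≤ K * (ε * X) := by
      apply mul_le_mul_of_nonneg_left _ hK
      nlinarith [mul_pos hε hY]
    have h3 : ρ ^ 2 * (ε * α ^ 2 * X) ≤ 4 * ‖y - c‖ ^ 2 * (ε * α ^ 2 * X) := by gcongr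
    have h4 : (2 * n * α + K) * (ε * X) < α ^ 2 * ρ ^ 2 * (ε * X) := by gcongr
    nlinarith
  · refine Eventually.of_forall fun t => ?_
    have h := (((((hasDerivAt_id t).const_mul (-α)).exp).sub_const (Real.exp (-α * ρ ^ 2))).const_mul
      ε).const_sub b
    refine h.congr_deriv ?_
    simp; ring
  · have h := (((hasDerivAt_id (‖y - c‖ ^ 2)).const_mul (-α)).exp).const_mul (ε * α)
    refine h.congr_deriv ?_
    simp; ring

lemma aux_le {n : ℕ} (f : ℝ → ℝ) (hf : Continuous f) (μ p ℓ : ℝ) (hp : 1 < p) (hℓ : 0 < ℓ)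
    (hs : Tendsto (fun t : ℝ => f (t + μ) / (t * |t| ^ (p - 1))) atTop (nhds ℓ))
    (b : ℝ) (hpos : ∀ t, b < t → 0 < f t)
    (u : EuclideanSpace ℝ (Fin n) → ℝ) (hu : ContDiff ℝ 2 u)
    (heq : ∀ x, lap u x = f (u x)) (x : EuclideanSpace ℝ (Fin n)) : u x ≤ b := by
  refine le_of_forall_gt_imp_ge_of_dense fun a ha => ?_
  obtain ⟨c, hc, hg⟩ := aux_growth f hf μ p ℓ hp hℓ hs b hpos a ha
  exact aux_keller f p a c hp hc hg u hu heq x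

lemma aux_lt {n : ℕ} (f : ℝ → ℝ) (hf : ContDiff ℝ 1 f) (b m : ℝ) (hfb : f b = 0)
    (u : EuclideanSpace ℝ (Fin n) → ℝ) (hu : ContDiff ℝ 2 u)
    (hle : ∀ x, u x ≤ b) (hge : ∀ x, m ≤ u x)
    (heq : ∀ x, lap u x = f (u x))
    (hnot : ¬ ∀ x, u x = b) : ∀ x, u x < b := by
  obtain ⟨K, hK⟩ := (isCompact_Icc (a := m) (b := b)).exists_bound_of_continuousOn
    (hf.continuous_deriv (by norm_num)).continuousOn
  have hmb : m ≤ b := (hge 0).trans (hle 0)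
  have hK0 : 0 ≤ K := (norm_nonneg _).trans (hK b ⟨hmb, le_rfl⟩)
  refine aux_strong f b K hK0 u hu hle heq (fun x => ?_) hnot
  have := (convex_Icc m b).norm_image_sub_le_of_norm_deriv_le
    (fun y _ => (hf.differentiable (by norm_num)) y) hK (⟨hge x, hle x⟩ : u x ∈ Icc m b)
    (⟨hmb, le_rfl⟩ : b ∈ Icc m b)
  rw [hfb, Real.norm_eq_abs, Real.norm_eq_abs, abs_of_nonneg (sub_nonneg.2 (hle x))] at this
  have := (abs_le.1 this).2
  linarith

lemma aux_lap_neg {n : ℕ} (u : EuclideanSpace ℝ (Fin n) → ℝ) (x : EuclideanSpace ℝ (Fin n)) :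
    lap (fun y => - u y) x = - lap u x := by
  unfold lap
  rw [← Finset.sum_neg_distrib]
  refine Finset.sum_congr rfl fun i _ => ?_
  have : (fun y => fderiv ℝ (fun y => - u y) y (EuclideanSpace.single i 1)) =
      fun y => - (fderiv ℝ u y (EuclideanSpace.single i 1)) := by
    funext y
    rw [fderiv_fun_neg]; simp
  rw [this, fderiv_fun_neg]; simp

theorem stmt12 (n : ℕ) (hn : 1 ≤ n) (W : ℝ → ℝ) (hW : ContDiff ℝ 2 W)
    (μ p : ℝ) (hp : 1 < p)
    -- `lim_{|t| → ∞} t⁻¹ |t|^{1-p} W'(t + μ) = ℓ ∈ (0, ∞)`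
    (hscale : ∃ ℓ : ℝ, 0 < ℓ ∧
      Filter.Tendsto (fun t : ℝ => (deriv W (t + μ)) / (t * |t| ^ (p - 1)))
        (Filter.atTop ⊔ Filter.atBot) (nhds ℓ))
    (μm μp : ℝ) (hμ : μm < μp)
    (hcrit : deriv W μm = 0 ∧ deriv W μp = 0)
    (hneg : ∀ t : ℝ, t < μm → deriv W t < 0)
    (hpos : ∀ t : ℝ, μp < t → 0 < deriv W t)
    (u : EuclideanSpace ℝ (Fin n) → ℝ) (hu : ContDiff ℝ 2 u)
    (heq : ∀ x, lap u x = deriv W (u x))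
    (hnotm : ¬ (∀ x, u x = μm)) (hnotp : ¬ (∀ x, u x = μp)) :
    ∀ x, μm < u x ∧ u x < μp := by
  obtain ⟨ℓ, hℓ, hsc⟩ := hscale
  rw [tendsto_sup] at hsc
  have hf : ContDiff ℝ 1 (deriv W) := by
    have : ContDiff ℝ (1 + 1) W := by simpa [one_add_one_eq_two] using hW
    exact (contDiff_succ_iff_deriv.1 this).2.2
  set g : ℝ → ℝ := fun t => - deriv W (-t) with hgdef
  have hg : ContDiff ℝ 1 g := (hf.comp contDiff_neg).neg
  have hgs : Tendsto (fun t : ℝ => g (t + -μ) / (t * |t| ^ (p - 1))) atTop (nhds ℓ) := by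
    have := hsc.2.comp tendsto_neg_atTop_atBot
    refine this.congr fun t => ?_
    simp only [Function.comp, hgdef, abs_neg]
    rw [show -(t + -μ) = -t + μ by ring, neg_mul, div_neg, neg_div]
  have hnu : ContDiff ℝ 2 (fun x => - u x) := hu.neg
  have hneq : ∀ x, lap (fun x => - u x) x = g (- u x) := by
    intro x
    rw [aux_lap_neg, heq, hgdef]; simp
  have hup : ∀ x, u x ≤ μp := aux_le _ hf.continuous μ p ℓ hp hℓ hsc.1 μp hpos u hu heq
  have hlo : ∀ x, - u x ≤ - μm :=
    aux_le g hg.continuous (-μ) p ℓ hp hℓ hgs (-μm)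
      (fun t ht => by have := hneg (-t) (by linarith); simp only [hgdef]; linarith) _ hnu hneq
  have h1 := aux_lt _ hf μp μm hcrit.2 u hu hup (fun x => by linarith [hlo x]) heq hnotp
  have h2 := aux_lt g hg (-μm) (-μp) (by simp [hgdef, hcrit.1]) _ hnu hlo
    (fun x => by linarith [hup x]) hneq (fun h => hnotm fun x => by linarith [h x])
  intro x
  exact ⟨by linarith [h2 x], h1 x⟩
end
end

section
/- Let λ ∈ ℝ, p > 1, and let u ∈ C²(ℝⁿ) be a nonnegative solution of Δu = u^p − λu on ℝⁿ. Then u must be a constant function. -/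
open Metric Set Filter Pointwise

noncomputable section

open Topology

abbrev EE (n : ℕ) := EuclideanSpace ℝ (Fin n)

lemma second_deriv_nonneg {f f' : ℝ → ℝ} {d : ℝ} (hmin : IsLocalMin f 0)
    (h1 : ∀ᶠ t in 𝓝 (0:ℝ), HasDerivAt f (f' t) t) (h2 : HasDerivAt f' d 0) : 0 ≤ d := by
  by_contra hd
  push Not at hd
  have e1 : deriv f =ᶠ[𝓝 0] f' := h1.mono fun t ht => ht.deriv
  have hdd : deriv (deriv f) 0 = d := by rw [e1.deriv_eq, h2.deriv]
  have hmax : IsLocalMax f 0 := isLocalMax_of_deriv_deriv_neg (by rw [hdd]; exact hd)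
    hmin.deriv_eq_zero h1.self_of_nhds.continuousAt
  have hc : f =ᶠ[𝓝 0] fun _ => f 0 := by
    filter_upwards [hmin, hmax] with t h h'
    exact le_antisymm h' h
  have h0 : deriv (deriv f) 0 = 0 := by
    have := hc.deriv.deriv_eq
    rw [this]; simp
  linarith

lemma line_deriv {n : ℕ} {u : EE n → ℝ} (hu : ContDiff ℝ 2 u) (y e : EE n) (t : ℝ) :
    HasDerivAt (fun t : ℝ => u (y + t • e)) (fderiv ℝ u (y + t • e) e) t := by
  have h := (hu.differentiable (by norm_num) (y + t • e)).hasFDerivAt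
  have hl : HasDerivAt (fun t : ℝ => y + t • e) e t := by
    simpa using ((hasDerivAt_id t).smul_const e).const_add y
  exact h.comp_hasDerivAt t hl

lemma line_deriv2 {n : ℕ} {u : EE n → ℝ} (hu : ContDiff ℝ 2 u) (y e : EE n) :
    HasDerivAt (fun t : ℝ => fderiv ℝ u (y + t • e) e)
      (fderiv ℝ (fun z => fderiv ℝ u z e) y e) 0 := by
  have hd : Differentiable ℝ (fun z => fderiv ℝ u z e) := by
    have : ContDiff ℝ 1 (fderiv ℝ u) := hu.fderiv_right (by norm_num)
    exact (this.clm_apply contDiff_const).differentiable (by norm_num)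
  have h := (hd (y + (0:ℝ) • e)).hasFDerivAt
  have hl : HasDerivAt (fun t : ℝ => y + t • e) e 0 := by
    simpa using ((hasDerivAt_id (0:ℝ)).smul_const e).const_add y
  have := h.comp_hasDerivAt (0:ℝ) hl
  have e0 : y + (0:ℝ) • e = y := by simp
  refine HasDerivAt.congr_deriv this ?_
  rw [e0]

lemma norm_line {n : ℕ} (x0 y : EE n) (i : Fin n) (t : ℝ) :
    ‖y + t • EuclideanSpace.single i (1:ℝ) - x0‖ ^ 2
      = ‖y - x0‖ ^ 2 + 2 * (y - x0) i * t + t ^ 2 := by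
  have : y + t • EuclideanSpace.single i (1:ℝ) - x0
      = (y - x0) + t • EuclideanSpace.single i (1:ℝ) := by abel
  rw [this, norm_add_sq_real, real_inner_smul_right, norm_smul]
  simp [EuclideanSpace.inner_single_right]
  ring

lemma cmp_min {n : ℕ} {u : EE n → ℝ} (hu : ContDiff ℝ 2 u) (x0 y : EE n)
    {F F' : ℝ → ℝ} {F'' : ℝ}
    (hF : ∀ᶠ s in 𝓝 (‖y - x0‖ ^ 2), HasDerivAt F (F' s) s)
    (hF' : HasDerivAt F' F'' (‖y - x0‖ ^ 2))
    (hmin : IsLocalMin (fun z => u z - F (‖z - x0‖ ^ 2)) y) :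
    4 * ‖y - x0‖ ^ 2 * F'' + 2 * n * F' (‖y - x0‖ ^ 2) ≤ lap u y := by
  have key : ∀ i : Fin n, F'' * (4 * ((y - x0) i) ^ 2) + 2 * F' (‖y - x0‖ ^ 2) ≤
      fderiv ℝ (fun z => fderiv ℝ u z (EuclideanSpace.single i 1)) y
        (EuclideanSpace.single i 1) := by
    intro i
    set e : EE n := EuclideanSpace.single i (1:ℝ) with he
    set b : ℝ := (y - x0) i with hb
    set ρ : ℝ := ‖y - x0‖ ^ 2 with hρ
    have hq : ∀ t : ℝ, HasDerivAt (fun t : ℝ => ρ + 2 * b * t + t ^ 2) (2 * b + 2 * t) t := by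
      intro t
      have := (((hasDerivAt_id t).const_mul (2 * b)).const_add ρ).add ((hasDerivAt_id t).pow 2)
      refine HasDerivAt.congr_deriv this ?_
      simp
    have hq0 : Tendsto (fun t : ℝ => ρ + 2 * b * t + t ^ 2) (𝓝 0) (𝓝 ρ) := by
      have := (hq 0).continuousAt.tendsto
      simpa using this
    have h1 : ∀ᶠ t in 𝓝 (0:ℝ), HasDerivAt
        (fun t : ℝ => u (y + t • e) - F (ρ + 2 * b * t + t ^ 2))
        (fderiv ℝ u (y + t • e) e - F' (ρ + 2 * b * t + t ^ 2) * (2 * b + 2 * t)) t := by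
      filter_upwards [hq0.eventually hF] with t ht
      exact (line_deriv hu y e t).sub (ht.comp t (hq t))
    have hF0 : HasDerivAt F' F'' (ρ + 2 * b * 0 + 0 ^ 2) := by simpa using hF'
    have h2 : HasDerivAt
        (fun t : ℝ => fderiv ℝ u (y + t • e) e
          - F' (ρ + 2 * b * t + t ^ 2) * (2 * b + 2 * t))
        (fderiv ℝ (fun z => fderiv ℝ u z e) y e
          - (F'' * (2 * b + 2 * 0) * (2 * b + 2 * 0)
            + F' (ρ + 2 * b * 0 + 0 ^ 2) * 2)) 0 := by
      refine (line_deriv2 hu y e).sub (HasDerivAt.mul (hF0.comp (0:ℝ) (hq 0)) ?_)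
      simpa using ((hasDerivAt_id (0:ℝ)).const_mul 2).const_add (2 * b)
    have hm : IsLocalMin (fun t : ℝ => u (y + t • e) - F (ρ + 2 * b * t + t ^ 2)) 0 := by
      have hl : Tendsto (fun t : ℝ => y + t • e) (𝓝 0) (𝓝 y) := by
        have : Continuous (fun t : ℝ => y + t • e) := by fun_prop
        simpa using this.tendsto 0
      have := hl.eventually hmin
      filter_upwards [this] with t ht
      rw [norm_line, ← hb, ← hρ] at ht
      simpa using ht
    have := second_deriv_nonneg hm h1 h2
    simp at this
    linarith
  have hs := Finset.sum_le_sum (fun i (_ : i ∈ Finset.univ) => key i)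
  rw [Finset.sum_add_distrib, ← Finset.mul_sum, ← Finset.mul_sum] at hs
  have hn : ∑ i, ((y - x0) i) ^ 2 = ‖y - x0‖ ^ 2 := by
    rw [EuclideanSpace.norm_sq_eq]; simp
  rw [hn] at hs
  simp only [Finset.sum_const, Finset.card_univ, Fintype.card_fin, nsmul_eq_mul] at hs
  unfold lap
  linarith

lemma lap_neg {n : ℕ} (u : EE n → ℝ) (y : EE n) : lap (fun z => - u z) y = - lap u y := by
  unfold lap
  simp [fderiv_fun_neg]

lemma cmp_max {n : ℕ} {u : EE n → ℝ} (hu : ContDiff ℝ 2 u) (x0 y : EE n)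
    {F F' : ℝ → ℝ} {F'' : ℝ}
    (hF : ∀ᶠ s in 𝓝 (‖y - x0‖ ^ 2), HasDerivAt F (F' s) s)
    (hF' : HasDerivAt F' F'' (‖y - x0‖ ^ 2))
    (hmax : IsLocalMax (fun z => u z - F (‖z - x0‖ ^ 2)) y) :
    lap u y ≤ 4 * ‖y - x0‖ ^ 2 * F'' + 2 * n * F' (‖y - x0‖ ^ 2) := by
  have := cmp_min (u := fun z => - u z) hu.neg x0 y (F := fun s => - F s)
    (F' := fun s => - F' s) (F'' := - F'') (hF.mono fun s hs => hs.neg) hF'.neg (by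
      filter_upwards [hmax] with z hz
      linarith)
  rw [lap_neg] at this
  linarith

lemma nhds_ball {n : ℕ} {x0 y : EE n} {R : ℝ} (h : ‖y - x0‖ < R) :
    ∀ᶠ z in 𝓝 y, z ∈ closedBall x0 R := by
  have : ball x0 R ∈ 𝓝 y := isOpen_ball.mem_nhds (by rwa [mem_ball, dist_eq_norm])
  filter_upwards [this] with z hz using ball_subset_closedBall hz

lemma upper_R {n : ℕ} {lam p : ℝ} (hp : 1 < p) {u : EE n → ℝ} (hu : ContDiff ℝ 2 u)
    (hnn : ∀ x, 0 ≤ u x) (heq : ∀ x, lap u x = u x ^ p - lam * u x) :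
    ∃ C : ℝ, 0 ≤ C ∧ ∀ x0, ∀ R > 0, u x0 ^ (p - 1) ≤ max lam 0 + C / R ^ 2 := by
  set k : ℝ := 2 / (p - 1) with hk
  have hp1 : 0 < p - 1 := by linarith
  have hk0 : 0 < k := by positivity
  refine ⟨4 * k * (k + 1) + 2 * n * k, by positivity, fun x0 R hR => ?_⟩
  have hRHS : 0 ≤ max lam 0 + (4 * k * (k + 1) + 2 * n * k) / R ^ 2 := by positivity
  rcases (hnn x0).eq_or_lt with h0 | h0
  · rw [← h0, Real.zero_rpow hp1.ne']; exact hRHS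
  have hcont : Continuous (fun z => u z * (R ^ 2 - ‖z - x0‖ ^ 2) ^ k) := by
    refine hu.continuous.mul (Continuous.rpow_const (by fun_prop) fun x => Or.inr hk0.le)
  obtain ⟨y, hy, hmax⟩ := (isCompact_closedBall x0 R).exists_isMaxOn
    ⟨x0, mem_closedBall_self hR.le⟩ hcont.continuousOn
  set M := u y * (R ^ 2 - ‖y - x0‖ ^ 2) ^ k with hM
  have hMx : u x0 * (R ^ 2) ^ k ≤ M := by
    have := hmax (mem_closedBall_self hR.le)
    simpa using this
  have hMpos : 0 < M := lt_of_lt_of_le (by positivity) hMx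
  rw [mem_closedBall, dist_eq_norm] at hy
  have hφ0 : 0 ≤ R ^ 2 - ‖y - x0‖ ^ 2 := by nlinarith [norm_nonneg (y - x0)]
  have hφ : 0 < R ^ 2 - ‖y - x0‖ ^ 2 := by
    rcases hφ0.eq_or_lt with h | h
    · rw [hM, ← h, Real.zero_rpow hk0.ne'] at hMpos
      simp at hMpos
    · exact h
  have hylt : ‖y - x0‖ < R := by nlinarith [norm_nonneg (y - x0)]
  have huy : 0 < u y := by
    rcases (hnn y).eq_or_lt with h | h
    · rw [hM, ← h] at hMpos
      simp at hMpos
    · exact h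
  set ρ := ‖y - x0‖ ^ 2 with hρ
  have hev : ∀ᶠ s in 𝓝 ρ, 0 < R ^ 2 - s := by
    have : ∀ᶠ s in 𝓝 ρ, s < R ^ 2 := Iio_mem_nhds (by linarith)
    filter_upwards [this] with s hs
    linarith
  have hder : ∀ (a c s : ℝ), 0 < R ^ 2 - s →
      HasDerivAt (fun s => c * (R ^ 2 - s) ^ a) (c * (-a) * (R ^ 2 - s) ^ (a - 1)) s := by
    intro a c s hs
    have h1 : HasDerivAt (fun s : ℝ => R ^ 2 - s) (-1) s := by
      simpa using (hasDerivAt_id s).const_sub (R ^ 2)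
    have := (h1.rpow_const (p := a) (Or.inl hs.ne')).const_mul c
    refine HasDerivAt.congr_deriv this ?_
    ring
  have hc := cmp_max hu x0 y (F := fun s => M * (R ^ 2 - s) ^ (-k))
    (F' := fun s => M * (- -k) * (R ^ 2 - s) ^ (-k - 1))
    (hev.mono fun s hs => hder (-k) M s hs)
    (hder (-k - 1) (M * (- -k)) ρ hφ) (by
      have hq : Tendsto (fun z : EE n => ‖z - x0‖ ^ 2) (𝓝 y) (𝓝 ρ) := by
        have : Continuous (fun z : EE n => ‖z - x0‖ ^ 2) := by fun_prop
        exact this.tendsto y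
      filter_upwards [hq.eventually hev, nhds_ball hylt] with z hz hz'
      have e1 : u y - M * (R ^ 2 - ‖y - x0‖ ^ 2) ^ (-k) = 0 := by
        rw [Real.rpow_neg hφ0, hM]
        have : (R ^ 2 - ρ) ^ k ≠ 0 := by positivity
        field_simp
        ring
      have e2 : u z - M * (R ^ 2 - ‖z - x0‖ ^ 2) ^ (-k) ≤ 0 := by
        rw [Real.rpow_neg hz.le, sub_nonpos, ← div_eq_mul_inv, le_div_iff₀ (by positivity)]
        exact hmax hz'
      linarith)
  rw [heq y] at hc
  set φ := R ^ 2 - ρ with hφd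
  have ek1 : φ ^ (-k - 1) = φ ^ (-k) / φ := by rw [Real.rpow_sub_one hφ.ne']
  have ek2 : φ ^ (-k - 1 - 1) = φ ^ (-k) / φ / φ := by
    rw [Real.rpow_sub_one hφ.ne', Real.rpow_sub_one hφ.ne']
  have eM : M * φ ^ (-k) = u y := by
    rw [hM, Real.rpow_neg hφ0]
    have : φ ^ k ≠ 0 := by positivity
    field_simp
  have ep : u y ^ p = u y ^ (p - 1) * u y := by
    rw [Real.rpow_sub_one huy.ne']; field_simp
  have hb : u y ^ (p - 1) * φ ^ 2 ≤ lam * φ ^ 2 + 4 * ρ * k * (k + 1) + 2 * n * k * φ := by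
    have e : 4 * ρ * (M * (- -k) * -(-k - 1) * φ ^ (-k - 1 - 1))
        + 2 * n * (M * (- -k) * φ ^ (-k - 1))
        = u y * ((4 * ρ * k * (k + 1) + 2 * n * k * φ) / φ ^ 2) := by
      rw [ek1, ek2, ← eM]
      field_simp
      ring
    have hc' : u y ^ p - lam * u y ≤ u y * ((4 * ρ * k * (k + 1) + 2 * n * k * φ) / φ ^ 2) := by
      rw [← e]; exact hc
    rw [ep] at hc'
    have h3 : u y ^ (p - 1) - lam ≤ (4 * ρ * k * (k + 1) + 2 * n * k * φ) / φ ^ 2 := by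
      refine le_of_mul_le_mul_left ?_ huy
      linarith
    rw [le_div_iff₀ (by positivity)] at h3
    linarith
  have eMp : M ^ (p - 1) = u y ^ (p - 1) * φ ^ 2 := by
    rw [hM, Real.mul_rpow huy.le (by positivity), ← Real.rpow_mul hφ0]
    have : k * (p - 1) = (2:ℕ) := by rw [hk]; push_cast; field_simp
    rw [this, Real.rpow_natCast]
  have eR : (u x0 * (R ^ 2) ^ k) ^ (p - 1) = u x0 ^ (p - 1) * (R ^ 2) ^ 2 := by
    rw [Real.mul_rpow h0.le (by positivity), ← Real.rpow_mul (by positivity)]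
    have : k * (p - 1) = (2:ℕ) := by rw [hk]; push_cast; field_simp
    rw [this, Real.rpow_natCast]
  have hle := Real.rpow_le_rpow (by positivity) hMx hp1.le
  rw [eMp, eR] at hle
  have hρ0 : 0 ≤ ρ := by positivity
  have hφR : φ ≤ R ^ 2 := by linarith
  have hρR : ρ ≤ R ^ 2 := by linarith
  have b1 : lam * φ ^ 2 ≤ max lam 0 * (R ^ 2) ^ 2 := by
    have a1 : φ ^ 2 ≤ (R ^ 2) ^ 2 := by gcongr
    have a2 : lam * φ ^ 2 ≤ max lam 0 * φ ^ 2 := by gcongr; exact le_max_left _ _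
    have a3 : max lam 0 * φ ^ 2 ≤ max lam 0 * (R ^ 2) ^ 2 := by
      gcongr
    linarith
  have b2 : 4 * ρ * k * (k + 1) ≤ 4 * R ^ 2 * k * (k + 1) := by gcongr
  have b3 : 2 * n * k * φ ≤ 2 * n * k * R ^ 2 := by gcongr
  have : u x0 ^ (p - 1) * (R ^ 2) ^ 2
      ≤ (max lam 0 + (4 * k * (k + 1) + 2 * n * k) / R ^ 2) * (R ^ 2) ^ 2 := by
    have : (max lam 0 + (4 * k * (k + 1) + 2 * n * k) / R ^ 2) * (R ^ 2) ^ 2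
      = max lam 0 * (R ^ 2) ^ 2 + (4 * k * (k + 1) + 2 * n * k) * R ^ 2 := by
      field_simp
    rw [this]
    linarith
  exact le_of_mul_le_mul_right this (by positivity)

lemma lim_R {a b C : ℝ} (h : ∀ R > 0, a ≤ b + C / R ^ 2) : a ≤ b := by
  have ht : Tendsto (fun R : ℝ => b + C / R ^ 2) atTop (𝓝 (b + 0)) := by
    refine tendsto_const_nhds.add ?_
    exact tendsto_const_nhds.div_atTop (tendsto_pow_atTop (by norm_num))
  rw [add_zero] at ht
  refine ge_of_tendsto ht ?_
  filter_upwards [eventually_gt_atTop 0] with R hR using h R hR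

lemma lower_R {n : ℕ} {lam p : ℝ} (hp : 1 < p) {u : EE n → ℝ} (hu : ContDiff ℝ 2 u)
    (hpos : ∀ x, 0 < u x) (heq : ∀ x, lap u x = u x ^ p - lam * u x) (x0 : EE n)
    (R : ℝ) (hR : 0 < R) : lam ≤ u x0 ^ (p - 1) + ((8 + 4 * n) ^ 2 / 32) / R ^ 2 := by
  have hp1 : 0 < p - 1 := by linarith
  have hcont : Continuous (fun z => (R ^ 2 - ‖z - x0‖ ^ 2) ^ 2 / u z) :=
    Continuous.div (by fun_prop) hu.continuous fun x => (hpos x).ne'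
  obtain ⟨y, hy, hmax⟩ := (isCompact_closedBall x0 R).exists_isMaxOn
    ⟨x0, mem_closedBall_self hR.le⟩ hcont.continuousOn
  set N := (R ^ 2 - ‖y - x0‖ ^ 2) ^ 2 / u y with hN
  have hx0 := hpos x0
  have huy := hpos y
  have hNx : (R ^ 2) ^ 2 / u x0 ≤ N := by
    have := hmax (mem_closedBall_self hR.le)
    simpa using this
  have hNpos : 0 < N := lt_of_lt_of_le (by positivity) hNx
  rw [mem_closedBall, dist_eq_norm] at hy
  have hφ0 : 0 ≤ R ^ 2 - ‖y - x0‖ ^ 2 := by nlinarith [norm_nonneg (y - x0)]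
  have hφ : 0 < R ^ 2 - ‖y - x0‖ ^ 2 := by
    rcases hφ0.eq_or_lt with h | h
    · rw [hN, ← h] at hNpos
      simp at hNpos
    · exact h
  have hylt : ‖y - x0‖ < R := by nlinarith [norm_nonneg (y - x0)]
  set ρ := ‖y - x0‖ ^ 2 with hρ
  have h1 : ∀ s : ℝ, HasDerivAt (fun s : ℝ => R ^ 2 - s) (-1) s := fun s => by
    simpa using (hasDerivAt_id s).const_sub (R ^ 2)
  have hc := cmp_min hu x0 y (F := fun s => (R ^ 2 - s) ^ 2 / N)
    (F' := fun s => (R ^ 2 - s) * (-2 / N)) (F'' := (-1) * (-2 / N))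
    (Eventually.of_forall fun s => by
      have := ((h1 s).pow 2).div_const N
      refine HasDerivAt.congr_deriv this ?_
      simp; ring)
    ((h1 ρ).mul_const _) (by
      filter_upwards [nhds_ball hylt] with z hz'
      have e1 : u y - (R ^ 2 - ‖y - x0‖ ^ 2) ^ 2 / N = 0 := by
        rw [hN]
        field_simp
        ring
      have e2 : 0 ≤ u z - (R ^ 2 - ‖z - x0‖ ^ 2) ^ 2 / N := by
        have := hmax hz'
        have h3 : (R ^ 2 - ‖z - x0‖ ^ 2) ^ 2 / u z ≤ N := this
        rw [div_le_iff₀ (hpos z)] at h3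
        rw [sub_nonneg, div_le_iff₀ hNpos]
        linarith
      linarith)
  rw [heq y] at hc
  set φ := R ^ 2 - ρ with hφd
  have ep : u y ^ p = u y ^ (p - 1) * u y := by
    rw [Real.rpow_sub_one huy.ne']; field_simp
  have eN : u y = φ ^ 2 / N := by rw [hN]; field_simp
  have hb : (8 * R ^ 2 - (8 + 4 * n) * φ) / φ ^ 2 ≤ u y ^ (p - 1) - lam := by
    have e : 4 * ρ * ((-1) * (-2 / N)) + 2 * n * (φ * (-2 / N))
        = u y * ((8 * R ^ 2 - (8 + 4 * n) * φ) / φ ^ 2) := by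
      have : R ^ 2 = φ + ρ := by rw [hφd]; ring
      rw [eN, this]
      field_simp
      ring
    have hc' : u y * ((8 * R ^ 2 - (8 + 4 * n) * φ) / φ ^ 2) ≤ u y ^ p - lam * u y := by
      rw [← e]; exact hc
    rw [ep] at hc'
    refine le_of_mul_le_mul_left ?_ huy
    linarith
  have hq : -(((8 + 4 * n) ^ 2 / 32) / R ^ 2) ≤ (8 * R ^ 2 - (8 + 4 * n) * φ) / φ ^ 2 := by
    rw [le_div_iff₀ (by positivity), ← sub_nonneg]
    have : 8 * R ^ 2 - (8 + 4 * n) * φ - -(((8 + 4 * (n:ℝ)) ^ 2 / 32) / R ^ 2) * φ ^ 2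
      = (16 * R ^ 2 - (8 + 4 * n) * φ) ^ 2 / (32 * R ^ 2) := by
      field_simp
      ring
    rw [this]
    positivity
  have hyx : u y ≤ u x0 := by
    rw [hN, div_le_div_iff₀ hx0 huy] at hNx
    have a1 : φ ^ 2 ≤ (R ^ 2) ^ 2 := by
      gcongr
      have : 0 ≤ ρ := by positivity
      linarith
    have a2 : φ ^ 2 * u x0 ≤ (R ^ 2) ^ 2 * u x0 := by gcongr
    exact le_of_mul_le_mul_left (hNx.trans a2) (by positivity)
  have := Real.rpow_le_rpow huy.le hyx hp1.le
  linarith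

lemma strong_min {n : ℕ} {u : EE n → ℝ} (hu : ContDiff ℝ 2 u)
    (hnn : ∀ x, 0 ≤ u x) (hsup : ∀ x, lap u x ≤ 0) (x0 x1 : EE n) (h0 : 0 < u x0) :
    0 < u x1 := by
  have hev : ∀ᶠ z in 𝓝 x0, u x0 / 2 < u z :=
    hu.continuous.continuousAt.eventually (lt_mem_nhds (by linarith))
  obtain ⟨s, hs, hball⟩ := Metric.eventually_nhds_iff.1 hev
  set R := ‖x1 - x0‖ + 1 with hR
  have hR0 : 0 < R := by positivity
  set α : ℝ := (n + 1) / (2 * s ^ 2) with hα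
  have hα0 : 0 < α := by positivity
  set ε := u x0 / 2 with hε
  have hε0 : 0 < ε := by positivity
  have hcont : Continuous (fun z =>
      u z - (fun q => ε * (Real.exp (-α * q) - Real.exp (-α * R ^ 2))) (‖z - x0‖ ^ 2)) := by
    have := hu.continuous
    fun_prop
  obtain ⟨y, hy, hmin⟩ := (isCompact_closedBall x0 R).exists_isMinOn
    ⟨x0, mem_closedBall_self hR0.le⟩ hcont.continuousOn
  rw [mem_closedBall, dist_eq_norm] at hy
  have hval : 0 ≤ u y - ε * (Real.exp (-α * ‖y - x0‖ ^ 2) - Real.exp (-α * R ^ 2)) := by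
    by_cases hys : ‖y - x0‖ < s
    · have h1 := hball (y := y) (by rwa [dist_eq_norm])
      have h2 : Real.exp (-α * ‖y - x0‖ ^ 2) ≤ 1 := by
        rw [Real.exp_le_one_iff]
        have : 0 ≤ α * ‖y - x0‖ ^ 2 := by positivity
        linarith
      have h3 := Real.exp_pos (-α * R ^ 2)
      nlinarith
    push Not at hys
    rcases hy.eq_or_lt with h | h
    · rw [h]; simpa using hnn y
    exfalso
    have hd : ∀ c q : ℝ, HasDerivAt (fun q => c * Real.exp (-α * q))
        (c * (-α) * Real.exp (-α * q)) q := by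
      intro c q
      have := (((hasDerivAt_id q).const_mul (-α)).exp).const_mul c
      refine HasDerivAt.congr_deriv this ?_
      simp; ring
    have hc := cmp_min hu x0 y
      (F := fun q => ε * (Real.exp (-α * q) - Real.exp (-α * R ^ 2)))
      (F' := fun q => ε * (-α) * Real.exp (-α * q))
      (Eventually.of_forall fun q => by
        have := (hd ε q).sub_const (ε * Real.exp (-α * R ^ 2))
        refine HasDerivAt.congr_of_eventuallyEq this (Eventually.of_forall fun r => ?_)
        simp only []
        ring)
      (hd _ _) (by
        filter_upwards [nhds_ball h] with z hz
        exact hmin hz)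
    have hE := Real.exp_pos (-α * ‖y - x0‖ ^ 2)
    have h4 : (n:ℝ) + 1 ≤ 2 * α * ‖y - x0‖ ^ 2 := by
      have e : 2 * α * s ^ 2 = n + 1 := by rw [hα]; field_simp
      rw [← e]
      gcongr
    have h5 : 0 < (ε * α * Real.exp (-α * ‖y - x0‖ ^ 2)) *
        (4 * α * ‖y - x0‖ ^ 2 - 2 * n) := by
      apply mul_pos (by positivity)
      linarith
    have := hsup y
    nlinarith
  have hx1 : x1 ∈ closedBall x0 R := by
    rw [mem_closedBall, dist_eq_norm]; linarith
  have h6 := hmin hx1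
  simp only [Set.mem_ofPred_eq] at h6
  have h7 : Real.exp (-α * R ^ 2) < Real.exp (-α * ‖x1 - x0‖ ^ 2) := by
    rw [Real.exp_lt_exp]
    have : ‖x1 - x0‖ ^ 2 < R ^ 2 := by
      rw [hR]; nlinarith [norm_nonneg (x1 - x0)]
    nlinarith
  have h8 : 0 < ε * (Real.exp (-α * ‖x1 - x0‖ ^ 2) - Real.exp (-α * R ^ 2)) :=
    mul_pos hε0 (by linarith)
  linarith

theorem stmt13 (n : ℕ) (hn : 1 ≤ n) (lam p : ℝ) (hp : 1 < p)
    (u : EuclideanSpace ℝ (Fin n) → ℝ) (hu : ContDiff ℝ 2 u)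
    (hnn : ∀ x, 0 ≤ u x)
    (heq : ∀ x, lap u x = u x ^ p - lam * u x) :
    ∃ c : ℝ, ∀ x, u x = c := by
  have hp1 : 0 < p - 1 := by linarith
  obtain ⟨C, hC, hup⟩ := upper_R hp hu hnn heq
  have hupper : ∀ x, u x ^ (p - 1) ≤ max lam 0 := fun x => lim_R (hup x)
  by_cases hz : ∀ x, u x = 0
  · exact ⟨0, hz⟩
  push Not at hz
  obtain ⟨x0, hx0⟩ := hz
  have hx0 : 0 < u x0 := lt_of_le_of_ne (hnn x0) (Ne.symm hx0)
  have hlam : 0 < lam := by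
    by_contra h
    push Not at h
    have h1 := hupper x0
    rw [max_eq_right h] at h1
    have : 0 < u x0 ^ (p - 1) := by positivity
    linarith
  rw [max_eq_left hlam.le] at hupper
  have hsup : ∀ x, lap u x ≤ 0 := by
    intro x
    rw [heq x]
    rcases (hnn x).eq_or_lt with h | h
    · rw [← h, Real.zero_rpow (by linarith)]; simp
    · have ep : u x ^ p = u x ^ (p - 1) * u x := by
        rw [Real.rpow_sub_one h.ne']; field_simp
      rw [ep]
      nlinarith [hupper x]
  have hpos : ∀ x, 0 < u x := fun x => strong_min hu hnn hsup x0 x hx0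
  refine ⟨lam ^ (p - 1)⁻¹, fun x => ?_⟩
  have h1 : u x ^ (p - 1) = lam := le_antisymm (hupper x)
    (lim_R (fun R hR => lower_R hp hu hpos heq x R hR))
  rw [← h1, Real.rpow_rpow_inv (hnn x) hp1.ne']
end
end

section
/- Let u ∈ C²(ℝⁿ) be a solution of the Allen–Cahn equation Δu + u(1 − u²) = 0 on ℝⁿ such that u(0) = 0 and u(x) > 0 for every x = (x₁, …, xₙ) with x₁ < 0. Then u is one-dimensional: u(x₁, …, xₙ) = tanh(−x₁/√2) for all x ∈ ℝⁿ (equivalently, u has the form tanh((x₁ − a)/√2) up to the reflection x₁ ↦ −x₁, with a = 0). -/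
open Metric Set Filter Pointwise

noncomputable section

open Topology

/-- Coordinate vector. -/
def ev {n : ℕ} (i : Fin n) : EuclideanSpace ℝ (Fin n) := EuclideanSpace.single i 1

/-- `f` has at `x` the partial derivatives `p` and the Laplacian `L`. -/
def J2 {n : ℕ} (f : EuclideanSpace ℝ (Fin n) → ℝ) (x : EuclideanSpace ℝ (Fin n))
    (p : Fin n → ℝ) (L : ℝ) : Prop :=
  (∀ᶠ y in 𝓝 x, DifferentiableAt ℝ f y) ∧
  (∀ i, DifferentiableAt ℝ (fun y => fderiv ℝ f y (ev i)) x) ∧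
  (∀ i, fderiv ℝ f x (ev i) = p i) ∧ lap f x = L

lemma lap_eq {n : ℕ} (f : EuclideanSpace ℝ (Fin n) → ℝ) (x : EuclideanSpace ℝ (Fin n)) :
    lap f x = ∑ i : Fin n, fderiv ℝ (fun y => fderiv ℝ f y (ev i)) x (ev i) := rfl

lemma J2.of_contDiff {n : ℕ} {f : EuclideanSpace ℝ (Fin n) → ℝ} (hf : ContDiff ℝ 2 f)
    (x : EuclideanSpace ℝ (Fin n)) : J2 f x (fun i => fderiv ℝ f x (ev i)) (lap f x) := by
  refine ⟨Eventually.of_forall fun y => (hf.differentiable (by norm_num)) y, fun i => ?_,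
    fun i => rfl, rfl⟩
  have h1 : ContDiff ℝ 1 (fderiv ℝ f) := hf.fderiv_right (by norm_num)
  have h2 : Differentiable ℝ (fderiv ℝ f) := h1.differentiable (by norm_num)
  exact (h2 x).clm_apply (differentiableAt_const _)

lemma J2.mk' {n : ℕ} {f : EuclideanSpace ℝ (Fin n) → ℝ} {x : EuclideanSpace ℝ (Fin n)}
    (g : Fin n → EuclideanSpace ℝ (Fin n) → ℝ) (l : Fin n → ℝ)
    (h : ∀ᶠ y in 𝓝 x, DifferentiableAt ℝ f y ∧ ∀ i, fderiv ℝ f y (ev i) = g i y)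
    (h' : ∀ i, DifferentiableAt ℝ (g i) x ∧ fderiv ℝ (g i) x (ev i) = l i) :
    J2 f x (fun i => g i x) (∑ i, l i) := by
  have key : ∀ i, (fun y => fderiv ℝ f y (ev i)) =ᶠ[𝓝 x] g i := fun i => by
    filter_upwards [h] with y hy using hy.2 i
  refine ⟨h.mono fun y hy => hy.1, fun i => ?_, fun i => h.self_of_nhds.2 i, ?_⟩
  · exact (key i).differentiableAt_iff.2 (h' i).1
  · rw [lap_eq]
    refine Finset.sum_congr rfl fun i _ => ?_
    rw [(key i).fderiv_eq, (h' i).2]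

lemma J2.congr {n : ℕ} {f : EuclideanSpace ℝ (Fin n) → ℝ} {x : EuclideanSpace ℝ (Fin n)}
    {p p' : Fin n → ℝ} {L L' : ℝ} (h : J2 f x p L) (hp : ∀ i, p i = p' i) (hL : L = L') :
    J2 f x p' L' := by
  obtain rfl : p = p' := funext hp
  subst hL; exact h

lemma J2.sub {n : ℕ} {f g : EuclideanSpace ℝ (Fin n) → ℝ} {x : EuclideanSpace ℝ (Fin n)}
    {p q : Fin n → ℝ} {L M : ℝ} (hf : J2 f x p L) (hg : J2 g x q M) :
    J2 (fun y => f y - g y) x (fun i => p i - q i) (L - M) := by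
  obtain ⟨f1, f2, f3, f4⟩ := hf
  obtain ⟨g1, g2, g3, g4⟩ := hg
  have := J2.mk' (f := fun y => f y - g y) (x := x)
    (fun i y => fderiv ℝ f y (ev i) - fderiv ℝ g y (ev i))
    (fun i => fderiv ℝ (fun y => fderiv ℝ f y (ev i)) x (ev i) -
      fderiv ℝ (fun y => fderiv ℝ g y (ev i)) x (ev i))
    (by
      filter_upwards [f1, g1] with y h1 h2
      refine ⟨h1.sub h2, fun i => ?_⟩
      rw [fderiv_fun_sub h1 h2]; rfl)
    (by
      intro i
      refine ⟨(f2 i).sub (g2 i), ?_⟩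
      rw [fderiv_fun_sub (f2 i) (g2 i)]; rfl)
  refine this.congr (fun i => by rw [f3, g3]) ?_
  rw [Finset.sum_sub_distrib, ← lap_eq, ← lap_eq, f4, g4]

lemma J2.comp {n : ℕ} {f : EuclideanSpace ℝ (Fin n) → ℝ} {x : EuclideanSpace ℝ (Fin n)}
    {p : Fin n → ℝ} {L : ℝ} (hf : J2 f x p L) {F F' : ℝ → ℝ} {F'' : ℝ}
    (h1 : ∀ᶠ t in 𝓝 (f x), HasDerivAt F (F' t) t) (h2 : HasDerivAt F' F'' (f x)) :
    J2 (fun y => F (f y)) x (fun i => F' (f x) * p i)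
      (F' (f x) * L + F'' * ∑ i, (p i) ^ 2) := by
  obtain ⟨f1, f2, f3, f4⟩ := hf
  have hc : ContinuousAt f x := f1.self_of_nhds.continuousAt
  have := J2.mk' (f := fun y => F (f y)) (x := x)
    (fun i y => F' (f y) * fderiv ℝ f y (ev i))
    (fun i => F' (f x) * fderiv ℝ (fun y => fderiv ℝ f y (ev i)) x (ev i) + F'' * (p i) ^ 2)
    (by
      filter_upwards [f1, hc.eventually h1] with y hy1 hy2
      have := hy2.comp_hasFDerivAt y hy1.hasFDerivAt
      refine ⟨this.differentiableAt, fun i => ?_⟩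
      have e := this.fderiv
      simp only [Function.comp_def] at e
      rw [e]; simp)
    (by
      intro i
      have hA := h2.comp_hasFDerivAt x f1.self_of_nhds.hasFDerivAt
      have := hA.mul (f2 i).hasFDerivAt
      refine ⟨this.differentiableAt, ?_⟩
      have e := this.fderiv
      simp only [Function.comp_def, Pi.mul_def] at e
      rw [e]; simp [f3]; ring)
  refine this.congr (fun i => by rw [f3]) ?_
  rw [Finset.sum_add_distrib, ← Finset.mul_sum, ← Finset.mul_sum, ← lap_eq, f4]

lemma J2.const_mul {n : ℕ} {f : EuclideanSpace ℝ (Fin n) → ℝ} {x : EuclideanSpace ℝ (Fin n)}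
    {p : Fin n → ℝ} {L : ℝ} (hf : J2 f x p L) (c : ℝ) :
    J2 (fun y => c * f y) x (fun i => c * p i) (c * L) := by
  refine (hf.comp (F := fun t => c * t) (F' := fun _ => c) (F'' := 0)
    (Eventually.of_forall fun t => ?_) (hasDerivAt_const _ _)).congr (fun i => rfl) (by ring)
  simpa using (hasDerivAt_id t).const_mul c

lemma J2.translate {n : ℕ} {f : EuclideanSpace ℝ (Fin n) → ℝ} {x : EuclideanSpace ℝ (Fin n)}
    {p : Fin n → ℝ} {L : ℝ} (hf : J2 f x p L) : J2 (fun w => f (w + x)) 0 p L := by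
  obtain ⟨f1, f2, f3, f4⟩ := hf
  have ht : Tendsto (fun w => w + x) (𝓝 0) (𝓝 x) := by
    have : Continuous fun w : EuclideanSpace ℝ (Fin n) => w + x := by fun_prop
    simpa using this.tendsto 0
  refine ⟨?_, ?_, ?_, ?_⟩
  · filter_upwards [ht.eventually f1] with y hy
    exact (differentiableAt_comp_add_right x).2 hy
  · intro i
    simp only [fderiv_comp_add_right]
    refine (differentiableAt_comp_add_right (f := fun y => fderiv ℝ f y (ev i)) x).2 ?_
    simpa using f2 i
  · intro i
    simp only [fderiv_comp_add_right, zero_add, f3]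
  · rw [← f4, lap_eq, lap_eq]
    refine Finset.sum_congr rfl fun i _ => ?_
    simp only [fderiv_comp_add_right]
    have := fderiv_comp_add_right (𝕜 := ℝ) (f := fun y => fderiv ℝ f y (ev i)) (x := 0) x
    rw [this, zero_add]

lemma J2.grad_max {n : ℕ} {f : EuclideanSpace ℝ (Fin n) → ℝ} {x : EuclideanSpace ℝ (Fin n)}
    {p : Fin n → ℝ} {L : ℝ} (hf : J2 f x p L) (hm : IsLocalMax f x) (i : Fin n) : p i = 0 := by
  rw [← hf.2.2.1 i, hm.fderiv_eq_zero]; rfl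

lemma J2.lap_max {n : ℕ} {f : EuclideanSpace ℝ (Fin n) → ℝ} {x : EuclideanSpace ℝ (Fin n)}
    {p : Fin n → ℝ} {L : ℝ} (hf : J2 f x p L) (hm : IsLocalMax f x) : L ≤ 0 := by
  have hp := hf.grad_max hm
  obtain ⟨f1, f2, f3, f4⟩ := hf
  rw [← f4, lap_eq]
  refine Finset.sum_nonpos fun i _ => ?_
  by_contra! hpos
  have hl : ∀ t : ℝ, HasDerivAt (fun t : ℝ => x + t • ev i) (ev i) t := fun t => by
    simpa using ((hasDerivAt_id t).smul_const (ev i)).const_add x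
  have hl0 : Tendsto (fun t : ℝ => x + t • ev i) (𝓝 0) (𝓝 x) := by
    simpa using (hl 0).continuousAt.tendsto
  set φ : ℝ → ℝ := fun t => f (x + t • ev i) with hφ
  have d1 : ∀ᶠ t in 𝓝 (0:ℝ), HasDerivAt φ (fderiv ℝ f (x + t • ev i) (ev i)) t := by
    filter_upwards [hl0.eventually f1] with t ht
    exact ht.hasFDerivAt.comp_hasDerivAt t (hl t)
  have d1' : deriv φ =ᶠ[𝓝 0] fun t => fderiv ℝ f (x + t • ev i) (ev i) := by
    filter_upwards [d1] with t ht using ht.deriv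
  have d2 : deriv (deriv φ) 0 = fderiv ℝ (fun y => fderiv ℝ f y (ev i)) x (ev i) := by
    rw [d1'.deriv_eq]
    have h : DifferentiableAt ℝ (fun y => fderiv ℝ f y (ev i)) (x + (0:ℝ) • ev i) := by
      simpa using f2 i
    have := (h.hasFDerivAt.comp_hasDerivAt (0:ℝ) (hl 0)).deriv
    simpa [Function.comp_def] using this
  have hmin : IsLocalMin φ 0 := by
    refine isLocalMin_of_deriv_deriv_pos (by rw [d2]; exact hpos) ?_ d1.self_of_nhds.continuousAt
    rw [d1'.self_of_nhds]; simp [f3, hp]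
  have hmax : ∀ᶠ t in 𝓝 (0:ℝ), φ t ≤ φ 0 := by
    have := hl0.eventually hm
    filter_upwards [this] with t ht
    simpa [hφ] using ht
  have hconst : φ =ᶠ[𝓝 0] fun _ => φ 0 := by
    filter_upwards [hmin, hmax] with t h1 h2 using le_antisymm h2 h1
  have : deriv (deriv φ) 0 = 0 := by
    rw [hconst.deriv.deriv_eq]; simp
  rw [d2] at this
  linarith

lemma inner_ev {n : ℕ} (x : EuclideanSpace ℝ (Fin n)) (i : Fin n) : inner ℝ x (ev i) = x i := by
  simp [ev, EuclideanSpace.inner_single_right]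

lemma ev_apply {n : ℕ} (i : Fin n) : (ev i : EuclideanSpace ℝ (Fin n)) i = 1 := by
  simp [ev]

lemma J2.sq {n : ℕ} (c x : EuclideanSpace ℝ (Fin n)) :
    J2 (fun y => ‖y - c‖ ^ 2) x (fun i => 2 * (x i - c i)) (2 * n) := by
  have := J2.mk' (f := fun y => ‖y - c‖ ^ 2) (x := x) (fun i y => 2 * (y i - c i)) (fun _ => 2)
    (by
      refine Eventually.of_forall fun y => ?_
      have := ((hasFDerivAt_id (𝕜 := ℝ) y).sub_const c).norm_sq
      refine ⟨this.differentiableAt, fun i => ?_⟩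
      have e := this.fderiv
      simp only [id] at e
      rw [e]; simp [inner_ev])
    (by
      intro i
      have h : HasFDerivAt (fun y : EuclideanSpace ℝ (Fin n) => y i)
        (EuclideanSpace.proj i : EuclideanSpace ℝ (Fin n) →L[ℝ] ℝ) x :=
        (EuclideanSpace.proj i : EuclideanSpace ℝ (Fin n) →L[ℝ] ℝ).hasFDerivAt
      have := (h.sub_const (c i)).const_mul 2
      refine ⟨this.differentiableAt, ?_⟩
      rw [this.fderiv]; simp [ev_apply])
  refine this.congr (fun i => rfl) (by simp; ring)

lemma J2.coord {n : ℕ} (j : Fin n) (x : EuclideanSpace ℝ (Fin n)) :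
    J2 (fun y => y j) x (fun i => (ev i : EuclideanSpace ℝ (Fin n)) j) 0 := by
  have := J2.mk' (f := fun y : EuclideanSpace ℝ (Fin n) => y j) (x := x)
    (fun i y => (ev i : EuclideanSpace ℝ (Fin n)) j) (fun _ => 0)
    (by
      refine Eventually.of_forall fun y => ?_
      have h : HasFDerivAt (fun y : EuclideanSpace ℝ (Fin n) => y j)
        (EuclideanSpace.proj j : EuclideanSpace ℝ (Fin n) →L[ℝ] ℝ) y :=
        (EuclideanSpace.proj j : EuclideanSpace ℝ (Fin n) →L[ℝ] ℝ).hasFDerivAt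
      refine ⟨h.differentiableAt, fun i => ?_⟩
      rw [h.fderiv]; simp)
    (by intro i; simp)
  exact this.congr (fun i => rfl) (by simp)

lemma sum_ev_sq {n : ℕ} (j : Fin n) :
    ∑ i, ((ev i : EuclideanSpace ℝ (Fin n)) j) ^ 2 = 1 := by
  simp [ev]

lemma sum_sq_sub {n : ℕ} (x c : EuclideanSpace ℝ (Fin n)) :
    ∑ i, (x i - c i) ^ 2 = ‖x - c‖ ^ 2 := by
  rw [EuclideanSpace.real_norm_sq_eq]; simp

/-- Keller–Osserman bound. -/
lemma KO {n : ℕ} {u : EuclideanSpace ℝ (Fin n) → ℝ} (hu : ContDiff ℝ 2 u)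
    (heq : ∀ x, lap u x = u x ^ 3 - u x) (x0 : EuclideanSpace ℝ (Fin n)) : u x0 ≤ 1 := by
  by_contra! hx
  set d := u x0 - 1 with hd
  have hdpos : 0 < d := by linarith
  have main : ∀ R : ℝ, 0 < R → d ^ 2 * R ^ 2 ≤ 2 * n + 8 := by
    intro R hR
    set ρ : EuclideanSpace ℝ (Fin n) → ℝ := fun y => R ^ 2 - ‖y - x0‖ ^ 2 with hρ
    have hcont : Continuous fun y => (u y - 1) * ρ y := by
      have := hu.continuous
      fun_prop
    obtain ⟨p, hpB, hpmax⟩ := (isCompact_closedBall x0 R).exists_isMaxOn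
      ⟨x0, by simp [hR.le]⟩ hcont.continuousOn
    set m := (u p - 1) * ρ p with hm
    have hm1 : d * R ^ 2 ≤ m := by
      have := hpmax (show x0 ∈ closedBall x0 R by simp [hR.le])
      simpa [hρ, hd] using this
    have hmpos : 0 < m := lt_of_lt_of_le (by positivity) hm1
    have hpR : ‖p - x0‖ ≤ R := by simpa [dist_eq_norm] using hpB
    have hρp : 0 < ρ p := by
      have h0 : 0 ≤ ρ p := by
        simp only [hρ]; nlinarith [norm_nonneg (p - x0)]
      rcases h0.lt_or_eq with h | h
      · exact h
      · rw [hm, ← h] at hmpos; simp at hmpos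
    have hρJ : J2 ρ p (fun i => -(2 * (p i - x0 i))) (-(2 * n)) := by
      have hc : J2 (fun _ : EuclideanSpace ℝ (Fin n) => R ^ 2) p (fun _ => 0) 0 := by
        have := J2.of_contDiff (n := n) (f := fun _ => R ^ 2) contDiff_const p
        refine this.congr (fun i => by simp) (by simp [lap])
      exact (hc.sub (J2.sq x0 p)).congr (fun i => by ring) (by ring)
    have hinv : J2 (fun y => (ρ y)⁻¹) p (fun i => (-(ρ p ^ 2)⁻¹) * (-(2 * (p i - x0 i))))
        ((-(ρ p ^ 2)⁻¹) * (-(2 * n)) + (2 * (ρ p ^ 3)⁻¹) * ∑ i, (-(2 * (p i - x0 i))) ^ 2) := by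
      refine hρJ.comp (F := fun t => t⁻¹) (F' := fun t => -(t ^ 2)⁻¹) ?_ ?_
      · filter_upwards [lt_mem_nhds hρp] with t ht
        exact hasDerivAt_inv ht.ne'
      · have := ((hasDerivAt_pow 2 (ρ p)).inv (by positivity)).neg
        refine this.congr_deriv ?_
        field_simp
        simp [mul_comm]
    have hJ := (J2.of_contDiff hu p).sub (hinv.const_mul m)
    have hloc : IsLocalMax (fun y => u y - m * (ρ y)⁻¹) p := by
      have hev : ∀ᶠ y in 𝓝 p, 0 < ρ y := by
        have : Continuous ρ := by fun_prop
        exact this.continuousAt.eventually (lt_mem_nhds hρp)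
      filter_upwards [hev] with y hy
      have hyB : y ∈ closedBall x0 R := by
        rw [mem_closedBall, dist_eq_norm]
        simp only [hρ] at hy
        exact (le_abs_self _).trans (abs_le_of_sq_le_sq (by linarith) hR.le)
      have h1 : (u y - 1) * ρ y ≤ m := hpmax hyB
      have h2 : u y - 1 ≤ m * (ρ y)⁻¹ := by
        rw [← div_eq_mul_inv, le_div_iff₀ hy]; exact h1
      have h3 : u p - 1 = m * (ρ p)⁻¹ := by
        rw [← div_eq_mul_inv, eq_div_iff hρp.ne']
      linarith
    have hL := hJ.lap_max hloc
    have hsum : ∑ i, (-(2 * (p i - x0 i))) ^ 2 = 4 * ‖p - x0‖ ^ 2 := by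
      rw [← sum_sq_sub, Finset.mul_sum]
      exact Finset.sum_congr rfl fun i _ => by ring
    rw [hsum, heq] at hL
    set w := u p - 1 with hw
    have hup : u p = w + 1 := by rw [hw]; ring
    have hwpos : 0 < w := by
      by_contra! h
      have : m ≤ 0 := mul_nonpos_of_nonpos_of_nonneg h hρp.le
      linarith
    have hw3 : w ^ 3 ≤ m * (2 * n * (ρ p ^ 2)⁻¹ + 8 * ‖p - x0‖ ^ 2 * (ρ p ^ 3)⁻¹) := by
      rw [hup] at hL
      nlinarith [pow_pos hwpos 2]
    have hrr : ‖p - x0‖ ^ 2 ≤ R ^ 2 := by nlinarith [norm_nonneg (p - x0)]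
    have hρR : ρ p ≤ R ^ 2 := by simp only [hρ]; nlinarith [sq_nonneg (‖p - x0‖)]
    have e1 : w ^ 3 * ρ p ^ 3 = m ^ 3 := by rw [hm]; ring
    have e2 : m ^ 3 ≤ m * (2 * n * ρ p + 8 * ‖p - x0‖ ^ 2) := by
      rw [← e1]
      have := mul_le_mul_of_nonneg_right hw3 (pow_pos hρp 3).le
      refine this.trans (le_of_eq ?_)
      field_simp
    have e3 : m ^ 2 ≤ 2 * n * ρ p + 8 * ‖p - x0‖ ^ 2 := by
      have : m * m ^ 2 ≤ m * (2 * n * ρ p + 8 * ‖p - x0‖ ^ 2) := by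
        calc m * m ^ 2 = m ^ 3 := by ring
          _ ≤ _ := e2
      exact le_of_mul_le_mul_left this hmpos
    have e4 : 2 * n * ρ p ≤ 2 * n * R ^ 2 := by gcongr
    have e5 : (d * R ^ 2) ^ 2 ≤ m ^ 2 := by gcongr
    have e6 : (d ^ 2 * R ^ 2) * R ^ 2 ≤ (2 * n + 8) * R ^ 2 := by nlinarith
    exact le_of_mul_le_mul_right e6 (by positivity)
  have h := main (Real.sqrt (2 * n + 9) / d) (by positivity)
  rw [div_pow, Real.sq_sqrt (by positivity), mul_div_cancel₀ _ (by positivity)] at h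
  linarith

/-- Strong maximum principle on the whole space. -/
lemma SMP {n : ℕ} {w : EuclideanSpace ℝ (Fin n) → ℝ} (hw : ContDiff ℝ 2 w)
    (h0 : ∀ x, 0 ≤ w x) (heq : ∀ x, lap w x ≤ 2 * w x) (p q : EuclideanSpace ℝ (Fin n))
    (hp : 0 < w p) : 0 < w q := by
  have hev : ∀ᶠ y in 𝓝 p, w p / 2 < w y :=
    hw.continuous.continuousAt.eventually (lt_mem_nhds (by linarith))
  obtain ⟨r, hr, hball⟩ := Metric.eventually_nhds_iff_ball.1 hev
  set R := ‖q - p‖ + 1 with hR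
  have hRpos : 0 < R := by positivity
  set α : ℝ := (n + 2) / r ^ 2 + 1 with hα
  have hαpos : 0 < α := by positivity
  have hα1 : 1 ≤ α := by
    have : 0 ≤ ((n:ℝ) + 2) / r ^ 2 := by positivity
    linarith
  have hαr : n + 2 ≤ α * r ^ 2 := by
    have : (α - 1) * r ^ 2 = n + 2 := by
      rw [hα]; field_simp; ring
    nlinarith [sq_nonneg r]
  set ε := w p / 2 with hε
  have hεpos : 0 < ε := by positivity
  set b : EuclideanSpace ℝ (Fin n) → ℝ :=
    fun y => Real.exp (-α * ‖y - p‖ ^ 2) - Real.exp (-α * R ^ 2) with hb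
  have hbc : Continuous b := by fun_prop
  obtain ⟨z, hzB, hzmin⟩ := (isCompact_closedBall p R).exists_isMinOn
      ⟨p, by simp [hRpos.le]⟩ (hw.continuous.sub (hbc.const_mul ε)).continuousOn
  have hbq : 0 < b q := by
    simp only [hb, sub_pos]
    apply Real.exp_lt_exp.2
    have : ‖q - p‖ ^ 2 < R ^ 2 := by
      rw [hR]; nlinarith [norm_nonneg (q - p)]
    nlinarith
  have hqB : q ∈ closedBall p R := by rw [mem_closedBall, dist_eq_norm, hR]; linarith
  have hqz : w z - ε * b z ≤ w q - ε * b q := hzmin hqB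
  by_cases hz : 0 ≤ w z - ε * b z
  · have := mul_pos hεpos hbq
    linarith
  exfalso
  push Not at hz
  have hzR : ‖z - p‖ ≤ R := by simpa [dist_eq_norm] using hzB
  have hzR' : ‖z - p‖ < R := by
    rcases hzR.lt_or_eq with h | h
    · exact h
    · have : b z = 0 := by simp [hb, h]
      rw [this] at hz
      linarith [h0 z]
  have hzr : r ≤ ‖z - p‖ := by
    by_contra! h
    have h1 := hball z (by rw [mem_ball, dist_eq_norm]; exact h)
    have h2 : b z ≤ 1 := by
      have e1 : Real.exp (-α * ‖z - p‖ ^ 2) ≤ 1 := Real.exp_le_one_iff.2 (by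
        have := mul_nonneg hαpos.le (sq_nonneg ‖z - p‖); linarith)
      have e2 := Real.exp_pos (-α * R ^ 2)
      simp only [hb]; linarith
    nlinarith
  have hbJ : J2 b z (fun i => -α * Real.exp (-α * ‖z - p‖ ^ 2) * (2 * (z i - p i)))
      (-α * Real.exp (-α * ‖z - p‖ ^ 2) * (2 * n) +
        α ^ 2 * Real.exp (-α * ‖z - p‖ ^ 2) * ∑ i, (2 * (z i - p i)) ^ 2) := by
    have key : ∀ t : ℝ, HasDerivAt (fun t => Real.exp (-α * t)) (-α * Real.exp (-α * t)) t := by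
      intro t
      have := ((hasDerivAt_id t).const_mul (-α)).exp
      refine this.congr_deriv ?_
      simp; ring
    refine (J2.sq p z).comp (F := fun t => Real.exp (-α * t) - Real.exp (-α * R ^ 2))
      (F' := fun t => -α * Real.exp (-α * t)) ?_ ?_
    · exact Eventually.of_forall fun t => (key t).sub_const _
    · refine ((key _).const_mul (-α)).congr_deriv ?_
      ring
  have hJ := (hbJ.const_mul ε).sub (J2.of_contDiff hw z)
  have hloc : IsLocalMax (fun y => ε * b y - w y) z := by
    have : ball p R ∈ 𝓝 z := isOpen_ball.mem_nhds (by rw [mem_ball, dist_eq_norm]; exact hzR')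
    filter_upwards [this] with y hy
    have : w z - ε * b z ≤ w y - ε * b y := hzmin (ball_subset_closedBall hy)
    linarith
  have hL := hJ.lap_max hloc
  have hsum : ∑ i, (2 * (z i - p i)) ^ 2 = 4 * ‖z - p‖ ^ 2 := by
    rw [← sum_sq_sub, Finset.mul_sum]
    exact Finset.sum_congr rfl fun i _ => by ring
  rw [hsum] at hL
  have hE := Real.exp_pos (-α * ‖z - p‖ ^ 2)
  set X := Real.exp (-α * ‖z - p‖ ^ 2) with hX
  have hbX : b z ≤ X := by
    have e2 := Real.exp_pos (-α * R ^ 2)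
    simp only [hb, ← hX]; linarith
  have hs : n + 2 ≤ α * ‖z - p‖ ^ 2 := by
    have : r ^ 2 ≤ ‖z - p‖ ^ 2 := by gcongr
    nlinarith
  have hn0 : (0:ℝ) ≤ n := Nat.cast_nonneg n
  have hcoef : 2 ≤ -α * (2 * n) + α ^ 2 * (4 * ‖z - p‖ ^ 2) := by
    have : α * (n + 2) ≤ α * (α * ‖z - p‖ ^ 2) := by gcongr
    nlinarith
  have : 2 * X ≤ -α * X * (2 * n) + α ^ 2 * X * (4 * ‖z - p‖ ^ 2) := by nlinarith
  have h5 := mul_le_mul_of_nonneg_left this hεpos.le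
  have h6 := heq z
  have h7 := mul_le_mul_of_nonneg_left hbX hεpos.le
  linarith

/-- The one-dimensional profile. -/
def hh (t : ℝ) : ℝ := Real.tanh (t / Real.sqrt 2)

lemma hasDerivAt_tanh' (t : ℝ) : HasDerivAt Real.tanh (1 - Real.tanh t ^ 2) t := by
  have hc := (Real.cosh_pos t).ne'
  have := (Real.hasDerivAt_sinh t).div (Real.hasDerivAt_cosh t) hc
  have e : Real.tanh = Real.sinh / Real.cosh := by
    funext x; simp [Real.tanh_eq_sinh_div_cosh]
  rw [e]
  refine this.congr_deriv ?_
  simp only [Pi.div_apply]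
  field_simp

lemma hh_deriv (t : ℝ) : HasDerivAt hh ((1 - hh t ^ 2) / Real.sqrt 2) t := by
  have := (hasDerivAt_tanh' (t / Real.sqrt 2)).comp t ((hasDerivAt_id t).div_const (Real.sqrt 2))
  refine this.congr_deriv ?_
  simp [hh]; ring

lemma hh_deriv2 (t : ℝ) :
    HasDerivAt (fun t => (1 - hh t ^ 2) / Real.sqrt 2) (-(hh t * (1 - hh t ^ 2))) t := by
  have := (((hh_deriv t).pow 2).const_sub 1).div_const (Real.sqrt 2)
  refine this.congr_deriv ?_
  have h2 : Real.sqrt 2 ^ 2 = 2 := Real.sq_sqrt (by norm_num)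
  have h3 : Real.sqrt 2 ≠ 0 := by positivity
  field_simp
  rw [h2]; simp; ring

lemma hh_mono : StrictMono hh := by
  refine strictMono_of_deriv_pos fun t => ?_
  rw [(hh_deriv t).deriv]
  have h1 : hh t < 1 := Real.tanh_lt_one _
  have h2 : -1 < hh t := Real.neg_one_lt_tanh _
  have : 0 < 1 - hh t ^ 2 := by nlinarith
  positivity

lemma hh_zero : hh 0 = 0 := by simp [hh]

lemma hh_sq (t : ℝ) : 0 < 1 - hh t ^ 2 := by
  have h1 : hh t < 1 := Real.tanh_lt_one _
  have h2 : -1 < hh t := Real.neg_one_lt_tanh _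
  nlinarith

lemma hh_cont : Continuous hh := continuous_iff_continuousAt.2 fun t => (hh_deriv t).continuousAt

/-- Comparison of a positive solution with a subsolution. -/
lemma compare_sub {n : ℕ} {u ψ : EuclideanSpace ℝ (Fin n) → ℝ} (hu : ContDiff ℝ 2 u)
    (heq : ∀ x, lap u x = u x ^ 3 - u x) (c : EuclideanSpace ℝ (Fin n)) (R : ℝ)
    (hpos : ∀ x ∈ closedBall c R, 0 < u x) (hψc : Continuous ψ)
    (hbd : ∀ x, ‖x - c‖ = R → ψ x ≤ 0)
    (hψ : ∀ x, ‖x - c‖ < R → ∃ p L, J2 ψ x p L ∧ ψ x ^ 3 - ψ x ≤ L) :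
    ∀ x ∈ closedBall c R, ψ x ≤ u x := by
  intro x hx
  by_contra! hlt
  obtain ⟨z, hzB, hz⟩ := (isCompact_closedBall c R).exists_isMaxOn ⟨x, hx⟩
    (f := fun y => ψ y / u y)
    (hψc.continuousOn.div hu.continuous.continuousOn fun y hy => (hpos y hy).ne')
  have huz := hpos z hzB
  set τ := ψ z / u z with hτ
  have hτ1 : 1 < τ := by
    have h1 : ψ x / u x ≤ τ := hz hx
    have h2 : 1 < ψ x / u x := by rw [lt_div_iff₀ (hpos x hx)]; linarith
    linarith
  have hψz : ψ z = τ * u z := by rw [hτ]; field_simp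
  have hzR : ‖z - c‖ < R := by
    have h1 : ‖z - c‖ ≤ R := by simpa [dist_eq_norm] using hzB
    rcases h1.lt_or_eq with h | h
    · exact h
    · have := hbd z h
      have : 0 < τ * u z := by positivity
      linarith
  obtain ⟨p, L, hJ, hL⟩ := hψ z hzR
  have hJ2 := hJ.sub ((J2.of_contDiff hu z).const_mul τ)
  have hloc : IsLocalMax (fun y => ψ y - τ * u y) z := by
    have : ball c R ∈ 𝓝 z := isOpen_ball.mem_nhds (by rw [mem_ball, dist_eq_norm]; exact hzR)
    filter_upwards [this] with y hy
    have hyB := ball_subset_closedBall hy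
    have h1 : ψ y / u y ≤ τ := hz hyB
    rw [div_le_iff₀ (hpos y hyB)] at h1
    linarith
  have h := hJ2.lap_max hloc
  rw [heq, ] at h
  rw [hψz] at hL
  have h3 : 0 < u z ^ 3 := by positivity
  have : τ < τ ^ 3 := by nlinarith [mul_pos (sub_pos.2 hτ1) (sub_pos.2 hτ1)]
  nlinarith

set_option maxHeartbeats 2000000 in
lemma lower_aux {n : ℕ} {u : EuclideanSpace ℝ (Fin n) → ℝ} (hu : ContDiff ℝ 2 u)
    (heq : ∀ x, lap u x = u x ^ 3 - u x) (c : EuclideanSpace ℝ (Fin n)) (R δ : ℝ)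
    (hpos : ∀ x ∈ closedBall c R, 0 < u x) (hδ : 0 < δ) (hδ4 : δ < 1 / 4) (hR : 4 ≤ R)
    (hR1 : n / R ≤ δ / 6) (hR2 : n / R ≤ hh (1 / 2) * δ) :
    ∀ x ∈ closedBall c R, hh ((1 - δ) * ((R ^ 2 - ‖x - c‖ ^ 2) / (2 * R)) -
      δ * (1 - Real.exp (-((R ^ 2 - ‖x - c‖ ^ 2) / (2 * R))))) ≤ u x := by
  have hRpos : 0 < R := by linarith
  -- everything as a function of `t = ‖x - c‖ ^ 2`
  set ρ : ℝ → ℝ := fun t => (R ^ 2 - t) / (2 * R) with hρ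
  have hρd : ∀ t, HasDerivAt ρ (-(1 / (2 * R))) t := fun t => by
    have := ((hasDerivAt_id t).const_sub (R ^ 2)).div_const (2 * R)
    exact this.congr_deriv (by ring)
  set k : ℝ → ℝ := fun s => (1 - δ) * s - δ * (1 - Real.exp (-s)) with hk
  have hkd : ∀ s, HasDerivAt k ((1 - δ) - δ * Real.exp (-s)) s := fun s => by
    have h1 : HasDerivAt (fun s => Real.exp (-s)) (-Real.exp (-s)) s := by
      simpa using (hasDerivAt_neg s).exp
    have := ((hasDerivAt_id s).const_mul (1 - δ)).sub ((h1.const_sub 1).const_mul δ)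
    exact this.congr_deriv (by ring)
  have hkd2 : ∀ s, HasDerivAt (fun s => (1 - δ) - δ * Real.exp (-s)) (δ * Real.exp (-s)) s :=
    fun s => by
    have h1 : HasDerivAt (fun s => Real.exp (-s)) (-Real.exp (-s)) s := by
      simpa using (hasDerivAt_neg s).exp
    exact ((h1.const_mul δ).const_sub (1 - δ)).congr_deriv (by ring)
  have hcont : Continuous fun x : EuclideanSpace ℝ (Fin n) => hh (k (ρ (‖x - c‖ ^ 2))) := by
    refine hh_cont.comp ?_
    simp only [hk, hρ]
    fun_prop
  refine compare_sub (ψ := fun x => hh (k (ρ (‖x - c‖ ^ 2)))) hu heq c R hpos hcont ?_ ?_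
  · intro x hx
    have : k (ρ (‖x - c‖ ^ 2)) = 0 := by simp [hk, hρ, hx]
    simp only [this, hh_zero, le_refl]
  intro x hx
  have J1 := (J2.sq c x).comp (F := ρ) (F' := fun _ => -(1 / (2 * R))) (F'' := 0)
    (Eventually.of_forall hρd) (hasDerivAt_const _ _)
  have J2' := J1.comp (F := k) (Eventually.of_forall hkd) (hkd2 _)
  have J3 := J2'.comp (F := hh) (Eventually.of_forall hh_deriv) (hh_deriv2 _)
  refine ⟨_, _, J3, ?_⟩
  have hsum : ∀ a b : ℝ, ∑ i, (a * (b * (2 * (x i - c i)))) ^ 2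
      = a ^ 2 * b ^ 2 * 4 * ‖x - c‖ ^ 2 := by
    intro a b
    rw [← sum_sq_sub, Finset.mul_sum]
    exact Finset.sum_congr rfl fun i _ => by ring
  have hsum2 : ∀ b : ℝ, ∑ i, (b * (2 * (x i - c i))) ^ 2
      = b ^ 2 * 4 * ‖x - c‖ ^ 2 := by
    intro b
    rw [← sum_sq_sub, Finset.mul_sum]
    exact Finset.sum_congr rfl fun i _ => by ring
  rw [hsum, hsum2]
  set s := ρ (‖x - c‖ ^ 2) with hs
  set K' := (1 - δ) - δ * Real.exp (-s) with hK'
  set H := hh (k s) with hH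
  have hnn := norm_nonneg (x - c)
  have hspos : 0 < s := by
    simp only [hs, hρ]
    apply div_pos _ (by positivity)
    nlinarith
  have hr2 : ‖x - c‖ ^ 2 = R ^ 2 * (1 - 2 * s / R) := by
    simp only [hs, hρ]; field_simp; ring
  set q := 1 - 2 * s / R with hq
  have hq0 : 0 ≤ q := by
    have : 0 ≤ R ^ 2 * q := by rw [← hr2]; positivity
    exact nonneg_of_mul_nonneg_right this (by positivity)
  have hq1 : q ≤ 1 := by
    have : 0 ≤ 2 * s / R := by positivity
    linarith
  have hEpos := Real.exp_pos (-s)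
  have hE1 : Real.exp (-s) ≤ 1 := Real.exp_le_one_iff.2 (by linarith)
  have hK0 : 0 ≤ K' := by nlinarith
  have hK1 : K' ≤ 1 - δ := by nlinarith
  have hKq : K' ^ 2 * q ≤ 1 - δ := by
    have h1 : K' ^ 2 ≤ 1 - δ := by nlinarith
    nlinarith [sq_nonneg K']
  have hks : s / 2 ≤ k s := by
    have : 1 - s ≤ Real.exp (-s) := by linarith [Real.add_one_le_exp (-s)]
    simp only [hk]
    nlinarith
  have hH0 : 0 ≤ H := by
    rw [← hh_zero]; exact hh_mono.monotone (by linarith)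
  have hHsq : 0 < 1 - H ^ 2 := hh_sq _
  rw [hr2]
  have h2 : Real.sqrt 2 ^ 2 = 2 := Real.sq_sqrt (by norm_num)
  have hs2 : 1 ≤ Real.sqrt 2 := by
    rw [Real.le_sqrt] <;> norm_num
  have main : 0 ≤ (1 / Real.sqrt 2) * (-(K' * (n / R)) + δ * Real.exp (-s) * q)
      + H * (1 - K' ^ 2 * q) := by
    have hnR : 0 ≤ n / R := by positivity
    have hKn : K' * (n / R) ≤ n / R := by nlinarith
    rcases le_total s 1 with h | h
    · have hqh : 1 / 2 ≤ q := by
        have : 2 * s / R ≤ 1 / 2 := by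
          rw [div_le_iff₀ hRpos]; linarith
        linarith
      have hexp : 1 / 3 ≤ Real.exp (-s) := by
        have h1 : Real.exp (-1) ≤ Real.exp (-s) := Real.exp_le_exp.2 (by linarith)
        have h2 : 1 / 3 ≤ Real.exp (-1) := by
          rw [Real.exp_neg, one_div]
          apply inv_anti₀ (Real.exp_pos _)
          linarith [Real.exp_one_lt_d9]
        linarith
      have h1 : δ / 6 ≤ δ * Real.exp (-s) * q := by
        have : (1:ℝ) / 6 ≤ Real.exp (-s) * q := by nlinarith
        nlinarith
      have h3 : 0 ≤ -(K' * (n / R)) + δ * Real.exp (-s) * q := by linarith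
      have h4 : 0 ≤ H * (1 - K' ^ 2 * q) := mul_nonneg hH0 (by linarith)
      have : 0 ≤ (1 / Real.sqrt 2) * (-(K' * (n / R)) + δ * Real.exp (-s) * q) := by positivity
      linarith
    · have hHh : hh (1 / 2) ≤ H := hh_mono.monotone (by linarith)
      have h4 : hh (1 / 2) * δ ≤ H * (1 - K' ^ 2 * q) := by
        apply mul_le_mul hHh (by linarith) hδ.le hH0
      have h5 : 0 ≤ δ * Real.exp (-s) * q := by positivity
      have h6 : (1 / Real.sqrt 2) * (n / R) ≤ n / R := by
        have : 1 / Real.sqrt 2 ≤ 1 := by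
          rw [div_le_one (by positivity)]; exact hs2
        nlinarith
      have h7 : (1 / Real.sqrt 2) * (-(n / R)) ≤
          (1 / Real.sqrt 2) * (-(K' * (n / R)) + δ * Real.exp (-s) * q) := by
        apply mul_le_mul_of_nonneg_left _ (by positivity)
        linarith
      linarith
  have := mul_nonneg hHsq.le main
  have e : (1 - H ^ 2) / Real.sqrt 2 * (K' * (-(1 / (2 * R)) * (2 * ↑n) +
      0 * ∑ i, (2 * (x i - c i)) ^ 2) +
      δ * Real.exp (-s) * ((-(1 / (2 * R))) ^ 2 * 4 * (R ^ 2 * q))) +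
      -(H * (1 - H ^ 2)) * (K' ^ 2 * (-(1 / (2 * R))) ^ 2 * 4 * (R ^ 2 * q)) - (H ^ 3 - H)
      = (1 - H ^ 2) * ((1 / Real.sqrt 2) * (-(K' * (n / R)) + δ * Real.exp (-s) * q)
      + H * (1 - K' ^ 2 * q)) := by
    field_simp
    ring
  linarith

lemma lower_bound {n : ℕ} (hn : 0 < n) {u : EuclideanSpace ℝ (Fin n) → ℝ} (hu : ContDiff ℝ 2 u)
    (heq : ∀ x, lap u x = u x ^ 3 - u x)
    (hpos : ∀ x : EuclideanSpace ℝ (Fin n), x (⟨0, hn⟩ : Fin n) < 0 → 0 < u x)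
    (x : EuclideanSpace ℝ (Fin n)) (hx : x (⟨0, hn⟩ : Fin n) < 0) :
    hh (-(x (⟨0, hn⟩ : Fin n))) ≤ u x := by
  set j : Fin n := ⟨0, hn⟩ with hj
  -- fixed δ
  have step : ∀ δ : ℝ, 0 < δ → δ < 1 / 4 → δ < -(x j) →
      hh ((1 - δ) * (-(x j) - δ) - δ * (1 - Real.exp (-(-(x j) - δ)))) ≤ u x := by
    intro δ hδ hδ4 hδx
    have hinv : Tendsto (fun R : ℝ => R⁻¹) atTop (𝓝 0) := tendsto_inv_atTop_zero
    -- value of ρ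
    have hval : ∀ R : ℝ, R ≠ 0 → (R ^ 2 - ‖x - (-(R + δ)) • ev j‖ ^ 2) / (2 * R)
        = (-(x j) - δ) - (‖x‖ ^ 2 / 2 + δ * x j + δ ^ 2 / 2) * R⁻¹ := by
      intro R hR
      have : ‖x - (-(R + δ)) • ev j‖ ^ 2 = ‖x‖ ^ 2 + 2 * (R + δ) * x j + (R + δ) ^ 2 := by
        rw [norm_sub_sq_real, inner_smul_right, inner_ev, norm_smul]
        have : ‖(ev j : EuclideanSpace ℝ (Fin n))‖ = 1 := by simp [ev]
        rw [this, mul_one, Real.norm_eq_abs, sq_abs]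
        ring
      rw [this]
      field_simp
      ring
    have hlim : Tendsto (fun R : ℝ => (R ^ 2 - ‖x - (-(R + δ)) • ev j‖ ^ 2) / (2 * R)) atTop
        (𝓝 (-(x j) - δ)) := by
      have h1 : Tendsto (fun R : ℝ => (-(x j) - δ) - (‖x‖ ^ 2 / 2 + δ * x j + δ ^ 2 / 2) * R⁻¹)
          atTop (𝓝 ((-(x j) - δ) - (‖x‖ ^ 2 / 2 + δ * x j + δ ^ 2 / 2) * 0)) :=
        tendsto_const_nhds.sub (hinv.const_mul _)
      rw [mul_zero, sub_zero] at h1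
      refine h1.congr' ?_
      filter_upwards [eventually_ne_atTop 0] with R hR using (hval R hR).symm
    have hcont : Continuous fun s : ℝ => hh ((1 - δ) * s - δ * (1 - Real.exp (-s))) := by
      refine hh_cont.comp ?_
      fun_prop
    have hlim2 := (hcont.tendsto (-(x j) - δ)).comp hlim
    refine le_of_tendsto hlim2 ?_
    have hnR : Tendsto (fun R : ℝ => (n:ℝ) / R) atTop (𝓝 0) := by
      simpa [div_eq_mul_inv] using hinv.const_mul (n:ℝ)
    have hh12 : 0 < hh (1 / 2) := by rw [← hh_zero]; exact hh_mono (by norm_num)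
    filter_upwards [eventually_ge_atTop 4, hlim.eventually (lt_mem_nhds (sub_pos.2 hδx)),
      hnR.eventually (gt_mem_nhds (show (0:ℝ) < δ / 6 by positivity)),
      hnR.eventually (gt_mem_nhds (show (0:ℝ) < hh (1 / 2) * δ by positivity))]
      with R hR4 hpos' h1 h2
    have hR0 : 0 < R := by linarith
    refine lower_aux hu heq ((-(R + δ)) • ev j) R δ ?_ hδ hδ4 hR4 h1.le h2.le x ?_
    · intro y hy
      apply hpos
      rw [mem_closedBall, dist_eq_norm] at hy
      have h3 : |(y - (-(R + δ)) • ev j : EuclideanSpace ℝ (Fin n)) j| ≤ R := by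
        refine le_trans ?_ hy
        have := PiLp.norm_apply_le (y - (-(R + δ)) • ev j : EuclideanSpace ℝ (Fin n)) j
        simpa using this
      have h4 := (abs_le.1 h3).2
      simp [ev_apply] at h4
      show y j < 0
      linarith
    · rw [mem_closedBall, dist_eq_norm]
      have : 0 < R ^ 2 - ‖x - (-(R + δ)) • ev j‖ ^ 2 := by
        by_contra! h
        have := div_nonpos_of_nonpos_of_nonneg h (show 0 ≤ 2 * R by positivity)
        linarith
      exact (le_abs_self _).trans (abs_le_of_sq_le_sq (by linarith) hR0.le)
  have hcont : Continuous fun δ : ℝ =>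
      hh ((1 - δ) * (-(x j) - δ) - δ * (1 - Real.exp (-(-(x j) - δ)))) := by
    refine hh_cont.comp ?_
    fun_prop
  have hlim := (hcont.tendsto 0).mono_left (nhdsWithin_le_nhds (s := Ioi 0))
  simp only [sub_zero, one_mul, zero_mul] at hlim
  refine le_of_tendsto hlim ?_
  filter_upwards [self_mem_nhdsWithin,
    nhdsWithin_le_nhds (gt_mem_nhds (show (0:ℝ) < 1 / 4 by norm_num)),
    nhdsWithin_le_nhds (gt_mem_nhds (show (0:ℝ) < -(x j) by linarith))] with δ h1 h2 h3
  exact step δ h1 h2 h3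

/-- Inverse of the profile `s ↦ c * hh (c * s)`. -/
def Ac (c t : ℝ) : ℝ := Real.sqrt 2 / c * Real.artanh (t / c)

lemma hasDerivAt_artanh' {x : ℝ} (h1 : -1 < x) (h2 : x < 1) :
    HasDerivAt Real.artanh (1 / (1 - x ^ 2)) x := by
  have e : Real.artanh =ᶠ[𝓝 x] fun y => 1 / 2 * (Real.log (1 + y) - Real.log (1 - y)) := by
    filter_upwards [lt_mem_nhds h1, gt_mem_nhds h2] with y hy1 hy2
    rw [Real.artanh_eq_half_log ⟨hy1.le, hy2.le⟩, Real.log_div (by linarith) (by linarith)]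
  refine HasDerivAt.congr_of_eventuallyEq ?_ e
  have a1 := ((hasDerivAt_id x).const_add 1).log (by simp; linarith)
  have a2 := ((hasDerivAt_id x).const_sub 1).log (by simp; linarith)
  refine ((a1.sub a2).const_mul (1 / 2)).congr_deriv ?_
  have : 1 + x ≠ 0 := by linarith
  have : 1 - x ≠ 0 := by linarith
  have : 1 - x ^ 2 ≠ 0 := by
    have : 1 - x ^ 2 = (1 - x) * (1 + x) := by ring
    rw [this]; positivity
  simp only [id]
  field_simp
  ring

lemma Ac_deriv {c t : ℝ} (hc : 1 < c) (h1 : -c < t) (h2 : t < c) :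
    HasDerivAt (Ac c) (Real.sqrt 2 / (c ^ 2 - t ^ 2)) t := by
  have hc0 : 0 < c := by linarith
  have a := hasDerivAt_artanh' (x := t / c) (by rw [lt_div_iff₀ hc0]; linarith)
    (by rw [div_lt_one hc0]; exact h2)
  have := (a.comp t ((hasDerivAt_id t).div_const c)).const_mul (Real.sqrt 2 / c)
  refine this.congr_deriv ?_
  have h3 : c ^ 2 - t ^ 2 ≠ 0 := by nlinarith
  have h4 : 1 - (t / c) ^ 2 = (c ^ 2 - t ^ 2) / c ^ 2 := by field_simp
  rw [h4]
  field_simp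

lemma Ac_deriv2 {c t : ℝ} (h : 0 < c ^ 2 - t ^ 2) :
    HasDerivAt (fun t => Real.sqrt 2 / (c ^ 2 - t ^ 2))
      (2 * Real.sqrt 2 * t / (c ^ 2 - t ^ 2) ^ 2) t := by
  have := (hasDerivAt_const t (Real.sqrt 2)).div ((hasDerivAt_pow 2 t).const_sub (c ^ 2)) h.ne'
  refine this.congr_deriv ?_
  simp; ring

lemma Ac_diff {c a b : ℝ} (hc : 1 < c) (ha : |a| ≤ 1) (hb : |b| ≤ 1) {η : ℝ} (hη : 0 < η)
    (h : η ≤ Ac c b - Ac c a) : η * (c ^ 2 - 1) / Real.sqrt 2 ≤ b - a := by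
  obtain ⟨ha1, ha2⟩ := abs_le.1 ha
  obtain ⟨hb1, hb2⟩ := abs_le.1 hb
  have hd : ∀ t ∈ Icc (-1:ℝ) 1, HasDerivAt (Ac c) (Real.sqrt 2 / (c ^ 2 - t ^ 2)) t :=
    fun t ht => Ac_deriv hc (by linarith [ht.1]) (by linarith [ht.2])
  have hpos : ∀ t ∈ Icc (-1:ℝ) 1, c ^ 2 - 1 ≤ c ^ 2 - t ^ 2 := fun t ht => by
    nlinarith [ht.1, ht.2]
  have hc2 : 0 < c ^ 2 - 1 := by nlinarith
  have hab : a < b := by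
    by_contra! hba
    have hmono : MonotoneOn (Ac c) (Icc (-1) 1) := by
      refine monotoneOn_of_deriv_nonneg (convex_Icc _ _)
        (fun t ht => (hd t ht).continuousAt.continuousWithinAt)
        (fun t ht => ((hd t (interior_subset ht)).differentiableAt.differentiableWithinAt)) ?_
      intro t ht
      have ht' := interior_subset ht
      rw [(hd t ht').deriv]
      have := hpos t ht'
      have : 0 < c ^ 2 - t ^ 2 := by linarith
      positivity
    have := hmono ⟨hb1, hb2⟩ ⟨ha1, ha2⟩ hba
    linarith
  obtain ⟨ξ, hξ, he⟩ := exists_hasDerivAt_eq_slope (Ac c) (fun t => Real.sqrt 2 / (c ^ 2 - t ^ 2))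
    hab (fun t ht => (hd t ⟨by linarith [ht.1], by linarith [ht.2]⟩).continuousAt.continuousWithinAt)
    (fun t ht => hd t ⟨by linarith [ht.1], by linarith [ht.2]⟩)
  have hξ' := hpos ξ ⟨by linarith [hξ.1], by linarith [hξ.2]⟩
  rw [eq_div_iff (by linarith)] at he
  have h1 : Real.sqrt 2 / (c ^ 2 - ξ ^ 2) ≤ Real.sqrt 2 / (c ^ 2 - 1) := by gcongr
  have h2 : η ≤ Real.sqrt 2 / (c ^ 2 - 1) * (b - a) := by
    have : Real.sqrt 2 / (c ^ 2 - ξ ^ 2) * (b - a) ≤ Real.sqrt 2 / (c ^ 2 - 1) * (b - a) := by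
      apply mul_le_mul_of_nonneg_right h1; linarith
    linarith
  rw [div_le_iff₀ (by positivity)]
  have h3 := mul_le_mul_of_nonneg_right h2 hc2.le
  refine h3.trans (le_of_eq ?_)
  field_simp

lemma theta_diff {c a b : ℝ} (hc : 1 < c) (ha : |a| ≤ 1) (hb : |b| ≤ 1) (hab : a ≤ b) :
    (c ^ 2 - 1) ^ 2 / c ^ 4 * (b - a) ≤
      b * (1 - (1 - b ^ 2) / (c ^ 2 - b ^ 2)) - a * (1 - (1 - a ^ 2) / (c ^ 2 - a ^ 2)) := by
  obtain ⟨ha1, ha2⟩ := abs_le.1 ha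
  obtain ⟨hb1, hb2⟩ := abs_le.1 hb
  have hA : 0 < c ^ 2 - a ^ 2 := by nlinarith
  have hB : 0 < c ^ 2 - b ^ 2 := by nlinarith
  have hc2 : 0 < c ^ 2 - 1 := by nlinarith
  have e : b * (1 - (1 - b ^ 2) / (c ^ 2 - b ^ 2)) - a * (1 - (1 - a ^ 2) / (c ^ 2 - a ^ 2))
      = (c ^ 2 - 1) * (c ^ 2 + a * b) / ((c ^ 2 - a ^ 2) * (c ^ 2 - b ^ 2)) * (b - a) := by
    field_simp
    ring
  rw [e]
  apply mul_le_mul_of_nonneg_right _ (by linarith)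
  have hab1 : -1 ≤ a * b := by
    have : |a * b| ≤ 1 := by rw [abs_mul]; nlinarith [abs_nonneg a, abs_nonneg b]
    exact (abs_le.1 this).1
  apply div_le_div₀ _ _ (by positivity) _
  · apply mul_nonneg hc2.le; linarith
  · rw [sq]; apply mul_le_mul_of_nonneg_left _ hc2.le; linarith
  · have : (c ^ 2 - a ^ 2) * (c ^ 2 - b ^ 2) ≤ c ^ 2 * c ^ 2 := by
      apply mul_le_mul _ _ hB.le (by positivity) <;> nlinarith [sq_nonneg a, sq_nonneg b]
    nlinarith

lemma J2_v {n : ℕ} {u : EuclideanSpace ℝ (Fin n) → ℝ} (hu : ContDiff ℝ 2 u)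
    (heq : ∀ x, lap u x = u x ^ 3 - u x) (hb : ∀ x, |u x| ≤ 1) {c : ℝ} (hc : 1 < c)
    (x : EuclideanSpace ℝ (Fin n)) : ∃ p : Fin n → ℝ, J2 (fun y => Ac c (u y)) x p
      (Real.sqrt 2 * u x * (∑ i, p i ^ 2 - (1 - u x ^ 2) / (c ^ 2 - u x ^ 2))) := by
  obtain ⟨h1, h2⟩ := abs_le.1 (hb x)
  have hA : 0 < c ^ 2 - u x ^ 2 := by nlinarith
  have J := (J2.of_contDiff hu x).comp (F := Ac c) (F' := fun t => Real.sqrt 2 / (c ^ 2 - t ^ 2))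
    (by
      filter_upwards [lt_mem_nhds (show -c < u x by linarith),
        gt_mem_nhds (show u x < c by linarith)] with t ht1 ht2 using Ac_deriv hc ht1 ht2)
    (Ac_deriv2 hA)
  refine ⟨_, J.congr (fun i => rfl) ?_⟩
  rw [heq]
  simp only [mul_pow]
  rw [← Finset.mul_sum]
  have hs2 : Real.sqrt 2 ^ 2 = 2 := Real.sq_sqrt (by norm_num)
  rw [div_pow, hs2]
  field_simp
  ring

lemma J2_norm {n : ℕ} (c x : EuclideanSpace ℝ (Fin n)) (h : x ≠ c) :
    ∃ L, J2 (fun y => ‖y - c‖) x (fun i => (x i - c i) / ‖x - c‖) L := by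
  have hpos : 0 < ‖x - c‖ := norm_pos_iff.2 (sub_ne_zero.2 h)
  have hsq : 0 < ‖x - c‖ ^ 2 := by positivity
  have J := (J2.sq c x).comp (F := Real.sqrt) (F' := fun t => 1 / (2 * Real.sqrt t))
    (F'' := deriv (fun t => 1 / (2 * Real.sqrt t)) (‖x - c‖ ^ 2))
    (by
      filter_upwards [lt_mem_nhds hsq] with t ht using Real.hasDerivAt_sqrt ht.ne')
    (by
      have h1 := (Real.hasDerivAt_sqrt hsq.ne').const_mul 2
      exact ((hasDerivAt_const _ (1:ℝ)).div h1
        (by have := Real.sqrt_pos.2 hsq; positivity)).differentiableAt.hasDerivAt)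
  simp only [Real.sqrt_sq (norm_nonneg _)] at J
  exact ⟨_, J.congr (fun i => by field_simp) rfl⟩

lemma exists_max_two {n : ℕ} {v : EuclideanSpace ℝ (Fin n) → ℝ} (hv : Continuous v) {V : ℝ}
    (hV : ∀ x, |v x| ≤ V) {μ : ℝ} (hμ : 0 < μ) (x0 y0 : EuclideanSpace ℝ (Fin n))
    (h0 : 0 < v y0 - v x0 - ‖y0 - x0‖ - μ * ‖x0‖ ^ 2) :
    ∃ x y, ∀ x' y', v y' - v x' - ‖y' - x'‖ - μ * ‖x'‖ ^ 2 ≤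
      v y - v x - ‖y - x‖ - μ * ‖x‖ ^ 2 := by
  have hV0 : 0 ≤ V := (abs_nonneg _).trans (hV x0)
  set a := 2 * V + 2 * V / μ + 1 with ha
  have hq : 0 ≤ 2 * V / μ := by positivity
  set F : EuclideanSpace ℝ (Fin n) × EuclideanSpace ℝ (Fin n) → ℝ :=
    fun z => v z.2 - v z.1 - ‖z.2 - z.1‖ - μ * ‖z.1‖ ^ 2 with hF
  have hFc : Continuous F := by fun_prop
  have hout : ∀ x y, 2 * a < ‖x‖ ∨ 2 * a < ‖y‖ → F (x, y) ≤ 0 := by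
    intro x y h
    have hx := abs_le.1 (hV x)
    have hy := abs_le.1 (hV y)
    simp only [hF]
    by_cases hxa : a ≤ ‖x‖
    · have h1 : 2 * V ≤ μ * a := by
        rw [ha]
        have : μ * (2 * V / μ) = 2 * V := by field_simp
        nlinarith
      have h2 : a ≤ ‖x‖ ^ 2 := by nlinarith
      have h3 : μ * a ≤ μ * ‖x‖ ^ 2 := by gcongr
      linarith [norm_nonneg (y - x)]
    · push Not at hxa
      have hy2 : 2 * a < ‖y‖ := by
        rcases h with h | h
        · linarith
        · exact h
      have h1 : ‖y‖ - ‖x‖ ≤ ‖y - x‖ := norm_sub_norm_le y x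
      have h2 : 0 ≤ μ * ‖x‖ ^ 2 := by positivity
      linarith
  obtain ⟨z, hzB, hz⟩ := (isCompact_closedBall
    (0 : EuclideanSpace ℝ (Fin n) × EuclideanSpace ℝ (Fin n)) (2 * a)).exists_isMaxOn
      ⟨0, by simp; positivity⟩ hFc.continuousOn
  have hin : ∀ x y, F (x, y) ≤ F z ∨ F (x, y) ≤ 0 := by
    intro x y
    by_cases h : 2 * a < ‖x‖ ∨ 2 * a < ‖y‖
    · right; exact hout x y h
    · left
      push Not at h
      apply hz
      rw [mem_closedBall_zero_iff, Prod.norm_def]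
      exact max_le h.1 h.2
  have hz0 : 0 < F z := by
    rcases hin x0 y0 with h | h
    · exact lt_of_lt_of_le h0 h
    · exact absurd h0 (not_lt.2 h)
  refine ⟨z.1, z.2, fun x' y' => ?_⟩
  rcases hin x' y' with h | h
  · exact h
  · exact h.trans hz0.le

set_option maxHeartbeats 1000000 in
lemma lip {n : ℕ} {u : EuclideanSpace ℝ (Fin n) → ℝ} (hu : ContDiff ℝ 2 u)
    (heq : ∀ x, lap u x = u x ^ 3 - u x) (hb : ∀ x, |u x| ≤ 1) {c : ℝ} (hc : 1 < c)
    (x0 y0 : EuclideanSpace ℝ (Fin n)) : Ac c (u y0) - Ac c (u x0) ≤ ‖y0 - x0‖ := by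
  by_contra! hlt
  set v : EuclideanSpace ℝ (Fin n) → ℝ := fun y => Ac c (u y) with hv
  have hAc : ContinuousOn (Ac c) (Icc (-1) 1) := fun t ht =>
    (Ac_deriv hc (by linarith [ht.1]) (by linarith [ht.2])).continuousAt.continuousWithinAt
  have hmem : ∀ x, u x ∈ Icc (-1:ℝ) 1 := fun x => abs_le.1 (hb x)
  have hvc : Continuous v := hAc.comp_continuous hu.continuous hmem
  obtain ⟨V, hV⟩ := isCompact_Icc.exists_bound_of_continuousOn hAc
  have hVv : ∀ x, |v x| ≤ V := fun x => hV _ (hmem x)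
  have hV0 : 0 ≤ V := (abs_nonneg _).trans (hVv x0)
  set η := (v y0 - v x0 - ‖y0 - x0‖) / 2 with hη
  have hη0 : 0 < η := by
    rw [hη]; simp only [hv]; linarith
  set M := Real.sqrt (2 * V) with hM
  have hM0 : 0 ≤ M := Real.sqrt_nonneg _
  have hM2 : M ^ 2 = 2 * V := Real.sq_sqrt (by linarith)
  set κ := (c ^ 2 - 1) ^ 2 / c ^ 4 * (η * (c ^ 2 - 1) / Real.sqrt 2) with hκ
  have hκ0 : 0 < κ := by
    have hc2 : 0 < c ^ 2 - 1 := by nlinarith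
    positivity
  have main : ∀ ν : ℝ, 0 < ν → ν ^ 2 * ‖x0‖ ^ 2 < η →
      Real.sqrt 2 * κ ≤ 2 * n * ν ^ 2 + Real.sqrt 2 * (4 * ν * M + 4 * ν ^ 2 * M ^ 2) := by
    intro ν hν hν0
    obtain ⟨x, y, hxy⟩ := exists_max_two hvc hVv (μ := ν ^ 2) (by positivity) x0 y0
      (by rw [hη] at hν0 hη0; linarith)
    have hF0 := hxy x0 y0
    have hge : η ≤ v y - v x - ‖y - x‖ - ν ^ 2 * ‖x‖ ^ 2 := by
      rw [hη] at hν0 ⊢; linarith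
    have hνx2 : 0 ≤ ν ^ 2 * ‖x‖ ^ 2 := by positivity
    have hne : y ≠ x := by
      rintro rfl
      simp at hge
      linarith
    have hpos : 0 < ‖y - x‖ := norm_pos_iff.2 (sub_ne_zero.2 hne)
    have hdiff : η ≤ v y - v x := by linarith
    have hVx := abs_le.1 (hVv x)
    have hVy := abs_le.1 (hVv y)
    have hνx : ν * ‖x‖ ≤ M := by
      refine (le_abs_self _).trans (abs_le_of_sq_le_sq ?_ hM0)
      rw [hM2, mul_pow]; linarith
    obtain ⟨p, hp⟩ := J2_v hu heq hb hc x
    obtain ⟨q, hq⟩ := J2_v hu heq hb hc y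
    -- gradient in y
    have hqi : ∀ i, q i = (y i - x i) / ‖y - x‖ := by
      obtain ⟨L, hL⟩ := J2_norm x y hne
      intro i
      have := (hq.sub hL).grad_max (Eventually.of_forall fun y' => by
        have := hxy x y'
        simp only [hv] at this ⊢
        linarith) i
      linarith
    have hpi : ∀ i, p i = (y i - x i) / ‖y - x‖ - 2 * ν ^ 2 * x i := by
      obtain ⟨L, hL⟩ := J2_norm y x hne.symm
      intro i
      have h1 := ((hp.const_mul (-1)).sub hL).sub ((J2.sq 0 x).const_mul (ν ^ 2))
      have := h1.grad_max (Eventually.of_forall fun x' => by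
        have := hxy x' y
        simp only [hv, sub_zero] at this ⊢
        rw [norm_sub_rev x' y, norm_sub_rev x y]
        linarith) i
      rw [norm_sub_rev x y] at this
      simp only [PiLp.zero_apply, sub_zero] at this
      have e : (y i - x i) / ‖y - x‖ = -((x i - y i) / ‖y - x‖) := by ring
      rw [e]
      linarith
    have hqs : ∑ i, q i ^ 2 = 1 := by
      simp only [hqi, div_pow]
      rw [← Finset.sum_div, sum_sq_sub, div_self (by positivity)]
    have hps : |∑ i, p i ^ 2 - 1| ≤ 4 * ν * M + 4 * ν ^ 2 * M ^ 2 := by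
      have e1 : ∑ i, p i ^ 2 = ‖(‖y - x‖⁻¹) • (y - x) - (2 * ν ^ 2) • x‖ ^ 2 := by
        rw [EuclideanSpace.real_norm_sq_eq]
        refine Finset.sum_congr rfl fun i _ => ?_
        rw [hpi]; simp; ring
      set e := (‖y - x‖⁻¹) • (y - x) with he
      have hen : ‖e‖ = 1 := by
        rw [he, norm_smul, norm_inv, norm_norm, inv_mul_cancel₀ hpos.ne']
      rw [e1, norm_sub_sq_real, hen, inner_smul_right, norm_smul, Real.norm_eq_abs,
        abs_of_nonneg (show (0:ℝ) ≤ 2 * ν ^ 2 by positivity)]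
      have hin : |inner ℝ e x| ≤ ‖x‖ := by
        have := abs_real_inner_le_norm e x
        rwa [hen, one_mul] at this
      obtain ⟨i1, i2⟩ := abs_le.1 hin
      have hνM : ν ^ 2 * ‖x‖ ≤ ν * M := by
        have := mul_le_mul_of_nonneg_left hνx hν.le
        linarith
      have b1 : ν ^ 2 * inner ℝ e x ≤ ν ^ 2 * ‖x‖ := by gcongr
      have b2 : -(ν ^ 2 * ‖x‖) ≤ ν ^ 2 * inner ℝ e x := by
        have := mul_le_mul_of_nonneg_left i1 (sq_nonneg ν)
        linarith
      have b3 : (2 * ν ^ 2 * ‖x‖) ^ 2 ≤ 4 * ν ^ 2 * M ^ 2 := by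
        have : (ν ^ 2 * ‖x‖) ^ 2 ≤ (ν * M) ^ 2 := by gcongr
        nlinarith
      have b4 : 0 ≤ (2 * ν ^ 2 * ‖x‖) ^ 2 := by positivity
      have b5 : 0 ≤ 4 * ν ^ 2 * M ^ 2 := by positivity
      rw [abs_le]
      constructor <;> nlinarith
    -- translation
    have hJ := (hq.translate.sub hp.translate).sub (((J2.sq 0 x).const_mul (ν ^ 2)).translate)
    have hL := hJ.lap_max (Eventually.of_forall fun w => by
        have := hxy (w + x) (w + y)
        simp only [hv, sub_zero, zero_add, add_sub_add_left_eq_sub] at this ⊢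
        linarith)
    rw [hqs] at hL
    have hab := Ac_diff hc (hb x) (hb y) hη0 hdiff
    have hc2 : 0 < c ^ 2 - 1 := by nlinarith
    have hab0 : u x ≤ u y := by
      have : 0 ≤ η * (c ^ 2 - 1) / Real.sqrt 2 := by positivity
      linarith
    have hθ := theta_diff hc (hb x) (hb y) hab0
    have hκθ : κ ≤ (c ^ 2 - 1) ^ 2 / c ^ 4 * (u y - u x) := by
      rw [hκ]; gcongr
    set m := (1 - u x ^ 2) / (c ^ 2 - u x ^ 2) with hm
    have hxt : u x * (∑ i, p i ^ 2 - m) ≤ u x * (1 - m) + (4 * ν * M + 4 * ν ^ 2 * M ^ 2) := by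
      have e : u x * (∑ i, p i ^ 2 - m) = u x * (1 - m) + u x * (∑ i, p i ^ 2 - 1) := by ring
      have : u x * (∑ i, p i ^ 2 - 1) ≤ |∑ i, p i ^ 2 - 1| := by
        refine (le_abs_self _).trans ?_
        rw [abs_mul]
        exact mul_le_of_le_one_left (abs_nonneg _) (hb x)
      linarith
    have hfin : κ ≤ u y * (1 - (1 - u y ^ 2) / (c ^ 2 - u y ^ 2)) - u x * (∑ i, p i ^ 2 - m)
        + (4 * ν * M + 4 * ν ^ 2 * M ^ 2) := by linarith
    have h9 := mul_le_mul_of_nonneg_left hfin (Real.sqrt_nonneg 2)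
    linarith
  have hlim : Tendsto (fun ν : ℝ => 2 * n * ν ^ 2 + Real.sqrt 2 * (4 * ν * M + 4 * ν ^ 2 * M ^ 2))
      (𝓝[>] 0) (𝓝 0) := by
    have : Continuous fun ν : ℝ =>
      2 * n * ν ^ 2 + Real.sqrt 2 * (4 * ν * M + 4 * ν ^ 2 * M ^ 2) := by fun_prop
    have := (this.tendsto 0).mono_left (nhdsWithin_le_nhds (s := Ioi 0))
    simpa using this
  have hev : ∀ᶠ ν : ℝ in 𝓝[>] 0, ν ^ 2 * ‖x0‖ ^ 2 < η := by
    have : Continuous fun ν : ℝ => ν ^ 2 * ‖x0‖ ^ 2 := by fun_prop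
    have h := (this.tendsto 0).mono_left (nhdsWithin_le_nhds (s := Ioi 0))
    simp only [ne_eq, OfNat.ofNat_ne_zero, not_false_eq_true, zero_pow, zero_mul] at h
    exact h.eventually (gt_mem_nhds hη0)
  have : Real.sqrt 2 * κ ≤ 0 := by
    refine ge_of_tendsto hlim ?_
    filter_upwards [hev, self_mem_nhdsWithin] with ν h1 h2 using main ν h2 h1
  have : 0 < Real.sqrt 2 * κ := by positivity
  linarith

lemma Ac_zero (c : ℝ) : Ac c 0 = 0 := by simp [Ac]

lemma Ac_inv {c t : ℝ} (hc : 1 < c) (ht : |t| ≤ 1) : c * hh (c * Ac c t) = t := by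
  obtain ⟨h1, h2⟩ := abs_le.1 ht
  have hc0 : 0 < c := by linarith
  have e : c * Ac c t / Real.sqrt 2 = Real.artanh (t / c) := by
    rw [Ac]; field_simp
  rw [hh, e, Real.tanh_artanh ⟨by rw [lt_div_iff₀ hc0]; linarith, by rw [div_lt_one hc0]; linarith⟩]
  field_simp

lemma Ac_one (t : ℝ) : Ac 1 (hh t) = t := by
  rw [Ac, hh, div_one, div_one, Real.artanh_tanh]
  field_simp

lemma Ac_cont {a : ℝ} (h1 : -1 < a) (h2 : a < 1) : ContinuousAt (fun c => Ac c a) 1 := by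
  unfold Ac
  refine (continuousAt_const.div continuousAt_id one_ne_zero).mul ?_
  have h3 : ContinuousAt (fun c : ℝ => a / c) 1 :=
    continuousAt_const.div continuousAt_id one_ne_zero
  refine ContinuousAt.comp (g := Real.artanh) ?_ h3
  rw [div_one]
  exact (hasDerivAt_artanh' h1 h2).continuousAt

lemma hh_contDiff : ContDiff ℝ 2 hh := by
  have e : hh = fun t => Real.sinh (t / Real.sqrt 2) / Real.cosh (t / Real.sqrt 2) := by
    funext t; rw [hh, Real.tanh_eq_sinh_div_cosh]
  rw [e]
  have h : ContDiff ℝ 2 fun t : ℝ => t / Real.sqrt 2 := contDiff_id.div_const _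
  exact h.sinh.div h.cosh fun t => (Real.cosh_pos _).ne'

theorem stmt17 (n : ℕ) (hn : 0 < n)
    (u : EuclideanSpace ℝ (Fin n) → ℝ) (hu : ContDiff ℝ 2 u)
    (heq : ∀ x, lap u x + u x * (1 - (u x)^2) = 0)
    (h0 : u 0 = 0)
    (hpos : ∀ x : EuclideanSpace ℝ (Fin n), x (⟨0, hn⟩ : Fin n) < 0 → 0 < u x) :
    ∀ x : EuclideanSpace ℝ (Fin n),
      u x = Real.tanh (-(x (⟨0, hn⟩ : Fin n)) / Real.sqrt 2) := by
  have heq' : ∀ x, lap u x = u x ^ 3 - u x := fun x => by linarith [heq x]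
  have hb : ∀ x, |u x| ≤ 1 := by
    intro x
    have hneg : ContDiff ℝ 2 fun y => -1 * u y := contDiff_const.mul hu
    have h2 := KO hneg (fun z => by
      rw [((J2.of_contDiff hu z).const_mul (-1)).2.2.2, heq' z]; ring) x
    exact abs_le.2 ⟨by linarith, KO hu heq' x⟩
  set j : Fin n := ⟨0, hn⟩ with hj
  have hev : ‖(ev j : EuclideanSpace ℝ (Fin n))‖ = 1 := by simp [ev]
  have hlow := lower_bound hn hu heq' hpos
  -- exact values on the negative half line
  have hray : ∀ t : ℝ, 0 < t → u ((-t) • ev j) = hh t := by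
    intro t ht
    apply le_antisymm
    · have hcont : Continuous fun c : ℝ => c * hh (c * t) := by
        have := hh_cont
        fun_prop
      have hlim := (hcont.tendsto 1).mono_left (nhdsWithin_le_nhds (s := Ioi 1))
      simp only [one_mul] at hlim
      refine ge_of_tendsto hlim ?_
      filter_upwards [self_mem_nhdsWithin] with c hc
      have hc' : 1 < c := hc
      have h1 := lip hu heq' hb hc' 0 ((-t) • ev j)
      rw [h0, Ac_zero, sub_zero, sub_zero, norm_smul, hev, mul_one, norm_neg, Real.norm_eq_abs,
        abs_of_pos ht] at h1
      rw [← Ac_inv hc' (hb ((-t) • ev j))]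
      have hc0 : 0 ≤ c := by linarith
      exact mul_le_mul_of_nonneg_left (hh_mono.monotone (mul_le_mul_of_nonneg_left h1 hc0)) hc0
    · have hval : ((-t) • ev j : EuclideanSpace ℝ (Fin n)) j = -t := by simp [ev_apply]
      have := hlow ((-t) • ev j) (by rw [← hj, hval]; linarith)
      rwa [← hj, hval, neg_neg] at this
  -- global lower bound
  have hglob : ∀ x : EuclideanSpace ℝ (Fin n), hh (-(x j)) ≤ u x := by
    intro x
    have step : ∀ t : ℝ, 0 < t → hh (-(x j) - ‖x‖ ^ 2 / 2 * t⁻¹) ≤ u x := by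
      intro t ht
      have h1 : hh (t - ‖(-t) • ev j - x‖) ≤ u x := by
        have hA := Ac_cont (a := hh t) (Real.neg_one_lt_tanh _) (Real.tanh_lt_one _)
        have hcont : ContinuousAt (fun c : ℝ => c * hh (c * (Ac c (hh t) - ‖(-t) • ev j - x‖))) 1 := by
          refine continuousAt_id.mul ?_
          refine hh_cont.continuousAt.comp ?_
          exact continuousAt_id.mul (hA.sub continuousAt_const)
        have hlim := hcont.tendsto.mono_left (nhdsWithin_le_nhds (s := Ioi 1))
        simp only [one_mul, Ac_one] at hlim
        refine le_of_tendsto hlim ?_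
        filter_upwards [self_mem_nhdsWithin] with c hc
        have hc' : 1 < c := hc
        have hc0 : 0 ≤ c := by linarith
        have h1 := lip hu heq' hb hc' x ((-t) • ev j)
        rw [hray t ht] at h1
        rw [← Ac_inv hc' (hb x)]
        refine mul_le_mul_of_nonneg_left (hh_mono.monotone (mul_le_mul_of_nonneg_left ?_ hc0)) hc0
        linarith
      refine le_trans (hh_mono.monotone ?_) h1
      have e : ‖(-t) • ev j - x‖ ^ 2 = t ^ 2 + 2 * t * x j + ‖x‖ ^ 2 := by
        rw [norm_sub_rev, norm_sub_sq_real, inner_smul_right, inner_ev, norm_smul, hev, mul_one,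
          Real.norm_eq_abs, sq_abs]
        ring
      have h2 : 2 * t * ‖(-t) • ev j - x‖ ≤ t ^ 2 + ‖(-t) • ev j - x‖ ^ 2 := by
        nlinarith [sq_nonneg (t - ‖(-t) • ev j - x‖)]
      have h3 : 2 * t * (t - ‖(-t) • ev j - x‖ - (-(x j) - ‖x‖ ^ 2 / 2 * t⁻¹)) ≥ 0 := by
        have : 2 * t * (‖x‖ ^ 2 / 2 * t⁻¹) = ‖x‖ ^ 2 := by field_simp
        nlinarith
      have h4 := nonneg_of_mul_nonneg_right h3 (by positivity)
      linarith
    have hlim : Tendsto (fun t : ℝ => hh (-(x j) - ‖x‖ ^ 2 / 2 * t⁻¹)) atTop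
        (𝓝 (hh (-(x j) - ‖x‖ ^ 2 / 2 * 0))) :=
      (hh_cont.tendsto _).comp (tendsto_const_nhds.sub (tendsto_inv_atTop_zero.const_mul _))
    rw [mul_zero, sub_zero] at hlim
    refine le_of_tendsto hlim ?_
    filter_upwards [eventually_gt_atTop 0] with t ht using step t ht
  -- strong maximum principle
  intro x
  show u x = hh (-(x j))
  by_contra hne
  have hgJ : ∀ z : EuclideanSpace ℝ (Fin n), ∃ p, J2 (fun y => hh (-1 * y j)) z p
      (hh (-1 * z j) ^ 3 - hh (-1 * z j)) := by
    intro z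
    have := ((J2.coord j z).const_mul (-1)).comp (F := hh) (Eventually.of_forall hh_deriv)
      (hh_deriv2 _)
    refine ⟨_, this.congr (fun i => rfl) ?_⟩
    simp only [mul_pow]
    rw [← Finset.mul_sum, sum_ev_sq]
    ring
  have hgc : ContDiff ℝ 2 fun y : EuclideanSpace ℝ (Fin n) => hh (-1 * y j) := by
    have h1 : ContDiff ℝ 2 hh := hh_contDiff
    refine h1.comp (contDiff_const.mul ?_)
    exact (EuclideanSpace.proj j : EuclideanSpace ℝ (Fin n) →L[ℝ] ℝ).contDiff
  have hpos' := SMP (w := fun y => u y - hh (-1 * y j)) (hu.sub hgc)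
    (fun z => by have := hglob z; rw [neg_one_mul]; linarith)
    (fun z => by
      obtain ⟨p, hp⟩ := hgJ z
      rw [((J2.of_contDiff hu z).sub hp).2.2.2, heq' z]
      have h1 := hglob z
      rw [neg_one_mul]
      set g := hh (-(z j))
      have hg : |g| ≤ 1 := abs_le.2 ⟨(Real.neg_one_lt_tanh _).le, (Real.tanh_lt_one _).le⟩
      have hu1 := hb z
      obtain ⟨a1, a2⟩ := abs_le.1 hg
      obtain ⟨b1, b2⟩ := abs_le.1 hu1
      have e : u z ^ 3 - u z - (g ^ 3 - g) = (u z ^ 2 + u z * g + g ^ 2 - 1) * (u z - g) := by ring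
      rw [e]
      apply mul_le_mul_of_nonneg_right _ (by linarith)
      nlinarith) x 0
    (by
      have := hglob x
      rw [neg_one_mul]
      exact sub_pos.2 (lt_of_le_of_ne this (Ne.symm hne)))
  simp [h0, hh_zero] at hpos'
end
end

section
/- Suppose W ∈ C²(ℝ), W(t) ≥ 0 for all t ∈ ℝ, W(t) > 0 for all t ∈ (μ_−, μ_+), W(μ_−) = W(μ_+) = 0, and W''(μ_−) > 0 and W''(μ_+) > 0, where μ_− < μ_+. If u ∈ C²(ℝ²) satisfies Δu = W'(u) on ℝ², μ_− ≤ u ≤ μ_+ on ℝ², and u(x₁, x₂) → μ_± uniformly in x₂ ∈ ℝ as x₁ → ±∞, then u(x₁, x₂) = U(x₁) for all (x₁, x₂) ∈ ℝ², where U : ℝ → ℝ satisfies U'' = W'(U) on ℝ and U(x₁) → μ_± as x₁ → ±∞ (Gibbons' conjecture in two dimensions). -/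
open Metric Set Filter Pointwise

noncomputable section

/-- one-dimensional second derivative test -/
lemma second_test (g g' : ℝ → ℝ) (g'' x : ℝ) (h1 : ∀ t, HasDerivAt g (g' t) t)
    (h2 : HasDerivAt g' g'' x) (hmin : IsLocalMin g x) : 0 ≤ g'' := by
  by_contra hneg
  push Not at hneg
  have hd : deriv g = g' := funext fun t => (h1 t).deriv
  have h0 : deriv g x = 0 := hmin.deriv_eq_zero
  have hmax : IsLocalMax g x := by
    apply isLocalMax_of_deriv_deriv_neg _ h0 (h1 x).continuousAt
    rw [hd, h2.deriv]; exact hneg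
  have hc : g =ᶠ[nhds x] fun _ => g x := by
    filter_upwards [hmin, hmax] with t a b
    exact le_antisymm b a
  have hc1 : deriv g =ᶠ[nhds x] deriv (fun _ => g x) := hc.deriv
  have : deriv (deriv g) x = 0 := by
    rw [hc1.deriv_eq]; simp
  rw [hd, h2.deriv] at this
  linarith

/-- `v` is continuous, twice differentiable along coordinate lines, with Laplacian `L`. -/
def HL (v L : ℝ → ℝ → ℝ) : Prop :=
  Continuous (fun p : ℝ × ℝ => v p.1 p.2) ∧ ∃ vx vy vxx vyy : ℝ → ℝ → ℝ,
    (∀ x y, HasDerivAt (fun t => v t y) (vx x y) x) ∧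
    (∀ x y, HasDerivAt (fun t => v x t) (vy x y) y) ∧
    (∀ x y, HasDerivAt (fun t => vx t y) (vxx x y) x) ∧
    (∀ x y, HasDerivAt (fun t => vy x t) (vyy x y) y) ∧
    (∀ x y, L x y = vxx x y + vyy x y)

lemma HL.min_test {v L : ℝ → ℝ → ℝ} (h : HL v L) {K : Set (ℝ × ℝ)} {x y : ℝ}
    (hK : K ∈ nhds (x, y)) (hmin : ∀ p ∈ K, v x y ≤ v p.1 p.2) : 0 ≤ L x y := by
  obtain ⟨hc, vx, vy, vxx, vyy, h1, h2, h3, h4, h5⟩ := h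
  rw [h5]
  have a : 0 ≤ vxx x y := by
    refine second_test (fun t => v t y) (fun t => vx t y) _ x (fun t => h1 t y) (h3 x y) ?_
    have : Tendsto (fun t : ℝ => (t, y)) (nhds x) (nhds (x, y)) :=
      (Continuous.prodMk continuous_id continuous_const).tendsto x
    filter_upwards [this hK] with t ht
    exact hmin _ ht
  have b : 0 ≤ vyy x y := by
    refine second_test (fun t => v x t) (fun t => vy x t) _ y (fun t => h2 x t) (h4 x y) ?_
    have : Tendsto (fun t : ℝ => (x, t)) (nhds y) (nhds (x, y)) :=
      (Continuous.prodMk continuous_const continuous_id).tendsto y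
    filter_upwards [this hK] with t ht
    exact hmin _ ht
  linarith

lemma HL.add {v L w M : ℝ → ℝ → ℝ} (h : HL v L) (h' : HL w M) :
    HL (fun x y => v x y + w x y) (fun x y => L x y + M x y) := by
  obtain ⟨hc, vx, vy, vxx, vyy, h1, h2, h3, h4, h5⟩ := h
  obtain ⟨hc', wx, wy, wxx, wyy, g1, g2, g3, g4, g5⟩ := h'
  refine ⟨hc.add hc', fun x y => vx x y + wx x y, fun x y => vy x y + wy x y,
    fun x y => vxx x y + wxx x y, fun x y => vyy x y + wyy x y, ?_, ?_, ?_, ?_, ?_⟩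
  · intro x y; exact (h1 x y).add (g1 x y)
  · intro x y; exact (h2 x y).add (g2 x y)
  · intro x y; exact (h3 x y).add (g3 x y)
  · intro x y; exact (h4 x y).add (g4 x y)
  · intro x y; simp only [h5, g5]; ring

lemma HL.sub {v L w M : ℝ → ℝ → ℝ} (h : HL v L) (h' : HL w M) :
    HL (fun x y => v x y - w x y) (fun x y => L x y - M x y) := by
  obtain ⟨hc, vx, vy, vxx, vyy, h1, h2, h3, h4, h5⟩ := h
  obtain ⟨hc', wx, wy, wxx, wyy, g1, g2, g3, g4, g5⟩ := h'
  refine ⟨hc.sub hc', fun x y => vx x y - wx x y, fun x y => vy x y - wy x y,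
    fun x y => vxx x y - wxx x y, fun x y => vyy x y - wyy x y, ?_, ?_, ?_, ?_, ?_⟩
  · intro x y; exact (h1 x y).sub (g1 x y)
  · intro x y; exact (h2 x y).sub (g2 x y)
  · intro x y; exact (h3 x y).sub (g3 x y)
  · intro x y; exact (h4 x y).sub (g4 x y)
  · intro x y; simp only [h5, g5]; ring

lemma HL.trans {v L : ℝ → ℝ → ℝ} (h : HL v L) (a b : ℝ) :
    HL (fun x y => v (x + a) (y + b)) (fun x y => L (x + a) (y + b)) := by
  obtain ⟨hc, vx, vy, vxx, vyy, h1, h2, h3, h4, h5⟩ := h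
  refine ⟨hc.comp (f := fun p : ℝ × ℝ => (p.1 + a, p.2 + b)) (by fun_prop),
    fun x y => vx (x + a) (y + b), fun x y => vy (x + a) (y + b),
    fun x y => vxx (x + a) (y + b), fun x y => vyy (x + a) (y + b), ?_, ?_, ?_, ?_, ?_⟩
  · intro x y; exact (h1 (x + a) (y + b)).comp_add_const x a
  · intro x y; exact (h2 (x + a) (y + b)).comp_add_const y b
  · intro x y; exact (h3 (x + a) (y + b)).comp_add_const x a
  · intro x y; exact (h4 (x + a) (y + b)).comp_add_const y b
  · intro x y; exact h5 _ _

lemma HL.swap {v L : ℝ → ℝ → ℝ} (h : HL v L) :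
    HL (fun x y => v y x) (fun x y => L y x) := by
  obtain ⟨hc, vx, vy, vxx, vyy, h1, h2, h3, h4, h5⟩ := h
  refine ⟨hc.comp continuous_swap,
    fun x y => vy y x, fun x y => vx y x,
    fun x y => vyy y x, fun x y => vxx y x, ?_, ?_, ?_, ?_, ?_⟩
  · intro x y; exact h2 y x
  · intro x y; exact h1 y x
  · intro x y; exact h4 y x
  · intro x y; exact h3 y x
  · intro x y; simp only [h5]; ring

lemma HL.reflect {v L : ℝ → ℝ → ℝ} (h : HL v L) :
    HL (fun x y => v x (-y)) (fun x y => L x (-y)) := by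
  obtain ⟨hc, vx, vy, vxx, vyy, h1, h2, h3, h4, h5⟩ := h
  refine ⟨hc.comp (f := fun p : ℝ × ℝ => (p.1, -p.2)) (by fun_prop),
    fun x y => vx x (-y), fun x y => - vy x (-y),
    fun x y => vxx x (-y), fun x y => vyy x (-y), ?_, ?_, ?_, ?_, ?_⟩
  · intro x y; exact h1 x (-y)
  · intro x y
    have := (h2 x (-y)).scomp y (hasDerivAt_neg y)
    refine HasDerivAt.congr_deriv this ?_
    simp
  · intro x y; exact h3 x (-y)
  · intro x y
    have := ((h4 x (-y)).scomp y (hasDerivAt_neg y)).neg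
    refine HasDerivAt.congr_deriv this ?_
    simp
  · intro x y; exact h5 _ _

/-- explicit quadratics -/
lemma HL_quad (a b c d : ℝ) :
    HL (fun x y => a * x ^ 2 + b * x + (c * y ^ 2 + d * y)) (fun _ _ => 2 * a + 2 * c) := by
  refine ⟨by fun_prop, fun x y => 2 * a * x + b, fun x y => 2 * c * y + d, fun _ _ => 2 * a,
    fun _ _ => 2 * c, ?_, ?_, ?_, ?_, ?_⟩
  · intro x y
    have := ((((hasDerivAt_id x).pow 2).const_mul a).add ((hasDerivAt_id x).const_mul b)).add_const
      (c * y ^ 2 + d * y)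
    refine HasDerivAt.congr_deriv this ?_
    simp
    try ring
  · intro x y
    have := ((((hasDerivAt_id y).pow 2).const_mul c).add ((hasDerivAt_id y).const_mul d)).const_add
      (a * x ^ 2 + b * x)
    refine HasDerivAt.congr_deriv this ?_
    simp
    try ring
  · intro x y
    have := ((hasDerivAt_id x).const_mul (2 * a)).add_const b
    refine HasDerivAt.congr_deriv this ?_
    simp
  · intro x y
    have := ((hasDerivAt_id y).const_mul (2 * c)).add_const d
    refine HasDerivAt.congr_deriv this ?_
    simp
  · intro x y; rfl

lemma exp_deriv1 (k α m x : ℝ) (y : ℝ) :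
    HasDerivAt (fun t => k * (Real.exp (-α * (t ^ 2 + y ^ 2)) - m))
      (k * (-2 * α * x) * Real.exp (-α * (x ^ 2 + y ^ 2))) x := by
  have := ((((((hasDerivAt_id x).pow 2).add_const (y ^ 2)).const_mul (-α)).exp).sub_const m).const_mul k
  refine HasDerivAt.congr_deriv this ?_
  simp
  try ring

lemma exp_deriv2 (k α x : ℝ) (y : ℝ) :
    HasDerivAt (fun t => k * (-2 * α * t) * Real.exp (-α * (t ^ 2 + y ^ 2)))
      (k * (4 * α ^ 2 * x ^ 2 - 2 * α) * Real.exp (-α * (x ^ 2 + y ^ 2))) x := by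
  have h1 := (((((hasDerivAt_id x).pow 2).add_const (y ^ 2)).const_mul (-α)).exp)
  have h2 := ((hasDerivAt_id x).const_mul (-2 * α)).const_mul k
  have := h2.mul h1
  refine HasDerivAt.congr_deriv this ?_
  simp
  try ring

lemma HL_exp (k α m : ℝ) :
    HL (fun x y => k * (Real.exp (-α * (x ^ 2 + y ^ 2)) - m))
      (fun x y => k * (4 * α ^ 2 * (x ^ 2 + y ^ 2) - 4 * α) *
        Real.exp (-α * (x ^ 2 + y ^ 2))) := by
  refine ⟨by fun_prop, fun x y => k * (-2 * α * x) * Real.exp (-α * (x ^ 2 + y ^ 2)),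
    fun x y => k * (-2 * α * y) * Real.exp (-α * (x ^ 2 + y ^ 2)),
    fun x y => k * (4 * α ^ 2 * x ^ 2 - 2 * α) * Real.exp (-α * (x ^ 2 + y ^ 2)),
    fun x y => k * (4 * α ^ 2 * y ^ 2 - 2 * α) * Real.exp (-α * (x ^ 2 + y ^ 2)), ?_, ?_, ?_, ?_, ?_⟩
  · intro x y; exact exp_deriv1 k α m x y
  · intro x y
    have := exp_deriv1 k α m y x
    simpa only [add_comm (x ^ 2)] using this
  · intro x y; exact exp_deriv2 k α x y
  · intro x y
    have := exp_deriv2 k α y x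
    simpa only [add_comm (x ^ 2)] using this
  · intro x y; ring

/-- maximum principle on the plane -/
lemma max_principle {w L : ℝ → ℝ → ℝ} (h : HL w L) (B c : ℝ) (hc : 0 < c)
    (hB : ∀ x y, -B ≤ w x y) (hL : ∀ x y, w x y < 0 → L x y ≤ c * w x y) (x y : ℝ) :
    0 ≤ w x y := by
  by_contra hneg
  push Not at hneg
  set η := - w x y with hη
  have hη0 : 0 < η := by linarith
  have hS : 0 < x ^ 2 + y ^ 2 + 1 := by positivity
  obtain ⟨ε, hε, hε1, hε2⟩ : ∃ ε : ℝ, 0 < ε ∧ ε * (x ^ 2 + y ^ 2 + 1) ≤ η / 2 ∧ 4 * ε < c * (η / 2) := by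
    refine ⟨min (η / 2 / (x ^ 2 + y ^ 2 + 1)) (c * η / 16), by positivity, ?_, ?_⟩
    · rw [← le_div_iff₀ hS]; exact min_le_left _ _
    · have : min (η / 2 / (x ^ 2 + y ^ 2 + 1)) (c * η / 16) ≤ c * η / 16 := min_le_right _ _
      have : 0 < c * η := by positivity
      linarith
  have hg := h.add (HL_quad ε 0 ε 0)
  obtain ⟨R, hR1, hRx, hRy, hRB⟩ : ∃ R : ℝ, 1 ≤ R ∧ |x| ≤ R ∧ |y| ≤ R ∧ |B| / ε ≤ R :=
    ⟨1 + |x| + |y| + |B| / ε, by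
      have : 0 ≤ |B| / ε := by positivity
      have := abs_nonneg x
      have := abs_nonneg y
      refine ⟨?_, ?_, ?_, ?_⟩ <;> linarith⟩
  have hRB' : B ≤ ε * R := by
    rw [div_le_iff₀ hε] at hRB
    have := le_abs_self B
    linarith
  have hcomp : IsCompact (Icc (-R) R ×ˢ Icc (-R) R) := isCompact_Icc.prod isCompact_Icc
  have hmem : (x, y) ∈ Icc (-R) R ×ˢ Icc (-R) R := ⟨abs_le.mp hRx, abs_le.mp hRy⟩
  obtain ⟨⟨a, b⟩, hab, hmin⟩ := hcomp.exists_isMinOn ⟨_, hmem⟩ hg.1.continuousOn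
  have h1 := hmin hmem
  simp only [mem_ofPred_eq] at h1
  have hneg2 : w a b + ε * (a ^ 2 + b ^ 2) ≤ -(η / 2) := by
    have : ε * (x ^ 2 + y ^ 2) ≤ η / 2 := by nlinarith
    nlinarith
  have hRR : B ≤ ε * R ^ 2 := by
    have : R * 1 ≤ R * R := mul_le_mul_of_nonneg_left hR1 (by linarith)
    have : ε * R ≤ ε * R ^ 2 := mul_le_mul_of_nonneg_left (by nlinarith) hε.le
    linarith
  have hint : ∀ s : ℝ, s ∈ Icc (-R) R → (B ≤ ε * s ^ 2 → False) → s ∈ Ioo (-R) R := by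
    intro s hs hf
    refine ⟨lt_of_le_of_ne hs.1 ?_, lt_of_le_of_ne hs.2 ?_⟩
    · rintro rfl; apply hf; simpa using hRR
    · rintro rfl; exact hf hRR
  have ha : a ∈ Ioo (-R) R := hint a hab.1 (fun hf => by
    have := hB a b
    have : 0 ≤ ε * b ^ 2 := by positivity
    linarith)
  have hb : b ∈ Ioo (-R) R := hint b hab.2 (fun hf => by
    have := hB a b
    have : 0 ≤ ε * a ^ 2 := by positivity
    linarith)
  have htest := hg.min_test (prod_mem_nhds (Icc_mem_nhds ha.1 ha.2) (Icc_mem_nhds hb.1 hb.2))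
    (fun p hp => hmin hp)
  have hp : 0 ≤ ε * (a ^ 2 + b ^ 2) := by positivity
  have hw : w a b ≤ -(η / 2) := by linarith
  have := hL a b (by linarith)
  have : c * w a b ≤ c * (-(η / 2)) := mul_le_mul_of_nonneg_left hw hc.le
  linarith

/-- interior gradient type estimate: odd reflection and a quadratic barrier -/
lemma lip_aux {v L : ℝ → ℝ → ℝ} (h : HL v L) (B N : ℝ)
    (hB : ∀ x y x' y', v x y - v x' y' ≤ B) (hN : ∀ x y, |L x y| ≤ N) (t : ℝ)
    (ht0 : 0 ≤ t) (ht1 : t ≤ 1) (p q : ℝ) :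
    v p (q + t) - v p (q - t) ≤ (2 * B + (2 * N + 1)) * t := by
  have hN0 : 0 ≤ N := (abs_nonneg _).trans (hN 0 0)
  have hB0 : 0 ≤ B := by have := hB 0 0 0 0; linarith
  have h1 := h.trans p q
  have h2 := ((HL_quad B 0 (-B - (2 * N + 1) / 2) (2 * B + (2 * N + 1) / 2)).sub (h1.sub h1.reflect))
  have hcomp : IsCompact (Icc (-1 : ℝ) 1 ×ˢ Icc (0 : ℝ) 1) := isCompact_Icc.prod isCompact_Icc
  have hmem : ((0 : ℝ), t) ∈ Icc (-1 : ℝ) 1 ×ˢ Icc (0 : ℝ) 1 := ⟨by simp, ht0, ht1⟩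
  obtain ⟨⟨a, b⟩, ⟨ha, hb⟩, hmin⟩ := hcomp.exists_isMinOn ⟨_, hmem⟩ h2.1.continuousOn
  have h3 := hmin hmem
  simp only [mem_ofPred_eq] at h3
  simp only at ha hb
  have hDB := hB (a + p) (b + q) (a + p) (-b + q)
  have hfin : 0 ≤ B * a ^ 2 + 0 * a + ((-B - (2 * N + 1) / 2) * b ^ 2 +
      (2 * B + (2 * N + 1) / 2) * b) - (v (a + p) (b + q) - v (a + p) (-b + q)) := by
    have hb1 : 0 ≤ b * (1 - b) := mul_nonneg hb.1 (by linarith [hb.2])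
    have e : B * a ^ 2 + 0 * a + ((-B - (2 * N + 1) / 2) * b ^ 2 +
      (2 * B + (2 * N + 1) / 2) * b) = B * (a ^ 2 + b) + (B + (2 * N + 1) / 2) * (b * (1 - b)) := by ring
    have hq : 0 ≤ (B + (2 * N + 1) / 2) * (b * (1 - b)) := by positivity
    rw [e]
    have hbase : 1 ≤ a ^ 2 + b → B ≤ B * (a ^ 2 + b) := fun hh => by nlinarith
    rcases eq_or_lt_of_le hb.1 with hb0 | hb0
    · rw [← hb0]; simp; positivity
    rcases eq_or_lt_of_le hb.2 with hb2 | hb2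
    · have := hbase (by nlinarith); linarith
    rcases eq_or_lt_of_le ha.1 with ha0 | ha0
    · have := hbase (by rw [← ha0]; nlinarith); linarith
    rcases eq_or_lt_of_le ha.2 with ha2 | ha2
    · have := hbase (by rw [ha2]; nlinarith); linarith
    exfalso
    have htest := h2.min_test (prod_mem_nhds (Icc_mem_nhds ha0 ha2) (Icc_mem_nhds hb0 hb2))
      (fun p hp => hmin hp)
    have n1 := abs_le.mp (hN (a + p) (b + q))
    have n2 := abs_le.mp (hN (a + p) (-b + q))
    linarith [n1.1, n2.2]
  have h4 := hfin.trans h3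
  simp only [zero_add, add_comm t q, add_comm (-t) q, ← sub_eq_add_neg] at h4
  have : 0 ≤ (B + (2 * N + 1) / 2) * t ^ 2 := by positivity
  have : 0 ≤ N * t := by positivity
  nlinarith

lemma lip_y {v L : ℝ → ℝ → ℝ} (h : HL v L) (B N : ℝ)
    (hB : ∀ x y x' y', v x y - v x' y' ≤ B) (hN : ∀ x y, |L x y| ≤ N) (p q r : ℝ) :
    |v p q - v p r| ≤ (2 * B + (2 * N + 1)) * |q - r| := by
  have hN0 : 0 ≤ N := (abs_nonneg _).trans (hN 0 0)
  have hB0 : 0 ≤ B := by have := hB 0 0 0 0; linarith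
  have key : ∀ q r : ℝ, r ≤ q → |v p q - v p r| ≤ (2 * B + (2 * N + 1)) * (q - r) := by
    intro q r hqr
    have hneg : HL (fun x y => v x (-y)) (fun x y => L x (-y)) := h.reflect
    rcases le_or_gt ((q - r) / 2) 1 with h1 | h1
    · have e1 := lip_aux h B N hB hN ((q - r) / 2) (by linarith) h1 p ((q + r) / 2)
      have e2 := lip_aux hneg B N (fun x y x' y' => hB _ _ _ _) (fun x y => hN _ _)
        ((q - r) / 2) (by linarith) h1 p (-((q + r) / 2))
      rw [show (q + r) / 2 + (q - r) / 2 = q by ring, show (q + r) / 2 - (q - r) / 2 = r by ring] at e1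
      rw [show -(-((q + r) / 2) + (q - r) / 2) = r by ring,
        show -(-((q + r) / 2) - (q - r) / 2) = q by ring] at e2
      have : 0 ≤ (2 * B + (2 * N + 1)) * (q - r) := mul_nonneg (by linarith) (by linarith)
      rw [abs_le]; constructor <;> linarith
    · have a := hB p q p r
      have b := hB p r p q
      have : B ≤ (2 * B + (2 * N + 1)) * (q - r) := by nlinarith
      rw [abs_le]; constructor <;> linarith
  rcases le_total r q with hh | hh
  · rw [abs_of_nonneg (sub_nonneg.mpr hh)]; exact key q r hh
  · rw [abs_sub_comm, abs_sub_comm q r, abs_of_nonneg (sub_nonneg.mpr hh)]; exact key r q hh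

lemma lip_xy {v L : ℝ → ℝ → ℝ} (h : HL v L) (B N : ℝ)
    (hB : ∀ x y x' y', v x y - v x' y' ≤ B) (hN : ∀ x y, |L x y| ≤ N) (p q r s : ℝ) :
    |v p q - v r s| ≤ (2 * B + (2 * N + 1)) * (|p - r| + |q - s|) := by
  have a := lip_y h B N hB hN p q s
  have b := lip_y h.swap B N (fun _ _ _ _ => hB _ _ _ _) (fun _ _ => hN _ _) s p r
  calc |v p q - v r s| ≤ |v p q - v p s| + |v p s - v r s| := abs_sub_le _ _ _
    _ ≤ _ := by linarith

set_option maxHeartbeats 1000000 in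
/-- quantitative strong maximum principle -/
lemma strong_max (C K a R : ℝ) (hC : 0 ≤ C) (hK : 0 < K) (ha : 0 < a) (hR : 0 ≤ R) :
    ∃ κ > 0, ∀ w L : ℝ → ℝ → ℝ, HL w L → (∀ x y, 0 ≤ w x y) → (∀ x y, L x y ≤ C * w x y) →
      (∀ p q r s, |w p q - w r s| ≤ K * (|p - r| + |q - s|)) →
      ∀ x y p q, p ^ 2 + q ^ 2 ≤ R ^ 2 → a ≤ w (x + p) (y + q) → κ ≤ w x y := by
  -- on the ball of radius ρ, w ≥ a / 2
  set ρ := a / (4 * K) with hρ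
  have hρ0 : 0 < ρ := by positivity
  obtain ⟨α, hα, hα2⟩ : ∃ α : ℝ, 0 < α ∧ C < 4 * α ^ 2 * ρ ^ 2 - 4 * α := by
    refine ⟨(C + 2) / ρ ^ 2 + C + 1, by positivity, ?_⟩
    have h1 : ((C + 2) / ρ ^ 2 + C + 1) * ρ ^ 2 ≥ C + 2 := by
      have : (C + 2) / ρ ^ 2 * ρ ^ 2 = C + 2 := by field_simp
      have : 0 ≤ (C + 1) * ρ ^ 2 := by positivity
      nlinarith
    have h2 : ((C + 2) / ρ ^ 2 + C + 1) ≥ C + 1 := by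
      have : 0 ≤ (C + 2) / ρ ^ 2 := by positivity
      linarith
    set α := (C + 2) / ρ ^ 2 + C + 1
    have : α * (α * ρ ^ 2) ≥ α * (C + 2) := mul_le_mul_of_nonneg_left h1 (by linarith)
    nlinarith
  have hexp : Real.exp (-α * (R + 1) ^ 2) < Real.exp (-α * R ^ 2) := by
    apply Real.exp_lt_exp.mpr; nlinarith
  refine ⟨a / 2 * (Real.exp (-α * R ^ 2) - Real.exp (-α * (R + 1) ^ 2)),
    mul_pos (by positivity) (by linarith), ?_⟩
  intro w L h hw hL hlip x y p q hpq hwa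
  set m := Real.exp (-α * (R + 1) ^ 2) with hm
  have hm0 : 0 < m := Real.exp_pos _
  have h1 := (h.trans (x + p) (y + q)).sub (HL_exp (a / 2) α m)
  have hcomp : IsCompact (Icc (-(R + 1)) (R + 1) ×ˢ Icc (-(R + 1)) (R + 1)) :=
    isCompact_Icc.prod isCompact_Icc
  have hmem : (-p, -q) ∈ Icc (-(R + 1)) (R + 1) ×ˢ Icc (-(R + 1)) (R + 1) := by
    have hp : |p| ≤ R := abs_le_of_sq_le_sq (by nlinarith) hR
    have hq : |q| ≤ R := abs_le_of_sq_le_sq (by nlinarith) hR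
    rw [abs_le] at hp hq
    refine ⟨⟨?_, ?_⟩, ⟨?_, ?_⟩⟩ <;> simp only <;> linarith
  obtain ⟨⟨b, d⟩, ⟨hb, hd⟩, hmin⟩ := hcomp.exists_isMinOn ⟨_, hmem⟩ h1.1.continuousOn
  have h3 := hmin hmem
  simp only [mem_ofPred_eq] at h3
  simp only at hb hd
  have hfin : 0 ≤ w (b + (x + p)) (d + (y + q)) - a / 2 * (Real.exp (-α * (b ^ 2 + d ^ 2)) - m) := by
    have hout : (R + 1) ^ 2 ≤ b ^ 2 + d ^ 2 → 0 ≤ w (b + (x + p)) (d + (y + q)) -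
        a / 2 * (Real.exp (-α * (b ^ 2 + d ^ 2)) - m) := by
      intro hh
      have : Real.exp (-α * (b ^ 2 + d ^ 2)) ≤ m := Real.exp_le_exp.mpr (by
        have := mul_le_mul_of_nonneg_left hh hα.le
        linarith)
      have := hw (b + (x + p)) (d + (y + q))
      nlinarith
    rcases eq_or_lt_of_le hb.1 with hb0 | hb0
    · apply hout; rw [← hb0]; nlinarith
    rcases eq_or_lt_of_le hb.2 with hb2 | hb2
    · apply hout; rw [hb2]; nlinarith
    rcases eq_or_lt_of_le hd.1 with hd0 | hd0
    · apply hout; rw [← hd0]; nlinarith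
    rcases eq_or_lt_of_le hd.2 with hd2 | hd2
    · apply hout; rw [hd2]; nlinarith
    rcases le_or_gt (b ^ 2 + d ^ 2) (ρ ^ 2) with hin | hin
    · have hb' : |b| ≤ ρ := abs_le_of_sq_le_sq (by nlinarith) hρ0.le
      have hd' : |d| ≤ ρ := abs_le_of_sq_le_sq (by nlinarith) hρ0.le
      have := hlip (x + p) (y + q) (b + (x + p)) (d + (y + q))
      rw [show x + p - (b + (x + p)) = -b by ring, show y + q - (d + (y + q)) = -d by ring,
        abs_neg, abs_neg] at this
      have h5 : K * (|b| + |d|) ≤ K * (2 * ρ) := mul_le_mul_of_nonneg_left (by linarith) hK.le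
      have h6 : K * (2 * ρ) = a / 2 := by rw [hρ]; field_simp; norm_num
      have h7 : Real.exp (-α * (b ^ 2 + d ^ 2)) ≤ 1 := by
        apply Real.exp_le_one_iff.mpr
        have : 0 ≤ α * (b ^ 2 + d ^ 2) := by positivity
        linarith
      have := (abs_le.mp this).2
      nlinarith
    by_contra hneg
    push Not at hneg
    have htest := h1.min_test (prod_mem_nhds (Icc_mem_nhds hb0 hb2) (Icc_mem_nhds hd0 hd2))
      (fun p hp => hmin hp)
    have hLL := hL (b + (x + p)) (d + (y + q))
    set E := Real.exp (-α * (b ^ 2 + d ^ 2)) with hE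
    have hE0 : 0 < E := Real.exp_pos _
    have h8 : C ≤ 4 * α ^ 2 * (b ^ 2 + d ^ 2) - 4 * α := by
      have : 4 * α ^ 2 * ρ ^ 2 ≤ 4 * α ^ 2 * (b ^ 2 + d ^ 2) :=
        mul_le_mul_of_nonneg_left hin.le (by positivity)
      linarith
    have h9 : C < 4 * α ^ 2 * (b ^ 2 + d ^ 2) - 4 * α := by
      have : 4 * α ^ 2 * ρ ^ 2 ≤ 4 * α ^ 2 * (b ^ 2 + d ^ 2) :=
        mul_le_mul_of_nonneg_left hin.le (by positivity)
      linarith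
    have h10 : a / 2 * C * E < a / 2 * (4 * α ^ 2 * (b ^ 2 + d ^ 2) - 4 * α) * E := by
      apply mul_lt_mul_of_pos_right _ hE0
      exact mul_lt_mul_of_pos_left h9 (by positivity)
    have h11 : C * w (b + (x + p)) (d + (y + q)) ≤ C * (a / 2 * (E - m)) :=
      mul_le_mul_of_nonneg_left (by linarith) hC
    have h12 : 0 ≤ C * (a / 2) * m := by positivity
    linarith
  have h4 := hfin.trans h3
  rw [show -p + (x + p) = x by ring, show -q + (y + q) = y by ring] at h4
  have : Real.exp (-α * R ^ 2) ≤ Real.exp (-α * ((-p) ^ 2 + (-q) ^ 2)) := by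
    apply Real.exp_le_exp.mpr
    have := mul_le_mul_of_nonneg_left hpq hα.le
    linarith
  have h13 := mul_le_mul_of_nonneg_left this (show 0 ≤ a / 2 by positivity)
  linarith

/-- comparison of `v` with a translate, given the order on the strip `|x| < M` -/
lemma compare_translate {f : ℝ → ℝ} {v : ℝ → ℝ → ℝ} {μm μp δ c M : ℝ}
    (h : HL v (fun x y => f (v x y)))
    (hm : ∀ x y, μm ≤ v x y) (hp : ∀ x y, v x y ≤ μp) (hc : 0 < c)
    (hbm : ∀ a b, μm ≤ a → a ≤ b → b ≤ μm + δ → c * (b - a) ≤ f b - f a)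
    (hbp : ∀ a b, μp - δ ≤ a → a ≤ b → b ≤ μp → c * (b - a) ≤ f b - f a)
    (hMp : ∀ x y, M ≤ x → μp - δ ≤ v x y) (hMm : ∀ x y, x ≤ -M → v x y ≤ μm + δ)
    (s t : ℝ) (hs : 0 ≤ s)
    (hstrip : ∀ x y, -M < x → x < M → v (x + s) (y + t) - v x y < 0 → μp - δ ≤ v (x + s) (y + t))
    (x y : ℝ) : v x y ≤ v (x + s) (y + t) := by
  have h1 := (h.trans s t).sub h
  have := max_principle h1 (μp - μm) c hc
    (fun x y => by have := hm (x + s) (y + t); have := hp x y; linarith)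
    (fun x y hneg => by
      rcases le_or_gt x (-M) with hx | hx
      · have := hbm (v (x + s) (y + t)) (v x y) (hm _ _) (by linarith) (hMm x y hx)
        linarith
      · have htop : μp - δ ≤ v (x + s) (y + t) := by
          rcases lt_or_ge x M with hx2 | hx2
          · exact hstrip x y hx hx2 hneg
          · exact hMp _ _ (by linarith)
        have := hbp (v (x + s) (y + t)) (v x y) htop (by linarith) (hp _ _)
        linarith) x y
  linarith

/-- uniform positivity of the increment on the strip -/
lemma strip_pos {f : ℝ → ℝ} {v : ℝ → ℝ → ℝ} {μm μp δ C N M : ℝ}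
    (h : HL v (fun x y => f (v x y)))
    (hm : ∀ x y, μm ≤ v x y) (hp : ∀ x y, v x y ≤ μp) (hC : 0 ≤ C)
    (hlip : ∀ a b, μm ≤ a → a ≤ b → b ≤ μp → f b - f a ≤ C * (b - a))
    (hN : ∀ x y, |f (v x y)| ≤ N) (hδ : 2 * δ < μp - μm)
    (hMp : ∀ x y, M ≤ x → μp - δ ≤ v x y) (hMm : ∀ x y, x ≤ -M → v x y ≤ μm + δ)
    (s t : ℝ) (hs : 0 < s) (hP : ∀ x y, v x y ≤ v (x + s) (y + t)) :
    ∃ κ > 0, ∀ x y, -M ≤ x → x ≤ M → κ ≤ v (x + s) (y + t) - v x y := by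
  obtain ⟨n₀, hn₀⟩ := exists_nat_ge (2 * M / s)
  obtain ⟨n, hn1, hn⟩ : ∃ n : ℕ, 1 ≤ n ∧ 2 * M ≤ n * s := by
    refine ⟨n₀ + 1, by omega, ?_⟩
    rw [div_le_iff₀ hs] at hn₀
    push_cast
    linarith
  have hB : ∀ x y x' y', v x y - v x' y' ≤ μp - μm := fun x y x' y' => by
    have := hp x y; have := hm x' y'; linarith
  have hK := lip_xy h (μp - μm) N hB hN
  have hN0 : 0 ≤ N := (abs_nonneg _).trans (hN 0 0)
  have hB0 : 0 ≤ μp - μm := by have := hB 0 0 0 0; linarith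
  set K := 2 * (μp - μm) + (2 * N + 1) with hKdef
  have hK0 : 0 < K := by rw [hKdef]; linarith
  have hnpos : (0 : ℝ) < n := by exact_mod_cast hn1
  set a := (μp - μm - 2 * δ) / (2 * n) with hadef
  have ha : 0 < a := div_pos (by linarith) (by positivity)
  obtain ⟨κ, hκ, hmain⟩ := strong_max C (2 * K) a (n * (|s| + |t|)) hC (by positivity) ha (by positivity)
  refine ⟨κ, hκ, fun x y hx1 hx2 => ?_⟩
  set z : ℕ → ℝ := fun k => v (x + ((k : ℝ) - n) * s) (y + ((k : ℝ) - n) * t) with hz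
  have hsum : ∑ k ∈ Finset.range (2 * n), (z (k + 1) - z k) = z (2 * n) - z 0 :=
    Finset.sum_range_sub z (2 * n)
  have hz2 : μp - δ ≤ z (2 * n) := by
    apply hMp; push_cast; nlinarith
  have hz0 : z 0 ≤ μm + δ := by
    apply hMm; push_cast; nlinarith
  obtain ⟨k, hk, hka⟩ : ∃ k ∈ Finset.range (2 * n), a ≤ z (k + 1) - z k := by
    apply Finset.exists_le_of_sum_le (f := fun _ => a)
    · exact ⟨0, by simp; omega⟩
    · rw [hsum]
      simp only [Finset.sum_const, Finset.card_range, nsmul_eq_mul]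
      push_cast
      have : 2 * (n : ℝ) * a = μp - μm - 2 * δ := by rw [hadef]; field_simp
      linarith
  have hk' : k < 2 * n := Finset.mem_range.mp hk
  have hkn : |(k : ℝ) - n| ≤ n := by
    have : (k : ℝ) ≤ 2 * n := by exact_mod_cast hk'.le
    have : (0 : ℝ) ≤ k := by positivity
    rw [abs_le]; constructor <;> linarith
  refine hmain (fun x y => v (x + s) (y + t) - v x y) _ ((h.trans s t).sub h)
    (fun x y => sub_nonneg.mpr (hP x y)) (fun x y => hlip _ _ (hm _ _) (hP x y) (hp _ _)) ?_
    x y (((k : ℝ) - n) * s) (((k : ℝ) - n) * t) ?_ ?_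
  · intro p q r w
    have e1 := hK (p + s) (q + t) (r + s) (w + t)
    have e2 := hK p q r w
    rw [add_sub_add_right_eq_sub, add_sub_add_right_eq_sub] at e1
    rw [abs_le] at *
    constructor <;> linarith [e1.1, e1.2, e2.1, e2.2]
  · have e : (((k : ℝ) - n) * s) ^ 2 + (((k : ℝ) - n) * t) ^ 2
        = |(k : ℝ) - n| ^ 2 * (|s| ^ 2 + |t| ^ 2) := by simp only [sq_abs]; ring
    rw [e, mul_pow]
    gcongr
    nlinarith [abs_nonneg s, abs_nonneg t]
  · convert hka using 2
    simp only [hz]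
    push_cast
    congr 1 <;> ring

lemma sliding {f : ℝ → ℝ} {v : ℝ → ℝ → ℝ} {μm μp δ c C N M : ℝ}
    (h : HL v (fun x y => f (v x y)))
    (hm : ∀ x y, μm ≤ v x y) (hp : ∀ x y, v x y ≤ μp) (hc : 0 < c) (hC : 0 ≤ C) (hM : 0 ≤ M)
    (hbm : ∀ a b, μm ≤ a → a ≤ b → b ≤ μm + δ → c * (b - a) ≤ f b - f a)
    (hbp : ∀ a b, μp - δ ≤ a → a ≤ b → b ≤ μp → c * (b - a) ≤ f b - f a)
    (hlip : ∀ a b, μm ≤ a → a ≤ b → b ≤ μp → f b - f a ≤ C * (b - a))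
    (hN : ∀ x y, |f (v x y)| ≤ N) (hδ : 2 * δ < μp - μm)
    (hMp : ∀ x y, M ≤ x → μp - δ ≤ v x y) (hMm : ∀ x y, x ≤ -M → v x y ≤ μm + δ)
    (t s : ℝ) (hs : 0 < s) (x y : ℝ) : v x y ≤ v (x + s) (y + t) := by
  by_contra hcon
  set P : ℝ → Prop := fun σ => ∀ x y, v x y ≤ v (x + σ) (y + t) with hPdef
  have hlarge : ∀ σ, 2 * M ≤ σ → P σ := by
    intro σ hσ
    exact compare_translate h hm hp hc hbm hbp hMp hMm σ t (by linarith)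
      (fun x y h1 h2 _ => hMp _ _ (by linarith))
  set S : Set ℝ := {σ | ¬ P σ} with hS
  have hsS : s ∈ S := fun hP => hcon (hP x y)
  have hbdd : BddAbove S := ⟨2 * M, fun σ hσ => by
    by_contra hh; push Not at hh; exact hσ (hlarge σ hh.le)⟩
  set s' := sSup S with hs'
  have hss' : s ≤ s' := le_csSup hbdd hsS
  have hgt : ∀ σ, s' < σ → P σ := fun σ hσ => by
    by_contra hh; exact absurd (le_csSup hbdd hh) (not_le.mpr hσ)
  have hPs' : P s' := by
    intro x y
    have hcont : Continuous (fun σ : ℝ => v (x + σ) (y + t)) :=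
      h.1.comp (f := fun σ : ℝ => (x + σ, y + t)) (by fun_prop)
    have htend : Tendsto (fun σ : ℝ => v (x + σ) (y + t)) (nhdsWithin s' (Ioi s'))
        (nhds (v (x + s') (y + t))) := (hcont.tendsto s').mono_left nhdsWithin_le_nhds
    refine ge_of_tendsto htend ?_
    filter_upwards [self_mem_nhdsWithin] with σ hσ
    exact hgt σ hσ x y
  obtain ⟨κ, hκ, hstrip⟩ := strip_pos h hm hp hC hlip hN hδ hMp hMm s' t (by linarith) hPs'
  have hB : ∀ x y x' y', v x y - v x' y' ≤ μp - μm := fun x y x' y' => by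
    have := hp x y; have := hm x' y'; linarith
  have hK := lip_xy h (μp - μm) N hB hN
  have hN0 : 0 ≤ N := (abs_nonneg _).trans (hN 0 0)
  have hB0 : 0 ≤ μp - μm := by have := hB 0 0 0 0; linarith
  set K := 2 * (μp - μm) + (2 * N + 1) with hKdef
  have hK0 : 0 < K := by rw [hKdef]; linarith
  set ε := min s (κ / K) with hε
  have hε0 : 0 < ε := lt_min hs (by positivity)
  have hεs : ε ≤ s := min_le_left _ _
  have hεκ : K * ε ≤ κ := by
    have : ε ≤ κ / K := min_le_right _ _
    rw [le_div_iff₀ hK0] at this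
    linarith
  have hlow : ∀ σ, s' - ε ≤ σ → σ ≤ s' → P σ := by
    intro σ h1 h2
    refine compare_translate h hm hp hc hbm hbp hMp hMm σ t (by linarith) ?_
    intro x y hx1 hx2 hneg
    exfalso
    have e1 := hstrip x y hx1.le hx2.le
    have e2 := hK (x + s') (y + t) (x + σ) (y + t)
    rw [add_sub_add_left_eq_sub, sub_self, abs_zero, add_zero,
      abs_of_nonneg (sub_nonneg.mpr h2)] at e2
    have e3 : K * (s' - σ) ≤ K * ε := mul_le_mul_of_nonneg_left (by linarith) hK0.le
    have := (abs_le.mp e2).2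
    linarith
  obtain ⟨σ, hσS, hσ⟩ := exists_lt_of_lt_csSup ⟨s, hsS⟩ (show s' - ε < sSup S by rw [← hs']; linarith)
  exact hσS (hlow σ hσ.le (le_csSup hbdd hσS))

lemma band_lemma (f : ℝ → ℝ) (hf : ContDiff ℝ 1 f) (μ : ℝ) (hpos : 0 < deriv f μ) :
    ∃ r > 0, ∀ a b, μ - r ≤ a → a ≤ b → b ≤ μ + r → deriv f μ / 2 * (b - a) ≤ f b - f a := by
  have hcont : Continuous (deriv f) := hf.continuous_deriv le_rfl
  have hev : ∀ᶠ x in nhds μ, deriv f μ / 2 < deriv f x :=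
    (hcont.tendsto μ).eventually_const_lt (by linarith)
  obtain ⟨r, hr, hball⟩ := Metric.eventually_nhds_iff.mp hev
  refine ⟨r / 2, by positivity, fun a b h1 h2 h3 => ?_⟩
  refine (convex_Icc a b).mul_sub_le_image_sub_of_le_deriv hf.continuous.continuousOn
    (hf.differentiable (by norm_num)).differentiableOn ?_ a (left_mem_Icc.mpr h2) b
    (right_mem_Icc.mpr h2) h2
  intro x hx
  rw [interior_Icc] at hx
  apply le_of_lt
  apply hball
  rw [Real.dist_eq, abs_lt]
  constructor <;> linarith [hx.1, hx.2]

lemma vec_eq (x y : ℝ) : (!₂[x, y] : EuclideanSpace ℝ (Fin 2)) =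
    x • EuclideanSpace.single 0 1 + y • EuclideanSpace.single 1 1 := by
  ext i
  fin_cases i <;> simp

lemma curve0 (x y : ℝ) : HasDerivAt (fun t : ℝ => (!₂[t, y] : EuclideanSpace ℝ (Fin 2)))
    (EuclideanSpace.single 0 1) x := by
  simp only [vec_eq]
  have := ((hasDerivAt_id x).smul_const (EuclideanSpace.single 0 1 : EuclideanSpace ℝ (Fin 2))).add_const
    (y • (EuclideanSpace.single 1 1 : EuclideanSpace ℝ (Fin 2)))
  rw [one_smul] at this
  exact this

lemma curve1 (x y : ℝ) : HasDerivAt (fun t : ℝ => (!₂[x, t] : EuclideanSpace ℝ (Fin 2)))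
    (EuclideanSpace.single 1 1) y := by
  simp only [vec_eq]
  have := ((hasDerivAt_id y).smul_const (EuclideanSpace.single 1 1 : EuclideanSpace ℝ (Fin 2))).const_add
    (x • (EuclideanSpace.single 0 1 : EuclideanSpace ℝ (Fin 2)))
  rw [one_smul] at this
  exact this

theorem HL_of_contDiff (u : EuclideanSpace ℝ (Fin 2) → ℝ) (hu : ContDiff ℝ 2 u) :
    HL (fun x y => u !₂[x, y]) (fun x y => lap u !₂[x, y]) := by
  have hd : Differentiable ℝ u := hu.differentiable (by norm_num)
  have hd2 : ∀ e : EuclideanSpace ℝ (Fin 2), Differentiable ℝ (fun y => fderiv ℝ u y e) := by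
    intro e
    have h1 : ContDiff ℝ 1 (fderiv ℝ u) := hu.fderiv_right (by norm_num)
    have h2 : ContDiff ℝ 1 (fun y => fderiv ℝ u y e) := h1.clm_apply contDiff_const
    exact h2.differentiable (by norm_num)
  refine ⟨hu.continuous.comp (f := fun p : ℝ × ℝ => (!₂[p.1, p.2] : EuclideanSpace ℝ (Fin 2)))
      (by fun_prop),
    fun x y => fderiv ℝ u !₂[x, y] (EuclideanSpace.single 0 1),
    fun x y => fderiv ℝ u !₂[x, y] (EuclideanSpace.single 1 1),
    fun x y => fderiv ℝ (fun y => fderiv ℝ u y (EuclideanSpace.single 0 1)) !₂[x, y]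
      (EuclideanSpace.single 0 1),
    fun x y => fderiv ℝ (fun y => fderiv ℝ u y (EuclideanSpace.single 1 1)) !₂[x, y]
      (EuclideanSpace.single 1 1), ?_, ?_, ?_, ?_, ?_⟩
  · intro x y
    exact (hd !₂[x, y]).hasFDerivAt.comp_hasDerivAt x (curve0 x y)
  · intro x y
    exact (hd !₂[x, y]).hasFDerivAt.comp_hasDerivAt y (curve1 x y)
  · intro x y
    exact (hd2 (EuclideanSpace.single 0 1) !₂[x, y]).hasFDerivAt.comp_hasDerivAt x (curve0 x y)
  · intro x y
    exact (hd2 (EuclideanSpace.single 1 1) !₂[x, y]).hasFDerivAt.comp_hasDerivAt y (curve1 x y)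
  · intro x y
    simp [lap, Fin.sum_univ_two]

theorem stmt19 (W : ℝ → ℝ) (μm μp : ℝ) (hμ : μm < μp)
    (hW : ContDiff ℝ 2 W) (hWnn : ∀ t : ℝ, 0 ≤ W t)
    (hWpos : ∀ t ∈ Set.Ioo μm μp, 0 < W t)
    (hWm : W μm = 0) (hWp : W μp = 0)
    (hW''m : 0 < deriv (deriv W) μm) (hW''p : 0 < deriv (deriv W) μp)
    (u : EuclideanSpace ℝ (Fin 2) → ℝ) (hu : ContDiff ℝ 2 u)
    (heq : ∀ x, lap u x = deriv W (u x))
    (hbd : ∀ x, μm ≤ u x ∧ u x ≤ μp)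
    -- `u(x₁, x₂) → μ₊` uniformly in `x₂` as `x₁ → +∞`, and `→ μ₋` as `x₁ → −∞`
    (hlim : ∀ δ > (0:ℝ), ∃ M : ℝ,
      (∀ x : EuclideanSpace ℝ (Fin 2), M < x 0 → |u x - μp| < δ) ∧
      (∀ x : EuclideanSpace ℝ (Fin 2), x 0 < -M → |u x - μm| < δ)) :
    -- Gibbons' conjecture in two dimensions: `u` is one-dimensional
    ∃ U : ℝ → ℝ, ContDiff ℝ 2 U ∧
      (∀ x : EuclideanSpace ℝ (Fin 2), u x = U (x 0)) ∧
      (∀ s : ℝ, deriv (deriv U) s = deriv W (U s)) ∧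
      Filter.Tendsto U Filter.atTop (nhds μp) ∧
      Filter.Tendsto U Filter.atBot (nhds μm) := by
  set f := deriv W with hf
  have hf1 : ContDiff ℝ 1 f := by
    have : ContDiff ℝ (1 + 1) W := by simpa [one_add_one_eq_two] using hW
    exact (contDiff_succ_iff_deriv.mp this).2.2
  have hv := HL_of_contDiff u hu
  have hvL : (fun x y => lap u !₂[x, y]) = fun x y => f ((fun x y => u !₂[x, y]) x y) := by
    funext x y; exact heq _
  rw [hvL] at hv
  obtain ⟨r1, hr1, hb1⟩ := band_lemma f hf1 μm hW''m
  obtain ⟨r2, hr2, hb2⟩ := band_lemma f hf1 μp hW''p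
  obtain ⟨δ, hδ0, hδ1, hδ2, hδ3⟩ : ∃ δ : ℝ, 0 < δ ∧ δ ≤ r1 ∧ δ ≤ r2 ∧ 2 * δ < μp - μm := by
    refine ⟨min (min r1 r2) ((μp - μm) / 3), lt_min (lt_min hr1 hr2) (by linarith),
      (min_le_left _ _).trans (min_le_left _ _), (min_le_left _ _).trans (min_le_right _ _), ?_⟩
    have := min_le_right (min r1 r2) ((μp - μm) / 3)
    linarith
  obtain ⟨M₀, hM1, hM2⟩ := hlim δ hδ0
  have hcontd : Continuous (deriv f) := hf1.continuous_deriv le_rfl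
  obtain ⟨C₀, hC₀⟩ := (isCompact_Icc (a := μm) (b := μp)).exists_bound_of_continuousOn
    hcontd.continuousOn
  obtain ⟨N, hN⟩ := (isCompact_Icc (a := μm) (b := μp)).exists_bound_of_continuousOn
    hf1.continuous.continuousOn
  have hC₀0 : 0 ≤ C₀ := (norm_nonneg _).trans (hC₀ μm (left_mem_Icc.mpr hμ.le))
  set c := min (deriv f μm / 2) (deriv f μp / 2) with hc
  have hc0 : 0 < c := lt_min (by linarith) (by linarith)
  have hslide : ∀ t s : ℝ, 0 < s → ∀ x y : ℝ, u !₂[x, y] ≤ u !₂[x + s, y + t] := by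
    intro t s hs x y
    refine sliding (δ := δ) (c := c) (C := C₀) (N := N) (M := |M₀| + 1) hv (μm := μm) (μp := μp)
      (fun x y => (hbd _).1) (fun x y => (hbd _).2) hc0 hC₀0 (by positivity) ?_ ?_ ?_
      (fun x y => hN _ (hbd _)) hδ3 ?_ ?_ t s hs x y
    · intro a b h1 h2 h3
      have e1 := hb1 a b (by linarith) h2 (by linarith)
      have e2 : c * (b - a) ≤ deriv f μm / 2 * (b - a) :=
        mul_le_mul_of_nonneg_right (min_le_left _ _) (by linarith)
      linarith
    · intro a b h1 h2 h3
      have e1 := hb2 a b (by linarith) h2 (by linarith)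
      have e2 : c * (b - a) ≤ deriv f μp / 2 * (b - a) :=
        mul_le_mul_of_nonneg_right (min_le_right _ _) (by linarith)
      linarith
    · intro a b h1 h2 h3
      refine (convex_Icc a b).image_sub_le_mul_sub_of_deriv_le hf1.continuous.continuousOn
        (hf1.differentiable (by norm_num)).differentiableOn ?_ a (left_mem_Icc.mpr h2) b
        (right_mem_Icc.mpr h2) h2
      intro x hx
      rw [interior_Icc] at hx
      exact (le_abs_self _).trans (hC₀ x ⟨by linarith [hx.1], by linarith [hx.2]⟩)
    · intro x y hx
      have := hM1 !₂[x, y] (by simp; linarith [le_abs_self M₀])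
      linarith [(abs_lt.mp this).1]
    · intro x y hx
      have := hM2 !₂[x, y] (by simp; linarith [le_abs_self M₀])
      linarith [(abs_lt.mp this).2]
  have hle : ∀ t x y : ℝ, u !₂[x, y] ≤ u !₂[x, y + t] := by
    intro t x y
    have hcont : Continuous (fun s : ℝ => u !₂[x + s, y + t]) :=
      hu.continuous.comp (by fun_prop)
    have htend : Tendsto (fun s : ℝ => u !₂[x + s, y + t]) (nhdsWithin 0 (Ioi 0))
        (nhds (u !₂[x + 0, y + t])) := (hcont.tendsto 0).mono_left nhdsWithin_le_nhds
    rw [add_zero] at htend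
    refine ge_of_tendsto htend ?_
    filter_upwards [self_mem_nhdsWithin] with s hs
    exact hslide t s hs x y
  have hconst : ∀ x y : ℝ, u !₂[x, y] = u !₂[x, 0] := by
    intro x y
    apply le_antisymm
    · have := hle (-y) x y
      simpa using this
    · have := hle y x 0
      simpa using this
  have hcurve : ContDiff ℝ 2 (fun s : ℝ => (!₂[s, 0] : EuclideanSpace ℝ (Fin 2))) := by
    simp only [vec_eq]
    exact (contDiff_id.smul contDiff_const).add contDiff_const
  refine ⟨fun s => u !₂[s, 0], hu.comp hcurve, ?_, ?_, ?_, ?_⟩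
  · intro x
    refine Eq.trans ?_ (hconst (x 0) (x 1))
    congr 1
    ext i
    fin_cases i <;> simp
  · intro s
    obtain ⟨-, vx, vy, vxx, vyy, h1, h2, h3, h4, h5⟩ := hv
    have e1 : deriv (fun s => u !₂[s, 0]) = fun s => vx s 0 := funext fun s => (h1 s 0).deriv
    have e2 : ∀ y, vy s y = 0 := by
      intro y
      rw [← (h2 s y).deriv]
      have : (fun t => u !₂[s, t]) = fun _ => u !₂[s, 0] := funext fun t => hconst s t
      simp only [this, deriv_const]
    have e3 : vyy s 0 = 0 := by
      rw [← (h4 s 0).deriv]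
      simp only [e2, deriv_const]
    rw [e1, (h3 s 0).deriv]
    have := h5 s 0
    simp only [e3, add_zero] at this
    exact this.symm
  · rw [Metric.tendsto_atTop]
    intro ε hε
    obtain ⟨M, hM, -⟩ := hlim ε hε
    refine ⟨M + 1, fun s hs => ?_⟩
    exact hM _ (by simp; linarith)
  · rw [Metric.tendsto_nhds]
    intro ε hε
    obtain ⟨M, -, hM⟩ := hlim ε hε
    filter_upwards [eventually_lt_atBot (-M)] with s hs
    exact hM _ (by simpa using hs)
end
end
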